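/- Let n ≥ 4, let M be a closed connected topological n-manifold, and let f : M → M be a regular homeomorphism. Let σ be a saddle periodic point of f of Morse index n−1 such that W^u_σ ∩ W^s_q = ∅ for every saddle periodic point q ≠ σ. Then there exists a unique sink periodic point ω such that the closure of W^u_σ equals W^u_σ ∪ {ω}, and the set S_σ = W^u_σ ∪ {ω} is a locally flat (n−1)-dimensional sphere in M: S_σ is homeomorphic to the standard sphere S^{n−1} and S_σ is a locally flat (n−1)-dimensional submanifold of M. -/

import Mathlib

open Filter Topology

/-- `M` is a topological `n`-manifold without boundary: every point has an open
neighbourhood homeomorphic to `ℝⁿ`. -/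
def IsChartedEuclidean (n : ℕ) (M : Type*) [TopologicalSpace M] : Prop :=
  ∀ x : M, ∃ U : Set M, IsOpen U ∧ x ∈ U ∧ Nonempty (U ≃ₜ EuclideanSpace ℝ (Fin n))

/-- An `ε`-chain of the map `f` from `x` to `y`. -/
def IsEpsChain {M : Type*} [PseudoMetricSpace M] (f : M → M) (ε : ℝ) (x y : M) : Prop :=
  ∃ k : ℕ, 0 < k ∧ ∃ (c : Fin (k + 1) → M) (m : Fin k → ℕ),
    c 0 = x ∧ c (Fin.last k) = y ∧ (∀ i, 1 ≤ m i) ∧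
    ∀ i : Fin k, dist (f^[m i] (c i.castSucc)) (c i.succ) < ε

/-- A point is chain recurrent for `f` if for every `ε > 0` there is an `ε`-chain
from the point to itself. -/
def ChainRecurrent {M : Type*} [PseudoMetricSpace M] (f : M → M) (x : M) : Prop :=
  ∀ ε : ℝ, 0 < ε → IsEpsChain f ε x x

/-- The chain recurrent set of `f`. -/
def chainRecurrentSet {M : Type*} [PseudoMetricSpace M] (f : M → M) : Set M :=
  {x | ChainRecurrent f x}

/-- The canonical hyperbolic model map `a_{i,δu,δs} : ℝⁿ → ℝⁿ`,
`a(x₁,…,xₙ) = (2δu·x₁, 2x₂, …, 2x_i, (δs/2)·x_{i+1}, x_{i+2}/2, …, xₙ/2)`. -/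
noncomputable def modelMap (n i : ℕ) (δu δs : ℝ) :
    EuclideanSpace ℝ (Fin n) → EuclideanSpace ℝ (Fin n) :=
  fun x => WithLp.toLp 2 fun j =>
    if (j : ℕ) < i then (if (j : ℕ) = 0 then 2 * δu else 2) * x j
    else (if (j : ℕ) = i then δs / 2 else 1 / 2) * x j

/-- A point `p` is a topologically hyperbolic periodic point of the homeomorphism `f`
with Morse index `i`: `p` is periodic of some least period `m` and `f^m` is conjugate,
in a neighbourhood of `p`, to the model map `a_{i,δu,δs}` on `ℝⁿ`. -/
def TopHyperbolic {M : Type*} [MetricSpace M] (n : ℕ) (f : M ≃ₜ M) (p : M) (i : ℕ) : Prop :=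
  ∃ m : ℕ, 0 < m ∧ Function.IsPeriodicPt (⇑f) m p ∧ Function.minimalPeriod (⇑f) p = m ∧
    ∃ δu δs : ℝ, (δu = 1 ∨ δu = -1) ∧ (δs = 1 ∨ δs = -1) ∧
      ∃ (U : Set M) (_ : IsOpen U) (_ : p ∈ U) (h : U ≃ₜ EuclideanSpace ℝ (Fin n)),
        ∀ x : U, (⇑f)^[m] (x : M) = ((h.symm (modelMap n i δu δs (h x)) : U) : M)

/-- A homeomorphism is regular if its chain recurrent set is finite and consists of
topologically hyperbolic periodic points (of some Morse index `i ∈ {0,…,n}`). -/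
def RegularHomeo {M : Type*} [MetricSpace M] (n : ℕ) (f : M ≃ₜ M) : Prop :=
  (chainRecurrentSet (⇑f)).Finite ∧
    ∀ p ∈ chainRecurrentSet (⇑f), ∃ i ≤ n, TopHyperbolic n f p i

/-- The stable manifold `W^s_p = {q : f^{km}(q) → p, k → +∞}`, `m` the least period. -/
def stableSet {M : Type*} [MetricSpace M] (f : M ≃ₜ M) (p : M) : Set M :=
  {q | Tendsto (fun k : ℕ => (⇑f)^[k * Function.minimalPeriod (⇑f) p] q) atTop (𝓝 p)}

/-- The unstable manifold `W^u_p = {q : f^{-km}(q) → p, k → +∞}`, `m` the least period. -/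
def unstableSet {M : Type*} [MetricSpace M] (f : M ≃ₜ M) (p : M) : Set M :=
  {q | Tendsto (fun k : ℕ => (⇑f.symm)^[k * Function.minimalPeriod (⇑f) p] q) atTop (𝓝 p)}

/-- A saddle periodic point: topologically hyperbolic of Morse index `0 < i < n`. -/
def IsSaddlePt {M : Type*} [MetricSpace M] (n : ℕ) (f : M ≃ₜ M) (p : M) : Prop :=
  ∃ i, 0 < i ∧ i < n ∧ TopHyperbolic n f p i

/-- A subset `S ⊆ M` is a locally flat `k`-dimensional submanifold of the `n`-manifold
`M`: every `x ∈ S` has an open neighbourhood `U` and a homeomorphism `ψ : U ≃ₜ ℝⁿ` with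
`ψ(U ∩ S) = ℝᵏ × {0}`. -/
def IsLocallyFlatSubmanifold (n k : ℕ) {M : Type*} [TopologicalSpace M] (S : Set M) : Prop :=
  ∀ x ∈ S, ∃ U : Set M, IsOpen U ∧ x ∈ U ∧
    ∃ ψ : U ≃ₜ EuclideanSpace ℝ (Fin n),
      ψ '' {y : U | (y : M) ∈ S} = {y | ∀ j : Fin n, k ≤ (j : ℕ) → y j = 0}
open Filter Topology

namespace LFS
open Set

/-- A map between products with `ℝ` which moves the last coordinate by a bounded amount. -/
def Bdd {X Y : Type*} (f : X × ℝ → Y × ℝ) : Prop := ∃ C : ℝ, ∀ p, |(f p).2 - p.2| ≤ C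

theorem Bdd.comp {X Y Z : Type*} {g : Y × ℝ → Z × ℝ} {f : X × ℝ → Y × ℝ} (hg : Bdd g)
    (hf : Bdd f) : Bdd (g ∘ f) := by
  obtain ⟨C, hC⟩ := hg
  obtain ⟨D, hD⟩ := hf
  refine ⟨C + D, fun p => ?_⟩
  have h1 := hC (f p)
  have h2 := hD p
  have : (g (f p)).2 - p.2 = ((g (f p)).2 - (f p).2) + ((f p).2 - p.2) := by ring
  simp only [Function.comp]
  rw [this]
  exact (abs_add_le _ _).trans (add_le_add h1 h2)

theorem Bdd.inv {X Y : Type*} {g : Y × ℝ → X × ℝ} {f : X × ℝ → Y × ℝ} (hf : Bdd f)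
    (h : ∀ y, f (g y) = y) : Bdd g := by
  obtain ⟨C, hC⟩ := hf
  refine ⟨C, fun p => ?_⟩
  have := hC (g p)
  rw [h] at this
  rwa [abs_sub_comm]

theorem Bdd.symm {X Y : Type*} [TopologicalSpace X] [TopologicalSpace Y] {f : X × ℝ ≃ₜ Y × ℝ}
    (hf : Bdd f) : Bdd f.symm := hf.inv (fun y => f.apply_symm_apply y)

theorem Bdd.of_comp {X Y Z : Type*} {g : Y × ℝ → Z × ℝ} {f : X × ℝ → Y × ℝ} (hg : Bdd g)
    (hf : Bdd (g ∘ f)) : Bdd f := by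
  obtain ⟨C, hC⟩ := hg
  obtain ⟨D, hD⟩ := hf
  refine ⟨C + D, fun p => ?_⟩
  have h1 := hC (f p)
  have h2 := hD p
  simp only [Function.comp] at h2
  rw [abs_le] at *
  constructor <;> linarith

theorem bdd_id {X : Type*} : Bdd (id : X × ℝ → X × ℝ) := ⟨0, fun p => by simp⟩

theorem Bdd.exists_nonneg {X Y : Type*} {f : X × ℝ → Y × ℝ} (hf : Bdd f) :
    ∃ C : ℝ, 0 ≤ C ∧ ∀ p, |(f p).2 - p.2| ≤ C := by
  obtain ⟨C, hC⟩ := hf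
  exact ⟨max C 0, le_max_right _ _, fun p => (hC p).trans (le_max_left _ _)⟩

theorem homeo_of_proper {X Y : Type*} [TopologicalSpace X] [TopologicalSpace Y] [T2Space Y]
    [WeaklyLocallyCompactSpace Y] (f : X → Y) (hc : Continuous f) (hb : Function.Bijective f)
    (ht : Tendsto f (cocompact X) (cocompact Y)) : ∃ e : X ≃ₜ Y, ⇑e = f := by
  have hp : IsProperMap f := isProperMap_iff_tendsto_cocompact.2 ⟨hc, ht⟩
  exact ⟨(Equiv.ofBijective f hb).toHomeomorphOfContinuousClosed hc hp.isClosedMap, rfl⟩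

/-- compact sets of `X × ℝ` have bounded last coordinate. -/
theorem isCompact_snd_bound {X : Type*} [TopologicalSpace X] {K : Set (X × ℝ)}
    (hK : IsCompact K) : ∃ A : ℝ, ∀ p ∈ K, |p.2| ≤ A := by
  obtain ⟨A, hA⟩ := (hK.image continuous_snd).isBounded.subset_closedBall 0
  refine ⟨A, fun p hp => ?_⟩
  have := hA (mem_image_of_mem _ hp)
  simpa using this

theorem homeo_N {K L : Type*} [TopologicalSpace K] [CompactSpace K] [T2Space K]
    [TopologicalSpace L] [CompactSpace L] [T2Space L]
    (f : K × ℝ → L × ℝ) (hc : Continuous f) (hb : Function.Bijective f) (hbd : Bdd f) :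
    ∃ e : K × ℝ ≃ₜ L × ℝ, ⇑e = f := by
  refine homeo_of_proper f hc hb ?_
  obtain ⟨C, hC⟩ := hbd
  rw [hasBasis_cocompact.tendsto_right_iff]
  intro A hA
  obtain ⟨R, hR⟩ := isCompact_snd_bound hA
  refine mem_cocompact.2 ⟨univ ×ˢ Icc (-(R + C)) (R + C), isCompact_univ.prod isCompact_Icc, ?_⟩
  intro p hp hpA
  apply hp
  have h1 := hR _ hpA
  have h2 := hC p
  rw [abs_le] at h1 h2
  exact ⟨mem_univ _, by constructor <;> linarith⟩

section BS
variable {F : Type*} [NormedAddCommGroup F] 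

/-- Bounded homeomorphisms of `F × ℝ` (as maps), fibrewise compactly supported. -/
structure BS (g : F × ℝ → F × ℝ) : Prop where
  cont : Continuous g
  bij : Function.Bijective g
  bdd : Bdd g
  supp : ∃ R : ℝ → ℝ, Continuous R ∧ ∀ x r, R r ≤ ‖x‖ → g (x, r) = (x, r)

theorem BS.id : BS (id : F × ℝ → F × ℝ) :=
  ⟨continuous_id, Function.bijective_id, bdd_id, fun _ => 0, continuous_const, fun _ _ _ => rfl⟩

theorem BS.comp {g f : F × ℝ → F × ℝ} (hg : BS g) (hf : BS f) : BS (g ∘ f) := by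
  refine ⟨hg.cont.comp hf.cont, hg.bij.comp hf.bij, hg.bdd.comp hf.bdd, ?_⟩
  obtain ⟨R, hR, h⟩ := hg.supp
  obtain ⟨R', hR', h'⟩ := hf.supp
  refine ⟨fun r => max (R r) (R' r), hR.max hR', fun x r hx => ?_⟩
  simp only [Function.comp]
  rw [h' x r ((le_max_right _ _).trans hx), h x r ((le_max_left _ _).trans hx)]

theorem BS.homeo [ProperSpace F] {g : F × ℝ → F × ℝ} (hg : BS g) :
    ∃ e : F × ℝ ≃ₜ F × ℝ, ⇑e = g := by
  refine homeo_of_proper g hg.cont hg.bij ?_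
  obtain ⟨C, hC⟩ := hg.bdd
  obtain ⟨R, hRc, hR⟩ := hg.supp
  rw [hasBasis_cocompact.tendsto_right_iff]
  intro A hA
  obtain ⟨S, hS⟩ := isCompact_snd_bound hA
  obtain ⟨B, hB⟩ := ((isCompact_Icc (a := -(S + C)) (b := S + C)).image hRc).isBounded.subset_closedBall 0
  refine mem_cocompact.2 ⟨(Metric.closedBall 0 B ×ˢ Icc (-(S + C)) (S + C)) ∪ A,
    ((isCompact_closedBall 0 B).prod isCompact_Icc).union hA, ?_⟩
  rintro ⟨x, r⟩ hp hpA
  apply hp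
  have h1 := hS _ hpA
  have h2 := hC (x, r)
  rw [abs_le] at h1 h2
  have hr : r ∈ Icc (-(S + C)) (S + C) := by simp only at h2; constructor <;> linarith
  by_cases hx : R r ≤ ‖x‖
  · right
    have := hR x r hx
    rw [← this]; exact hpA
  · left
    refine ⟨?_, hr⟩
    have h3 := hB (mem_image_of_mem R hr)
    simp only [Metric.mem_closedBall, dist_zero_right, Real.norm_eq_abs] at h3 ⊢
    exact (not_le.1 hx).le.trans ((le_abs_self _).trans h3)

end BS

section Tubes
variable {F : Type*} [NormedAddCommGroup F]

/-- The standard inclusion. -/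
def iota (p : F × ℝ) : OnePoint F × ℝ := ((p.1 : OnePoint F), p.2)

@[simp] theorem iota_mk (x : F) (r : ℝ) : iota (x, r) = ((x : OnePoint F), r) := rfl

structure Tube (τ : F × ℝ → OnePoint F × ℝ) : Prop where
  emb : IsOpenEmbedding τ
  bdd : Bdd τ

theorem tube_iota : Tube (iota : F × ℝ → OnePoint F × ℝ) :=
  ⟨OnePoint.isOpenEmbedding_coe.prodMap IsOpenEmbedding.id, 0, fun p => by simp [iota]⟩

theorem Tube.comp {τ : F × ℝ → OnePoint F × ℝ} (hτ : Tube τ)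
    (e : OnePoint F × ℝ ≃ₜ OnePoint F × ℝ) (he : Bdd e) : Tube (e ∘ τ) :=
  ⟨e.isOpenEmbedding.comp hτ.emb, he.comp hτ.bdd⟩

variable [ProperSpace F]

theorem Tube.isClosed_image {τ : F × ℝ → OnePoint F × ℝ} (hτ : Tube τ) {A : Set (F × ℝ)}
    (hA : IsClosed A) {R : ℝ → ℝ} (hR : Continuous R) (hAR : ∀ p ∈ A, ‖p.1‖ ≤ R p.2) :
    IsClosed (τ '' A) := by
  rw [← closure_subset_iff_isClosed]
  intro y hy
  obtain ⟨C, hC⟩ := hτ.bdd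
  set J := Icc (y.2 - 1 - C) (y.2 + 1 + C)
  obtain ⟨B, hB⟩ := ((isCompact_Icc (a := y.2 - 1 - C) (b := y.2 + 1 + C)).image
    hR).isBounded.subset_closedBall 0
  have hcomp : IsCompact (A ∩ (Metric.closedBall 0 B ×ˢ J)) :=
    ((isCompact_closedBall 0 B).prod isCompact_Icc).inter_left hA
  have hcl : IsClosed (τ '' (A ∩ (Metric.closedBall 0 B ×ˢ J))) :=
    (hcomp.image hτ.emb.continuous).isClosed
  have : y ∈ closure (τ '' (A ∩ (Metric.closedBall 0 B ×ˢ J))) := by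
    rw [mem_closure_iff_nhds] at hy ⊢
    intro t ht
    have hn : {z : OnePoint F × ℝ | |z.2 - y.2| < 1} ∈ 𝓝 y := by
      apply (isOpen_lt (by fun_prop) continuous_const).mem_nhds
      simp
    obtain ⟨z, ⟨hzt, hz1⟩, ⟨p, hpA, rfl⟩⟩ := hy _ (inter_mem ht hn)
    refine ⟨τ p, hzt, p, ⟨hpA, ?_⟩, rfl⟩
    have h2 := hC p
    simp only [mem_setOf_eq] at hz1
    rw [abs_le] at h2
    rw [abs_lt] at hz1
    have hr : p.2 ∈ J := by constructor <;> linarith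
    refine ⟨?_, hr⟩
    have h3 := hB (mem_image_of_mem R hr)
    simp only [Metric.mem_closedBall, dist_zero_right, Real.norm_eq_abs] at h3 ⊢
    exact (hAR p hpA).trans ((le_abs_self _).trans h3)
  rw [hcl.closure_eq] at this
  exact image_mono inter_subset_left this

open Classical in
/-- transport of a map through a tube -/
noncomputable def trans {X Y : Type*} (τ : X → Y) (g : X → X) (y : Y) : Y :=
  if h : ∃ x, τ x = y then τ (g h.choose) else y

theorem trans_apply {X Y : Type*} {τ : X → Y} (hτ : Function.Injective τ) (g : X → X) (x : X) :
    trans τ g (τ x) = τ (g x) := by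
  have h : ∃ x', τ x' = τ x := ⟨x, rfl⟩
  rw [trans, dif_pos h, hτ h.choose_spec]

theorem trans_not {X Y : Type*} {τ : X → Y} (g : X → X) {y : Y} (hy : y ∉ range τ) :
    trans τ g y = y := by
  rw [trans, dif_neg]; exact hy

theorem transport {τ : F × ℝ → OnePoint F × ℝ} (hτ : Tube τ) {g : F × ℝ → F × ℝ} (hg : BS g) :
    ∃ G : OnePoint F × ℝ ≃ₜ OnePoint F × ℝ, Bdd G ∧ (∀ p, G (τ p) = τ (g p)) ∧
      ∀ y, y ∉ range τ → G y = y := by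
  have hbdd : Bdd (trans τ g) := by
    obtain ⟨C, hC0, hC⟩ := hτ.bdd.exists_nonneg
    obtain ⟨D, hD0, hD⟩ := hg.bdd.exists_nonneg
    refine ⟨C + D + C, fun y => ?_⟩
    by_cases hy : y ∈ range τ
    · obtain ⟨x, rfl⟩ := hy
      rw [trans_apply hτ.emb.injective]
      have h1 := hC x
      have h2 := hC (g x)
      have h3 := hD x
      rw [abs_le] at *
      constructor <;> linarith
    · rw [trans_not g hy]; simp; positivity
  have hbij : Function.Bijective (trans τ g) := by
    constructor
    · intro y z h
      by_cases hy : y ∈ range τ <;> by_cases hz : z ∈ range τ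
      · obtain ⟨x, rfl⟩ := hy
        obtain ⟨w, rfl⟩ := hz
        rw [trans_apply hτ.emb.injective, trans_apply hτ.emb.injective] at h
        rw [hg.bij.1 (hτ.emb.injective h)]
      · obtain ⟨x, rfl⟩ := hy
        rw [trans_apply hτ.emb.injective, trans_not g hz] at h
        exact absurd ⟨_, h⟩ hz
      · obtain ⟨x, rfl⟩ := hz
        rw [trans_apply hτ.emb.injective, trans_not g hy] at h
        exact absurd ⟨_, h.symm⟩ hy
      · rwa [trans_not g hz, trans_not g hy] at h
    · intro y
      by_cases hy : y ∈ range τ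
      · obtain ⟨x, rfl⟩ := hy
        obtain ⟨w, rfl⟩ := hg.bij.2 x
        exact ⟨τ w, trans_apply hτ.emb.injective _ _⟩
      · exact ⟨y, trans_not g hy⟩
  have hcont : Continuous (trans τ g) := by
    obtain ⟨R, hRc, hR⟩ := hg.supp
    have hcl : IsClosed (τ '' {p | ‖p.1‖ ≤ R p.2}) :=
      hτ.isClosed_image (isClosed_le (by fun_prop) (by fun_prop)) hRc (fun p hp => hp)
    rw [continuous_iff_continuousAt]
    intro y
    by_cases hy : y ∈ range τ
    · obtain ⟨x, rfl⟩ := hy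
      rw [← hτ.emb.continuousAt_iff]
      have : trans τ g ∘ τ = τ ∘ g := funext fun x => trans_apply hτ.emb.injective g x
      rw [this]
      exact (hτ.emb.continuous.comp hg.cont).continuousAt
    · have : trans τ g =ᶠ[𝓝 y] id := by
        have hn : (τ '' {p | ‖p.1‖ ≤ R p.2})ᶜ ∈ 𝓝 y :=
          hcl.isOpen_compl.mem_nhds (fun ⟨p, _, hp⟩ => hy ⟨p, hp⟩)
        filter_upwards [hn] with z hz
        by_cases hz' : z ∈ range τ
        · obtain ⟨⟨x, r⟩, rfl⟩ := hz'
          rw [trans_apply hτ.emb.injective, hR x r, id]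
          by_contra hlt
          exact hz ⟨(x, r), (not_le.1 hlt).le, rfl⟩
        · rw [trans_not g hz', id]
      exact continuousAt_id.congr this.symm
  obtain ⟨G, hG⟩ := homeo_N _ hcont hbij hbdd
  refine ⟨G, by rwa [hG], fun p => ?_, fun y hy => ?_⟩
  · rw [hG, trans_apply hτ.emb.injective]
  · rw [hG, trans_not g hy]

end Tubes
end LFS


open Filter Topology

namespace LFS
open Set

section Radial
variable {F : Type*} [NormedAddCommGroup F] [NormedSpace ℝ F]

theorem radial (δ ε : ℝ → ℝ) (hδc : Continuous δ) (hεc : Continuous ε) (hδ : ∀ r, 0 < δ r)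
    (hδ1 : ∀ r, δ r ≤ 1) (hε : ∀ r, 0 < ε r) :
    ∃ g : F × ℝ → F × ℝ, BS g ∧ (∀ x r, ‖x‖ ≤ 1 → g (x, r) = (δ r • x, r)) ∧
      (∀ x r, 1 + ε r ≤ ‖x‖ → g (x, r) = (x, r)) ∧ ∀ p, (g p).2 = p.2 := by
  set lam : ℝ → ℝ → ℝ := fun r t => δ r + (1 - δ r) * max 0 (min 1 ((t - 1) / ε r)) with hlam
  have hlc : Continuous fun p : ℝ × ℝ => lam p.1 p.2 := by
    have : ∀ p : ℝ × ℝ, ε p.1 ≠ 0 := fun p => (hε p.1).ne'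
    simp only [hlam]
    fun_prop (disch := assumption)
  have hpos : ∀ r t, 0 < lam r t := fun r t => by
    have h1 := hδ r
    have h2 : 0 ≤ (1 - δ r) * max 0 (min 1 ((t - 1) / ε r)) :=
      mul_nonneg (by linarith [hδ1 r]) (le_max_left _ _)
    simp only [hlam]; linarith
  have hmono : ∀ r, Monotone (lam r) := fun r s t hst => by
    simp only [hlam]
    have := hε r
    have h2 : 0 ≤ 1 - δ r := by linarith [hδ1 r]
    gcongr
  have hstrict : ∀ r s t, 0 ≤ s → s < t → lam r s * s < lam r t * t := fun r s t hs hst => by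
    calc lam r s * s ≤ lam r t * s := mul_le_mul_of_nonneg_right (hmono r hst.le) hs
      _ < lam r t * t := mul_lt_mul_of_pos_left hst (hpos r t)
  have hone : ∀ r t, 1 + ε r ≤ t → lam r t = 1 := fun r t h => by
    have : 1 ≤ (t - 1) / ε r := by rw [le_div_iff₀ (hε r)]; linarith
    simp only [hlam, min_eq_left this]; norm_num
  have hin : ∀ r t, t ≤ 1 → lam r t = δ r := fun r t h => by
    have h1 : (t - 1) / ε r ≤ 0 := div_nonpos_of_nonpos_of_nonneg (by linarith) (hε r).le
    simp only [hlam]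
    rw [max_eq_left ((min_le_right _ _).trans h1)]; simp
  have hcont : Continuous (fun p : F × ℝ => (lam p.2 ‖p.1‖ • p.1, p.2)) := by
    have : Continuous fun p : F × ℝ => lam p.2 ‖p.1‖ :=
      hlc.comp (f := fun p : F × ℝ => (p.2, ‖p.1‖)) (by fun_prop)
    fun_prop
  refine ⟨fun p => (lam p.2 ‖p.1‖ • p.1, p.2), ⟨hcont, ⟨?_, ?_⟩, ⟨0, by simp⟩,
    fun r => 1 + ε r, by fun_prop, ?_⟩, ?_, ?_, ?_⟩
  · rintro ⟨x, r⟩ ⟨y, s⟩ h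
    simp only [Prod.mk.injEq] at h
    obtain ⟨h, rfl⟩ := h
    have hn : lam r ‖x‖ * ‖x‖ = lam r ‖y‖ * ‖y‖ := by
      have := congrArg norm h
      rwa [norm_smul, norm_smul, Real.norm_of_nonneg (hpos _ _).le,
        Real.norm_of_nonneg (hpos _ _).le] at this
    have hxy : ‖x‖ = ‖y‖ := by
      rcases lt_trichotomy ‖x‖ ‖y‖ with h' | h' | h'
      · exact absurd hn (hstrict r _ _ (norm_nonneg _) h').ne
      · exact h'
      · exact absurd hn (hstrict r _ _ (norm_nonneg _) h').ne'
    rw [hxy] at h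
    rw [smul_right_injective F (hpos r ‖y‖).ne' h]
  · rintro ⟨y, r⟩
    have hc : ContinuousOn (fun t => lam r t * t) (Icc 0 (max ‖y‖ (1 + ε r))) := by
      have : Continuous fun t => lam r t := hlc.comp (f := fun t : ℝ => (r, t)) (by fun_prop)
      fun_prop
    have h0 : (0:ℝ) ≤ max ‖y‖ (1 + ε r) := (norm_nonneg _).trans (le_max_left _ _)
    have hm : ‖y‖ ∈ Icc (lam r 0 * 0) (lam r (max ‖y‖ (1 + ε r)) * (max ‖y‖ (1 + ε r))) := by
      rw [hone r _ (le_max_right _ _)]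
      simp
    obtain ⟨t, ht, hty⟩ := intermediate_value_Icc h0 hc hm
    simp only at hty
    refine ⟨((lam r t)⁻¹ • y, r), ?_⟩
    have hn : ‖(lam r t)⁻¹ • y‖ = t := by
      rw [norm_smul, norm_inv, Real.norm_of_nonneg (hpos _ _).le, ← hty]
      field_simp [(hpos r t).ne']
    simp only [hn]
    rw [smul_smul, mul_inv_cancel₀ (hpos r t).ne', one_smul]
  · intro x r hx
    simp only [hone r _ hx, one_smul]
  · intro x r hx
    simp only [hin r _ hx]
  · intro x r hx
    simp only [hone r _ hx, one_smul]
  · intro p; rfl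

end Radial

section Push
variable {E : Type*} [NormedAddCommGroup E] [NormedSpace ℝ E]

/-- the basic push, moving `z` to `z + a` with support in the ball of radius `R`. -/
noncomputable def push (z a : E) (R : ℝ) (v : E) : E := v + max 0 (1 - ‖v - z‖ / R) • a

theorem push_center (z a : E) (R : ℝ) : push z a R z = z + a := by simp [push]

theorem push_zero (z : E) (R : ℝ) (v : E) : push z 0 R v = v := by simp [push]

theorem push_far (z a : E) {R : ℝ} (hR : 0 < R) (v : E) (h : R ≤ ‖v - z‖) :
    push z a R v = v := by
  have : 1 - ‖v - z‖ / R ≤ 0 := by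
    rw [sub_nonpos, le_div_iff₀ hR]; linarith
  simp [push, max_eq_left this]

theorem push_coef (z : E) {R : ℝ} (hR : 0 < R) (v : E) :
    0 ≤ max 0 (1 - ‖v - z‖ / R) ∧ max 0 (1 - ‖v - z‖ / R) ≤ 1 :=
  ⟨le_max_left _ _, max_le zero_le_one (by
    have : 0 ≤ ‖v - z‖ / R := by positivity
    linarith)⟩

theorem push_bijective [CompleteSpace E] (z a : E) {R : ℝ} (haR : ‖a‖ < R) :
    Function.Bijective (push z a R) := by
  have hR : 0 < R := (norm_nonneg a).trans_lt haR
  have hlip : ∀ v w : E, ‖max 0 (1 - ‖v - z‖ / R) • a - max 0 (1 - ‖w - z‖ / R) • a‖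
      ≤ ‖a‖ / R * ‖v - w‖ := fun v w => by
    rw [← sub_smul, norm_smul]
    have h1 : |max 0 (1 - ‖v - z‖ / R) - max 0 (1 - ‖w - z‖ / R)| ≤ ‖v - w‖ / R := by
      refine (abs_max_sub_max_le_max _ _ _ _).trans ?_
      have : (1 - ‖v - z‖ / R) - (1 - ‖w - z‖ / R) = (‖w - z‖ - ‖v - z‖) / R := by ring
      rw [this, sub_self, abs_zero, abs_div, abs_of_pos hR]
      apply max_le (by positivity)
      gcongr
      refine (abs_norm_sub_norm_le _ _).trans ?_
      rw [sub_sub_sub_cancel_right, norm_sub_rev]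
    calc _ ≤ ‖v - w‖ / R * ‖a‖ := by rw [Real.norm_eq_abs]; gcongr
      _ = _ := by ring
  have hK : ‖a‖ / R < 1 := by rwa [div_lt_one hR]
  constructor
  · intro v w h
    have h2 := hlip v w
    have h3 : max 0 (1 - ‖v - z‖ / R) • a - max 0 (1 - ‖w - z‖ / R) • a = w - v := by
      simp only [push] at h
      rw [sub_eq_sub_iff_add_eq_add, add_comm, h, add_comm]
    rw [h3, norm_sub_rev w v] at h2
    have h4 : ‖v - w‖ = 0 := by
      by_contra hne
      have : 0 < ‖v - w‖ := lt_of_le_of_ne (norm_nonneg _) (Ne.symm hne)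
      nlinarith
    exact sub_eq_zero.1 (norm_eq_zero.1 h4)
  · intro y
    have hctr : ContractingWith ⟨‖a‖ / R, by positivity⟩
        (fun v => y - max 0 (1 - ‖v - z‖ / R) • a) := by
      refine ⟨by exact_mod_cast hK, LipschitzWith.of_dist_le_mul fun v w => ?_⟩
      rw [dist_eq_norm, dist_eq_norm]
      have := hlip w v
      rw [norm_sub_rev w v] at this
      rw [sub_sub_sub_cancel_left]
      exact this
    refine ⟨hctr.fixedPoint, ?_⟩
    have := hctr.fixedPoint_isFixedPt
    simp only [Function.IsFixedPt] at this
    rw [push]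
    nth_rw 1 [← this]
    abel

theorem continuous_push {Y : Type*} [TopologicalSpace Y] {z a v : Y → E} {R : Y → ℝ}
    (hz : Continuous z) (ha : Continuous a) (hR : Continuous R) (hv : Continuous v)
    (hR0 : ∀ y, 0 < R y) : Continuous fun y => push (z y) (a y) (R y) (v y) := by
  have : ∀ y, R y ≠ 0 := fun y => (hR0 y).ne'
  unfold push
  fun_prop (disch := assumption)

end Push

section Squeeze

noncomputable def rho (a r : ℝ) : ℝ := r + max (-a ^ 2) (min (a ^ 2) (a * r))
noncomputable def Lam (a u : ℝ) : ℝ := u - max (-a ^ 2) (min (a ^ 2) (a / (1 + a) * u))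

theorem clamp_cases (A x : ℝ) (hA : 0 ≤ A) : (x ≤ -A ∧ max (-A) (min A x) = -A) ∨
    (-A ≤ x ∧ x ≤ A ∧ max (-A) (min A x) = x) ∨ (A ≤ x ∧ max (-A) (min A x) = A) := by
  rcases le_total x A with h | h
  · rcases le_total x (-A) with h' | h'
    · left; exact ⟨h', by rw [min_eq_right h, max_eq_left h']⟩
    · right; left; exact ⟨h', h, by rw [min_eq_right h, max_eq_right h']⟩
  · right; right; exact ⟨h, by rw [min_eq_left h, max_eq_right (by linarith)]⟩

theorem rho_cases {a : ℝ} (ha : 0 ≤ a) (r : ℝ) : (r ≤ -a ∧ rho a r = r - a ^ 2) ∨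
    (-a ≤ r ∧ r ≤ a ∧ rho a r = (1 + a) * r) ∨ (a ≤ r ∧ rho a r = r + a ^ 2) := by
  rcases ha.eq_or_lt with rfl | ha
  · rcases le_total r 0 with h | h
    · left; simpa [rho] using h
    · right; right; simpa [rho] using h
  · rcases clamp_cases (a ^ 2) (a * r) (by positivity) with ⟨h, e⟩ | ⟨h, h', e⟩ | ⟨h, e⟩
    · left; exact ⟨by nlinarith, by rw [rho, e]; ring⟩
    · right; left; exact ⟨by nlinarith, by nlinarith, by rw [rho, e]; ring⟩
    · right; right; exact ⟨by nlinarith, by rw [rho, e]⟩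

theorem Lam_cases {a : ℝ} (ha : 0 ≤ a) (u : ℝ) :
    (u ≤ -(a * (1 + a)) ∧ Lam a u = u + a ^ 2) ∨
    (-(a * (1 + a)) ≤ u ∧ u ≤ a * (1 + a) ∧ Lam a u = u / (1 + a)) ∨
    (a * (1 + a) ≤ u ∧ Lam a u = u - a ^ 2) := by
  rcases ha.eq_or_lt with rfl | ha
  · rcases le_total u 0 with h | h
    · left; simpa [Lam] using h
    · right; right; simpa [Lam] using h
  · have h1 : 0 < 1 + a := by linarith
    rcases clamp_cases (a ^ 2) (a / (1 + a) * u) (by positivity) with ⟨h, e⟩ | ⟨h, h', e⟩ | ⟨h, e⟩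
    · left
      rw [div_mul_eq_mul_div, div_le_iff₀ h1] at h
      exact ⟨by nlinarith, by rw [Lam, e]; ring⟩
    · right; left
      rw [div_mul_eq_mul_div, div_le_iff₀ h1] at h'
      rw [div_mul_eq_mul_div, le_div_iff₀ h1] at h
      exact ⟨by nlinarith, by nlinarith, by rw [Lam, e]; field_simp; ring⟩
    · right; right
      rw [div_mul_eq_mul_div, le_div_iff₀ h1] at h
      exact ⟨by nlinarith, by rw [Lam, e]⟩

theorem Lam_rho {a : ℝ} (ha : 0 ≤ a) (r : ℝ) : Lam a (rho a r) = r := by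
  have h1 : 0 < 1 + a := by linarith
  rcases rho_cases ha r with ⟨h, e⟩ | ⟨h, h', e⟩ | ⟨h, e⟩ <;> rw [e]
  · rcases Lam_cases ha (r - a ^ 2) with ⟨g, k⟩ | ⟨g, g', k⟩ | ⟨g, k⟩ <;> rw [k]
    · ring
    · rw [div_eq_iff h1.ne']; nlinarith
    · nlinarith
  · rcases Lam_cases ha ((1 + a) * r) with ⟨g, k⟩ | ⟨g, g', k⟩ | ⟨g, k⟩ <;> rw [k]
    · nlinarith
    · field_simp
    · nlinarith
  · rcases Lam_cases ha (r + a ^ 2) with ⟨g, k⟩ | ⟨g, g', k⟩ | ⟨g, k⟩ <;> rw [k]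
    · nlinarith
    · rw [div_eq_iff h1.ne']; nlinarith
    · ring

theorem rho_Lam {a : ℝ} (ha : 0 ≤ a) (u : ℝ) : rho a (Lam a u) = u := by
  have h1 : 0 < 1 + a := by linarith
  rcases Lam_cases ha u with ⟨h, e⟩ | ⟨h, h', e⟩ | ⟨h, e⟩ <;> rw [e]
  · rcases rho_cases ha (u + a ^ 2) with ⟨g, k⟩ | ⟨g, g', k⟩ | ⟨g, k⟩ <;> rw [k] <;> nlinarith
  · rcases rho_cases ha (u / (1 + a)) with ⟨g, k⟩ | ⟨g, g', k⟩ | ⟨g, k⟩ <;> rw [k]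
    · rw [div_le_iff₀ h1] at g
      have : u = -(a * (1 + a)) := by linarith
      rw [this]; field_simp; ring
    · field_simp
    · rw [le_div_iff₀ h1] at g
      have : u = (a * (1 + a)) := by linarith
      rw [this]; field_simp
  · rcases rho_cases ha (u - a ^ 2) with ⟨g, k⟩ | ⟨g, g', k⟩ | ⟨g, k⟩ <;> rw [k] <;> nlinarith

theorem Lam_lip {a : ℝ} (ha : 0 ≤ a) {u v : ℝ} : |Lam a u - Lam a v| ≤ |u - v| := by
  have h1 : 0 < 1 + a := by linarith
  wlog huv : v ≤ u generalizing u v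
  · rw [abs_sub_comm, abs_sub_comm u v]; exact this (le_of_not_ge huv)
  rw [abs_of_nonneg (sub_nonneg.2 huv)]
  have hk0 : 0 ≤ a / (1 + a) := by positivity
  have hk1 : a / (1 + a) ≤ 1 := by rw [div_le_one h1]; linarith
  have hle : a / (1 + a) * v ≤ a / (1 + a) * u := by gcongr
  have hd : a / (1 + a) * u - a / (1 + a) * v ≤ u - v := by nlinarith
  unfold Lam
  rw [abs_le]
  rcases clamp_cases (a ^ 2) (a / (1 + a) * u) (by positivity) with ⟨h, e⟩ | ⟨h, h', e⟩ | ⟨h, e⟩ <;>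
  rcases clamp_cases (a ^ 2) (a / (1 + a) * v) (by positivity) with ⟨g, k⟩ | ⟨g, g', k⟩ | ⟨g, k⟩ <;>
  rw [e, k] <;> constructor <;> nlinarith

theorem Lam_neg (a u : ℝ) : Lam a (-u) = - Lam a u := by
  have : max (-a ^ 2) (min (a ^ 2) (a / (1 + a) * -u)) =
      - max (-a ^ 2) (min (a ^ 2) (a / (1 + a) * u)) := by
    rcases clamp_cases (a ^ 2) (a / (1 + a) * u) (by positivity) with ⟨h, e⟩ | ⟨h, h', e⟩ | ⟨h, e⟩ <;>
    rcases clamp_cases (a ^ 2) (a / (1 + a) * -u) (by positivity) with ⟨g, k⟩ | ⟨g, g', k⟩ | ⟨g, k⟩ <;>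
    rw [e, k] <;> nlinarith [sq_nonneg a]
  unfold Lam; rw [this]; ring

theorem Lam_diff {a b : ℝ} (ha : 0 ≤ a) (hb : 0 ≤ b) (u : ℝ) :
    |Lam a u - Lam b u| ≤ |a ^ 2 - b ^ 2| := by
  wlog hab : a ≤ b generalizing a b
  · rw [abs_sub_comm, abs_sub_comm (a ^ 2)]; exact this hb ha (le_of_not_ge hab)
  wlog hu : 0 ≤ u generalizing u
  · have := this (-u) (by linarith)
    rwa [Lam_neg, Lam_neg, ← neg_sub', abs_neg] at this
  have h1 : 0 < 1 + a := by linarith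
  have h2 : 0 < 1 + b := by linarith
  have hsq : a ^ 2 ≤ b ^ 2 := by gcongr
  rw [abs_of_nonpos (by linarith : a ^ 2 - b ^ 2 ≤ 0), abs_le]
  have key : a / (1 + a) * u ≤ b / (1 + b) * u := by
    gcongr ?_ * u
    rw [div_le_div_iff₀ h1 h2]; nlinarith
  have hpos : 0 ≤ a / (1 + a) * u := by positivity
  unfold Lam
  rcases clamp_cases (a ^ 2) (a / (1 + a) * u) (by positivity) with ⟨h, e⟩ | ⟨h, h', e⟩ | ⟨h, e⟩ <;>
  rcases clamp_cases (b ^ 2) (b / (1 + b) * u) (by positivity) with ⟨g, k⟩ | ⟨g, g', k⟩ | ⟨g, k⟩ <;>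
  rw [e, k] <;> try (constructor <;> nlinarith)
  all_goals
    constructor
    · nlinarith
    · have hua : u * a ≤ a ^ 2 * (1 + a) := by
        rw [div_mul_eq_mul_div, div_le_iff₀ h1] at h'; nlinarith
      have e1 : b / (1 + b) * u - a / (1 + a) * u = (b - a) * u / ((1 + a) * (1 + b)) := by
        field_simp; ring
      have hua' : a = 0 ∨ u ≤ a * (1 + a) := by
        rcases ha.eq_or_lt with h0 | h0
        · left; exact h0.symm
        · right; nlinarith
      rcases hua' with rfl | hua'
      · nlinarith
      · have : (b - a) * u / ((1 + a) * (1 + b)) ≤ b ^ 2 - a ^ 2 := by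
          rw [div_le_iff₀ (by positivity)]
          have : (b - a) * u ≤ (b - a) * (a * (1 + a)) :=
            mul_le_mul_of_nonneg_left hua' (by linarith)
          have h5 : 0 ≤ (b - a) * (1 + a) := mul_nonneg (by linarith) h1.le
          have : (b - a) * (1 + a) * a ≤ (b - a) * (1 + a) * ((b + a) * (1 + b)) :=
            mul_le_mul_of_nonneg_left (by nlinarith) h5
          nlinarith
        nlinarith

theorem Lam_conv (K C η : ℝ) (hK : 0 ≤ K) (hC : 0 ≤ C) (hη : 0 < η) :
    ∃ A : ℝ, 0 < A ∧ ∀ a a' u r : ℝ, A ≤ a → 0 ≤ a' → |a' ^ 2 - a ^ 2| ≤ C → |r| ≤ K →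
      |u - rho a r| ≤ C → |Lam a' u - r| ≤ η := by
  refine ⟨(2 + 2 * K + C) + (C * K + C) / η, by positivity, fun a a' u r hA ha' h1 h2 h3 => ?_⟩
  have hq : 0 ≤ (C * K + C) / η := by positivity
  have hAa : 2 + 2 * K + C ≤ a := by linarith
  have hqa : (C * K + C) / η ≤ a := by linarith
  rw [div_le_iff₀ hη] at hqa
  have ha0 : 0 < a := by linarith
  have ha1 : 2 ≤ a := by linarith
  have hd : |a' - a| * (a' + a) ≤ C := by
    rw [← abs_of_pos (by linarith : 0 < a' + a), ← abs_mul]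
    have e0 : (a' - a) * (a' + a) = a' ^ 2 - a ^ 2 := by ring
    rwa [e0]
  have hd1 : |a' - a| * a ≤ C := by nlinarith [abs_nonneg (a' - a)]
  have hd2 : |a' - a| ≤ 1 := by
    by_contra hlt
    push Not at hlt
    nlinarith
  have hd3 : |a' - a| ≤ C := by nlinarith [abs_nonneg (a' - a)]
  rw [abs_le] at hd2 h2 h3
  have hrho : rho a r = (1 + a) * r := by
    rcases rho_cases ha0.le r with ⟨h, e⟩ | ⟨h, h', e⟩ | ⟨h, e⟩
    · exfalso; linarith
    · exact e
    · exfalso; linarith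
  rw [hrho] at h3
  have hr1 : (1 + a) * r ≤ (1 + a) * K := by nlinarith
  have hr2 : -((1 + a) * K) ≤ (1 + a) * r := by nlinarith
  have hbig : (1 + a) * K + C < a' * (1 + a') := by
    have : (a - 1) * a ≤ a' * (1 + a') := by nlinarith
    nlinarith
  have hL : Lam a' u = u / (1 + a') := by
    rcases Lam_cases ha' u with ⟨h, e⟩ | ⟨h, h', e⟩ | ⟨h, e⟩
    · exfalso; linarith
    · exact e
    · exfalso; linarith
  have h1a : 0 < 1 + a' := by linarith
  have e1 : u / (1 + a') - r = ((u - (1 + a) * r) + (a - a') * r) / (1 + a') := by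
    field_simp; ring
  rw [hL, e1, abs_div, abs_of_pos h1a, div_le_iff₀ h1a]
  have h5 : |u - (1 + a) * r + (a - a') * r| ≤ C + C * K := by
    refine (abs_add_le _ _).trans (add_le_add (abs_le.2 h3) ?_)
    rw [abs_mul, abs_sub_comm]
    exact mul_le_mul hd3 (abs_le.2 h2) (abs_nonneg _) hC
  nlinarith

end Squeeze
end LFS


open Filter Topology

namespace LFS
open Set

section Ext
variable {F : Type*} [NormedAddCommGroup F]

/-- extension of a map of `F × ℝ` by the identity of `{∞} × ℝ`. -/
def extInf (f : F × ℝ → F × ℝ) : OnePoint F × ℝ → OnePoint F × ℝ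
  | (none, r) => (OnePoint.infty, r)
  | (some x, r) => iota (f (x, r))

@[simp] theorem extInf_infty (f : F × ℝ → F × ℝ) (r : ℝ) :
    extInf f (OnePoint.infty, r) = (OnePoint.infty, r) := rfl
@[simp] theorem extInf_coe (f : F × ℝ → F × ℝ) (x : F) (r : ℝ) :
    extInf f ((x : OnePoint F), r) = iota (f (x, r)) := rfl

theorem iota_injective : Function.Injective (iota : F × ℝ → OnePoint F × ℝ) := by
  rintro ⟨x, r⟩ ⟨y, s⟩ h
  simpa using h

theorem extInf_bijective {f : F × ℝ → F × ℝ} (hf : Function.Bijective f) :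
    Function.Bijective (extInf f) := by
  constructor
  · rintro ⟨x, r⟩ ⟨y, s⟩ h
    induction x using OnePoint.rec <;> induction y using OnePoint.rec
    · simpa using h
    · simp [iota] at h
    · simp [iota] at h
    · simp only [extInf_coe] at h
      have := hf.1 (iota_injective h)
      simpa using this
  · rintro ⟨y, s⟩
    induction y using OnePoint.rec with
    | infty => exact ⟨(OnePoint.infty, s), rfl⟩
    | coe y =>
      obtain ⟨⟨x, r⟩, h⟩ := hf.2 (y, s)
      exact ⟨((x : OnePoint F), r), by simp [h]⟩

theorem extInf_bdd {f : F × ℝ → F × ℝ} (hf : Bdd f) : Bdd (extInf f) := by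
  obtain ⟨C, h0, hC⟩ := hf.exists_nonneg
  refine ⟨C, ?_⟩
  rintro ⟨x, r⟩
  induction x using OnePoint.rec with
  | infty => simpa using h0
  | coe x => exact hC (x, r)

theorem extInf_continuous {f : F × ℝ → F × ℝ} (hf : Continuous f)
    (h : ∀ r, Tendsto f (cocompact F ×ˢ 𝓝 r) (cocompact F ×ˢ 𝓝 r)) :
    Continuous (extInf f) := by
  rw [continuous_iff_continuousAt]
  rintro ⟨x, r⟩
  induction x using OnePoint.rec with
  | infty =>
    have hle : cocompact F ×ˢ 𝓝 r ≤ comap iota (𝓝 ((OnePoint.infty : OnePoint F), r)) := by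
      rw [← map_le_iff_le_comap]
      change Tendsto iota (cocompact F ×ˢ 𝓝 r) _
      rw [nhds_prod_eq]
      refine Tendsto.prodMap (f := fun x : F => (x : OnePoint F)) (g := fun x : ℝ => x) ?_ tendsto_id
      rw [← coclosedCompact_eq_cocompact]
      exact OnePoint.tendsto_coe_infty
    have hi : Tendsto iota (cocompact F ×ˢ 𝓝 r) (𝓝 ((OnePoint.infty : OnePoint F), r)) :=
      map_le_iff_le_comap.2 hle
    have hsrc : 𝓝 ((OnePoint.infty : OnePoint F), r) = map iota (cocompact F ×ˢ 𝓝 r) ⊔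
        map (Prod.mk OnePoint.infty) (𝓝 r) := by
      rw [nhds_prod_eq, OnePoint.nhds_infty_eq, sup_prod, pure_prod, coclosedCompact_eq_cocompact]
      congr 1
      nth_rw 1 [← map_id (f := 𝓝 r)]
      rw [prod_map_map_eq]
      rfl
    rw [ContinuousAt, extInf_infty]
    nth_rw 1 [hsrc]
    rw [tendsto_sup]
    constructor
    · rw [tendsto_map'_iff]
      exact hi.comp (h r)
    · rw [tendsto_map'_iff]
      exact (continuous_const.prodMk continuous_id).continuousAt
  | coe x =>
    have := (tube_iota (F := F)).emb.continuousAt_iff (g := extInf f) (x := (x, r))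
    rw [iota_mk] at this
    rw [← this]
    have e : extInf f ∘ iota = iota ∘ f := by
      funext ⟨y, s⟩; rfl
    rw [e]
    exact ((tube_iota (F := F)).emb.continuous.comp hf).continuousAt

noncomputable def ell (x : F) : ℝ := Real.log (max 1 ‖x‖)

theorem ell_nonneg (x : F) : 0 ≤ ell x := Real.log_nonneg (le_max_left _ _)

theorem ell_zero {x : F} (h : ‖x‖ ≤ 1) : ell x = 0 := by simp [ell, max_eq_left h]

theorem ell_continuous : Continuous (ell : F → ℝ) := by
  have : ∀ x : F, max 1 ‖x‖ ≠ 0 := fun x => (zero_lt_one.trans_le (le_max_left _ _)).ne'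
  unfold ell
  fun_prop (disch := assumption)

theorem ell_tendsto [ProperSpace F] : Tendsto (ell : F → ℝ) (cocompact F) atTop := by
  unfold ell
  exact Real.tendsto_log_atTop.comp (tendsto_atTop_mono (fun x => le_max_right 1 ‖x‖)
    (tendsto_norm_cocompact_atTop (E := F)))

theorem tendsto_of_ell [ProperSpace F] {α : Type*} {l : Filter α} {u : α → F}
    (h : Tendsto (fun a => ell (u a)) l atTop) : Tendsto u l (cocompact F) := by
  rw [← Metric.cobounded_eq_cocompact, ← tendsto_norm_atTop_iff_cobounded]
  refine tendsto_atTop_mono (fun a => ?_) h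
  rcases le_total ‖u a‖ 1 with h1 | h1
  · rw [ell_zero h1]; exact norm_nonneg _
  · rw [ell, max_eq_right h1]
    have := Real.log_le_sub_one_of_pos (by linarith : 0 < ‖u a‖)
    linarith

theorem squeeze [ProperSpace F] (f : F × ℝ → F × ℝ) (hc : Continuous f)
    (hb : Function.Bijective f) (hbd : Bdd f) (hl : ∃ C : ℝ, ∀ p, |ell (f p).1 - ell p.1| ≤ C) :
    ∃ Θ : OnePoint F × ℝ ≃ₜ OnePoint F × ℝ, Bdd Θ ∧
      (∀ r, Θ (OnePoint.infty, r) = (OnePoint.infty, r)) ∧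
      (∀ x r, ‖x‖ ≤ 1 → ‖(f (x, r)).1‖ ≤ 1 → Θ ((x : OnePoint F), r) = iota (f (x, r))) ∧
      (∀ x, (∀ r, f (x, r) = (x, r)) → ∀ r, Θ ((x : OnePoint F), r) = ((x : OnePoint F), r)) := by
  obtain ⟨C1, hC10, hC1⟩ := hbd.exists_nonneg
  obtain ⟨C2, hC2⟩ := hl
  set C := max C1 C2
  have hC0 : 0 ≤ C := hC10.trans (le_max_left _ _)
  have hfd : ∀ p, |(f p).2 - p.2| ≤ C := fun p => (hC1 p).trans (le_max_left _ _)
  have hfl : ∀ p, |ell (f p).1 - ell p.1| ≤ C := fun p => (hC2 p).trans (le_max_right _ _)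
  set a : F → ℝ := fun x => Real.sqrt (ell x) with ha
  have ha0 : ∀ x, 0 ≤ a x := fun x => Real.sqrt_nonneg _
  have hasq : ∀ x, a x ^ 2 = ell x := fun x => Real.sq_sqrt (ell_nonneg x)
  have hac : Continuous a := ell_continuous.sqrt
  set up : F × ℝ → F × ℝ := fun p => (p.1, rho (a p.1) p.2) with hup
  set dn : F × ℝ → F × ℝ := fun p => (p.1, Lam (a p.1) p.2) with hdn
  have hupc : Continuous up := by simp only [hup, rho]; fun_prop
  have hdnc : Continuous dn := by
    have : ∀ x : F × ℝ, 1 + a x.1 ≠ 0 := fun x => by have := ha0 x.1; positivity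
    simp only [hdn, Lam]; fun_prop (disch := assumption)
  have hud : ∀ p, up (dn p) = p := fun p => by simp [hup, hdn, rho_Lam (ha0 p.1)]
  have hdu : ∀ p, dn (up p) = p := fun p => by simp [hup, hdn, Lam_rho (ha0 p.1)]
  have hupb : Function.Bijective up := Function.bijective_iff_has_inverse.2 ⟨dn, hdu, hud⟩
  have hdnb : Function.Bijective dn := Function.bijective_iff_has_inverse.2 ⟨up, hud, hdu⟩
  set g : F × ℝ → F × ℝ := dn ∘ f ∘ up with hg
  have hgc : Continuous g := hdnc.comp (hc.comp hupc)
  have hgb : Function.Bijective g := hdnb.comp (hb.comp hupb)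
  have hgbd : Bdd g := by
    refine ⟨C + C, fun p => ?_⟩
    have e1 : (g p).2 = Lam (a (f (up p)).1) (f (up p)).2 := rfl
    have e2 : p.2 = Lam (a p.1) (up p).2 := (Lam_rho (ha0 _) _).symm
    rw [e1, e2]
    have h1 := Lam_lip (ha0 (f (up p)).1) (u := (f (up p)).2) (v := (up p).2)
    have h2 := Lam_diff (ha0 (f (up p)).1) (ha0 p.1) (up p).2
    rw [hasq, hasq] at h2
    have h3 := hfd (up p)
    have h4 := hfl (up p)
    calc _ ≤ |Lam (a (f (up p)).1) (f (up p)).2 - Lam (a (f (up p)).1) (up p).2| +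
          |Lam (a (f (up p)).1) (up p).2 - Lam (a p.1) (up p).2| := abs_sub_le _ _ _
      _ ≤ _ := add_le_add (h1.trans h3) (h2.trans h4)
  have hlim : ∀ r, Tendsto g (cocompact F ×ˢ 𝓝 r) (cocompact F ×ˢ 𝓝 r) := by
    intro r
    have hfst : Tendsto (fun p : F × ℝ => ell p.1) (cocompact F ×ˢ 𝓝 r) atTop :=
      ell_tendsto.comp tendsto_fst
    have hsnd : Tendsto (fun p : F × ℝ => p.2) (cocompact F ×ˢ 𝓝 r) (𝓝 r) := tendsto_snd
    refine Tendsto.prodMk ?_ ?_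
    · apply tendsto_of_ell
      refine tendsto_atTop_mono (fun p => ?_) (tendsto_atTop_add_const_right _ (-C) hfst)
      have := hfl (up p)
      rw [abs_le] at this
      have e : (g p).1 = (f (up p)).1 := rfl
      have e' : (up p).1 = p.1 := rfl
      change _ ≤ ell (f (up p)).1
      rw [e'] at this
      linarith
    · change Tendsto (fun p => (g p).2) _ _
      suffices h : Tendsto (fun p : F × ℝ => (g p).2 - p.2) (cocompact F ×ˢ 𝓝 r) (𝓝 0) by
        have := h.add hsnd
        refine (this.congr (fun p => ?_)).trans (by simp)
        simp only [sub_add_cancel]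
      rw [Metric.tendsto_nhds]
      intro η hη
      obtain ⟨A, hA0, hA⟩ := Lam_conv (|r| + 1) C (η / 2) (by positivity) hC0 (by positivity)
      have hb1 : ∀ᶠ p : F × ℝ in cocompact F ×ˢ 𝓝 r, |p.2| < |r| + 1 :=
        hsnd.abs.eventually_lt_const (by linarith)
      filter_upwards [hfst.eventually_ge_atTop (A ^ 2), hb1] with p hp1 hp2
      rw [Real.dist_eq, sub_zero]
      have := hA (a p.1) (a (f (up p)).1) (f (up p)).2 p.2 (by
        rw [← Real.sqrt_sq hA0.le]; exact Real.sqrt_le_sqrt hp1) (ha0 _)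
        (by rw [hasq, hasq]; exact hfl (up p)) hp2.le (hfd (up p))
      exact this.trans_lt (by linarith)
  obtain ⟨Θ, hΘ⟩ := homeo_N (extInf g) (extInf_continuous hgc hlim) (extInf_bijective hgb)
    (extInf_bdd hgbd)
  have rho0 : ∀ r, rho 0 r = r := fun r => by simp [rho]
  have Lam0 : ∀ r, Lam 0 r = r := fun r => by simp [Lam]
  refine ⟨Θ, by rw [hΘ]; exact extInf_bdd hgbd, fun r => by rw [hΘ]; rfl, fun x r hx hfx => ?_,
    fun x hx r => ?_⟩
  · rw [hΘ, extInf_coe]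
    have h1 : a x = 0 := by simp [ha, ell_zero hx]
    have h2 : a (f (x, r)).1 = 0 := by simp [ha, ell_zero hfx]
    simp only [hg, Function.comp, hup, hdn, h1, rho0, h2, Lam0]
  · rw [hΘ, extInf_coe]
    simp only [hg, Function.comp, hup, hdn, hx, Lam_rho (ha0 x), iota_mk]

end Ext

section Periodic
variable {X Y : Type*} [TopologicalSpace X] [TopologicalSpace Y]

theorem t_zpow {t : X → ℝ} {μ : X ≃ₜ X} (hμ : ∀ x, t (μ x) = t x + 1) (k : ℤ) (x : X) :
    t ((μ ^ k) x) = t x + k := by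
  have hinv : ∀ x, t (μ⁻¹ x) = t x - 1 := fun x => by
    have := hμ (μ⁻¹ x)
    rw [← Homeomorph.mul_apply, mul_inv_cancel, Homeomorph.one_apply] at this
    linarith
  induction k using Int.induction_on generalizing x with
  | zero => simp
  | succ k ih => rw [zpow_add_one, Homeomorph.mul_apply, ih, hμ]; push_cast; ring
  | pred k ih => rw [zpow_sub_one, Homeomorph.mul_apply, ih, hinv]; push_cast; ring

theorem equiv_zpow {K : X → Y} {μ : X ≃ₜ X} {ν : Y ≃ₜ Y} (h : ∀ x, K (μ x) = ν (K x)) (k : ℤ)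
    (x : X) : K ((μ ^ k) x) = (ν ^ k) (K x) := by
  have hinv : ∀ x, K (μ⁻¹ x) = ν⁻¹ (K x) := fun x => by
    have := h (μ⁻¹ x)
    rw [← Homeomorph.mul_apply, mul_inv_cancel, Homeomorph.one_apply] at this
    rw [this, ← Homeomorph.mul_apply, inv_mul_cancel, Homeomorph.one_apply]
  induction k using Int.induction_on generalizing x with
  | zero => simp
  | succ k ih => rw [zpow_add_one, Homeomorph.mul_apply, ih, h, zpow_add_one, Homeomorph.mul_apply]
  | pred k ih =>
    rw [zpow_sub_one, Homeomorph.mul_apply, ih, hinv, zpow_sub_one, Homeomorph.mul_apply]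

/-- periodic extension (no continuity) -/
theorem periodic_fun {t : X → ℝ} {μ : X ≃ₜ X} (hμ : ∀ x, t (μ x) = t x + 1)
    (ν : Y ≃ₜ Y) (κ : X → Y) :
    ∃ K : X → Y, (∀ x, K (μ x) = ν (K x)) ∧ (∀ x, 0 ≤ t x → t x < 1 → K x = κ x) := by
  refine ⟨fun x => (ν ^ ⌊t x⌋) (κ ((μ ^ (-⌊t x⌋)) x)), fun x => ?_, fun x h0 h1 => ?_⟩
  · simp only [hμ, Int.floor_add_one]
    rw [← Homeomorph.mul_apply (μ ^ (-(⌊t x⌋ + 1))), ← Homeomorph.mul_apply ν, ← zpow_add_one,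
      ← zpow_one_add]
    rw [add_comm 1 ⌊t x⌋, show -(⌊t x⌋ + 1) + 1 = -⌊t x⌋ by ring]
  · have : ⌊t x⌋ = 0 := by rw [Int.floor_eq_zero_iff]; exact ⟨h0, h1⟩
    simp [this]

theorem periodic_ext {t : X → ℝ} (ht : Continuous t) {μ : X ≃ₜ X} (hμ : ∀ x, t (μ x) = t x + 1)
    (ν : Y ≃ₜ Y) (κ : X → Y) (hκ : ContinuousOn κ {x | 0 ≤ t x ∧ t x ≤ 1})
    (hglue : ∀ x, t x = 0 → κ (μ x) = ν (κ x)) :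
    ∃ K : X → Y, Continuous K ∧ (∀ x, K (μ x) = ν (K x)) ∧
      (∀ x, 0 ≤ t x → t x ≤ 1 → K x = κ x) := by
  obtain ⟨K, hK, hKκ⟩ := periodic_fun hμ ν κ
  have hKκ' : ∀ x, 0 ≤ t x → t x ≤ 1 → K x = κ x := fun x h0 h1 => by
    rcases h1.lt_or_eq with h1 | h1
    · exact hKκ x h0 h1
    · obtain ⟨y, rfl⟩ := μ.surjective x
      rw [hμ] at h1
      have hy : t y = 0 := by linarith
      rw [hK, hKκ y hy.ge (by rw [hy]; exact one_pos), hglue y hy]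
  refine ⟨K, ?_, hK, hKκ'⟩
  have hpiece : ∀ k : ℤ, ContinuousOn K {x | (k : ℝ) ≤ t x ∧ t x ≤ k + 1} := fun k => by
    have h1 : EqOn K (fun x => (ν ^ k) (κ ((μ ^ (-k)) x))) {x | (k : ℝ) ≤ t x ∧ t x ≤ k + 1} := by
      intro x hx
      have h2 := t_zpow hμ (-k) x
      push_cast at h2
      have h3 := hKκ' ((μ ^ (-k)) x) (by linarith [hx.1]) (by linarith [hx.2])
      simp only
      rw [← h3, equiv_zpow hK, ← Homeomorph.mul_apply, ← zpow_add, add_neg_cancel, zpow_zero,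
        Homeomorph.one_apply]
    refine ContinuousOn.congr ?_ h1
    refine (ν ^ k).continuous.comp_continuousOn (hκ.comp (μ ^ (-k)).continuous.continuousOn ?_)
    intro x hx
    have h2 := t_zpow hμ (-k) x
    push_cast at h2
    exact ⟨by linarith [hx.1], by linarith [hx.2]⟩
  rw [continuous_iff_continuousAt]
  intro x
  have hcl : ∀ k : ℤ, IsClosed {x | (k : ℝ) ≤ t x ∧ t x ≤ k + 1} := fun k =>
    (isClosed_le continuous_const ht).inter (isClosed_le ht continuous_const)
  have hu := (hpiece (⌊t x⌋ - 1)).union_of_isClosed (hpiece ⌊t x⌋) (hcl _) (hcl _)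
  refine hu.continuousAt ?_
  have hopen : IsOpen {y | (⌊t x⌋ : ℝ) - 1 < t y ∧ t y < ⌊t x⌋ + 1} :=
    (isOpen_lt continuous_const ht).inter (isOpen_lt ht continuous_const)
  refine mem_of_superset (hopen.mem_nhds ⟨?_, Int.lt_floor_add_one _⟩) ?_
  · have := Int.floor_le (t x); linarith
  · rintro y ⟨h1, h2⟩
    rcases le_total (t y) ⌊t x⌋ with h | h
    · left; push_cast; exact ⟨h1.le, by linarith⟩
    · right; exact ⟨h, h2.le⟩

end Periodic
end LFS


open Filter Topology

namespace LFS
open Set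

theorem dimH_image_open {E G : Type*} [NormedAddCommGroup E] [NormedSpace ℝ E]
    [FiniteDimensional ℝ E] [NormedAddCommGroup G] [NormedSpace ℝ G] {f : E → G} {U : Set E}
    (hU : IsOpen U) (hf : ∀ x ∈ U, ContDiffAt ℝ 1 f x) :
    dimH (f '' U) ≤ Module.finrank ℝ E := by
  have h1 : dimH (f '' U) ≤ dimH U := by
    apply dimH_image_le_of_locally_lipschitzOn
    intro x hx
    obtain ⟨K, t, ht, hl⟩ := (hf x hx).exists_lipschitzOnWith
    exact ⟨K, t, mem_nhdsWithin_of_mem_nhds ht, hl⟩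
  refine h1.trans ?_
  rw [← Real.dimH_univ_eq_finrank E]
  exact dimH_mono (subset_univ _)

theorem exists_injective_approx {V : Type*} [NormedAddCommGroup V] [NormedSpace ℝ V]
    [FiniteDimensional ℝ V] (hV : 3 ≤ Module.finrank ℝ V) {γ : ℝ → V} (hγ : Continuous γ)
    {ε : ℝ → ℝ} (hε : Continuous ε) (hε0 : ∀ r, 0 < ε r) :
    ∃ γ' : ℝ → V, Continuous γ' ∧ Function.Injective γ' ∧ ∀ r, dist (γ' r) (γ r) < ε r := by
  obtain ⟨γ0, hγ0, hγ0der, -⟩ := hγ.exists_contDiff_approx 1 (ε := fun r => ε r / 2)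
    (by fun_prop) (fun r => by have := hε0 r; positivity)
  have hθc : Continuous fun r : ℝ => ε r / (4 * (1 + |r|)) := by
    have : ∀ r : ℝ, 4 * (1 + |r|) ≠ 0 := fun r => by positivity
    fun_prop (disch := assumption)
  have hθ0 : ∀ r : ℝ, 0 < ε r / (4 * (1 + |r|)) := fun r => by have := hε0 r; positivity
  obtain ⟨η, hη, hηd, -⟩ := hθc.exists_contDiff_approx 1
    (ε := fun r => ε r / (4 * (1 + |r|)) / 2) (by fun_prop) (fun r => half_pos (hθ0 r))
  have hηpos : ∀ r, 0 < η r := fun r => by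
    have h1 := hηd r
    have h2 := hθ0 r
    rw [Real.dist_eq, abs_lt] at h1
    linarith
  have hηε : ∀ r, η r * (1 + |r|) < ε r / 2 := fun r => by
    have h1 := hηd r
    have h2 := hθ0 r
    rw [Real.dist_eq, abs_lt] at h1
    have h3 : η r < 2 * (ε r / (4 * (1 + |r|))) := by linarith
    have h4 : 0 < 1 + |r| := by positivity
    calc η r * (1 + |r|) < 2 * (ε r / (4 * (1 + |r|))) * (1 + |r|) := by gcongr
      _ = ε r / 2 := by field_simp; ring
  have hη' : ContDiff ℝ 1 η := by exact_mod_cast hη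
  have hγ' : ContDiff ℝ 1 γ0 := by exact_mod_cast hγ0
  let φ1 : ℝ × ℝ × V → V × V := fun p =>
    (-((η p.1 - η p.2.1)⁻¹ • (γ0 p.1 - γ0 p.2.1 + (η p.1 * p.1 - η p.2.1 * p.2.1) • p.2.2)), p.2.2)
  let φ2 : ℝ × ℝ × V → V × V := fun p =>
    (p.2.2, -((η p.1 * (p.1 - p.2.1))⁻¹ • (γ0 p.1 - γ0 p.2.1)))
  let U1 : Set (ℝ × ℝ × V) := {p | η p.1 - η p.2.1 ≠ 0}
  let U2 : Set (ℝ × ℝ × V) := {p | η p.1 * (p.1 - p.2.1) ≠ 0}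
  have hηc := hη'.continuous
  have hU1 : IsOpen U1 := isOpen_ne_fun (by fun_prop) (by fun_prop)
  have hU2 : IsOpen U2 := isOpen_ne_fun (by fun_prop) (by fun_prop)
  have e1 : ContDiff ℝ 1 fun p : ℝ × ℝ × V => η p.1 := hη'.comp contDiff_fst
  have e2 : ContDiff ℝ 1 fun p : ℝ × ℝ × V => η p.2.1 := hη'.comp (contDiff_fst.comp contDiff_snd)
  have e3 : ContDiff ℝ 1 fun p : ℝ × ℝ × V => γ0 p.1 := hγ'.comp contDiff_fst
  have e4 : ContDiff ℝ 1 fun p : ℝ × ℝ × V => γ0 p.2.1 := hγ'.comp (contDiff_fst.comp contDiff_snd)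
  have e5 : ContDiff ℝ 1 fun p : ℝ × ℝ × V => p.1 := contDiff_fst
  have e6 : ContDiff ℝ 1 fun p : ℝ × ℝ × V => p.2.1 := contDiff_fst.comp contDiff_snd
  have e7 : ContDiff ℝ 1 fun p : ℝ × ℝ × V => p.2.2 := contDiff_snd.comp contDiff_snd
  have hφ1 : ∀ p ∈ U1, ContDiffAt ℝ 1 φ1 p := fun p hp =>
    ((((e1.sub e2).contDiffAt.inv hp).smul ((e3.sub e4).add (((e1.mul e5).sub
      (e2.mul e6)).smul e7)).contDiffAt).neg).prodMk e7.contDiffAt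
  have hφ2 : ∀ p ∈ U2, ContDiffAt ℝ 1 φ2 p := fun p hp =>
    e7.contDiffAt.prodMk ((((e1.mul (e5.sub e6)).contDiffAt.inv hp).smul (e3.sub e4).contDiffAt).neg)
  have hdim : dimH (φ1 '' U1 ∪ φ2 '' U2) < Module.finrank ℝ (V × V) := by
    rw [dimH_union]
    refine (max_le (dimH_image_open hU1 hφ1) (dimH_image_open hU2 hφ2)).trans_lt ?_
    simp only [Module.finrank_prod, Module.finrank_self]
    norm_cast
    omega
  obtain ⟨⟨v1, v2⟩, hv, hvb⟩ := (dense_compl_of_dimH_lt_finrank hdim).exists_mem_open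
    (Metric.isOpen_ball (x := (0 : V × V)) (ε := 1)) ⟨0, by simp⟩
  have hn : ‖v1‖ < 1 ∧ ‖v2‖ < 1 := by
    have : ‖(v1, v2)‖ < 1 := by simpa using hvb
    rwa [Prod.norm_def, max_lt_iff] at this
  refine ⟨fun r => γ0 r + η r • (v1 + r • v2), ?_, ?_, fun r => ?_⟩
  · have := hγ'.continuous
    fun_prop
  · intro r1 r2 h
    by_contra hne
    apply hv
    simp only at h
    have hh : γ0 r1 - γ0 r2 + (η r1 - η r2) • v1 + (η r1 * r1 - η r2 * r2) • v2 = 0 := by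
      have : γ0 r1 + η r1 • (v1 + r1 • v2) - (γ0 r2 + η r2 • (v1 + r2 • v2)) = 0 := sub_eq_zero.2 h
      rw [← this]; module
    by_cases hη12 : η r1 - η r2 = 0
    · right
      have hnz : η r1 * (r1 - r2) ≠ 0 := mul_ne_zero (hηpos r1).ne' (sub_ne_zero.2 hne)
      refine ⟨(r1, r2, v1), hnz, ?_⟩
      have e : η r2 = η r1 := by linarith
      rw [hη12, zero_smul, add_zero, e, ← mul_sub] at hh
      have h5 : γ0 r1 - γ0 r2 = -((η r1 * (r1 - r2)) • v2) := eq_neg_of_add_eq_zero_left hh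
      simp only [φ2, h5, smul_neg, smul_smul, inv_mul_cancel₀ hnz, one_smul, neg_neg]
    · left
      refine ⟨(r1, r2, v2), hη12, ?_⟩
      have h5 : γ0 r1 - γ0 r2 + (η r1 * r1 - η r2 * r2) • v2 = -((η r1 - η r2) • v1) := by
        apply eq_neg_of_add_eq_zero_left
        rw [← hh]; abel
      simp only [φ1, h5, smul_neg, smul_smul, inv_mul_cancel₀ hη12, one_smul, neg_neg]
  · have h1 : ‖η r • (v1 + r • v2)‖ ≤ η r * (1 + |r|) := by
      rw [norm_smul, Real.norm_of_nonneg (hηpos r).le]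
      gcongr
      · exact (hηpos r).le
      refine (norm_add_le _ _).trans ?_
      rw [norm_smul, Real.norm_eq_abs]
      have : |r| * ‖v2‖ ≤ |r| * 1 := by gcongr; exact hn.2.le
      linarith [hn.1]
    have h2 := hγ0der r
    rw [dist_eq_norm] at h2 ⊢
    calc _ = ‖(γ0 r - γ r) + η r • (v1 + r • v2)‖ := by rw [add_sub_right_comm]
      _ ≤ ‖γ0 r - γ r‖ + ‖η r • (v1 + r • v2)‖ := norm_add_le _ _
      _ < _ := by linarith [hηε r]

end LFS


open Filter Topology

namespace LFS
open Set

theorem exists_sup_bound {X : Type*} [TopologicalSpace X] {K : Set X} (hK : IsCompact K)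
    (f : ℝ → X → ℝ) (hf : Continuous fun p : ℝ × X => f p.1 p.2) :
    ∃ R : ℝ → ℝ, Continuous R ∧ ∀ h, ∀ x ∈ K, f h x ≤ R h := by
  refine ⟨fun h => sSup (f h '' K), hK.continuous_sSup (f := f) hf, fun h x hx => ?_⟩
  apply le_csSup
  · have : Continuous (f h) := hf.comp (Continuous.prodMk_right h)
    exact (hK.image this).bddAbove
  · exact mem_image_of_mem _ hx

section LemC
variable {Q : Type*} [NormedAddCommGroup Q] [NormedSpace ℝ Q] [FiniteDimensional ℝ Q]

theorem lemC2 (c : ℝ → (Q × ℝ) × ℝ) (hc : Continuous c) (C : ℝ) (hC : ∀ r, |(c r).2 - r| ≤ C)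
    (K : ℝ) (hK : ∀ r, ‖(c r).1.1‖ ≤ K)
    (hinj : Function.Injective fun r => ((c r).1.1, (c r).2)) :
    ∃ g : (Q × ℝ) × ℝ → (Q × ℝ) × ℝ, BS g ∧ ∀ r, g ((0, 0), r) = c r := by
  have hC0 : 0 ≤ C := (abs_nonneg _).trans (hC 0)
  have hK0 : 0 ≤ K := (norm_nonneg _).trans (hK 0)
  have : CompleteSpace Q := FiniteDimensional.complete ℝ Q
  have : ProperSpace Q := FiniteDimensional.proper ℝ Q
  -- first push
  have h1 : ∃ g : (Q × ℝ) × ℝ → (Q × ℝ) × ℝ, BS g ∧ ∀ r, g ((0, 0), r) = ((0, r), r) := by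
    set a : Q → ℝ → ℝ := fun q h => max 0 (1 - ‖q‖) * h
    have hb : ∀ q h, ‖a q h‖ < 1 + |h| := fun q h => by
      simp only [a, Real.norm_eq_abs, abs_mul, abs_of_nonneg (le_max_left 0 (1 - ‖q‖))]
      have h1 : max 0 (1 - ‖q‖) ≤ 1 := max_le zero_le_one (by linarith [norm_nonneg q])
      have := mul_le_mul_of_nonneg_right h1 (abs_nonneg h)
      linarith
    have hR : ∀ h : ℝ, 0 < 1 + |h| := fun h => by positivity
    refine ⟨fun p => ((p.1.1, push 0 (a p.1.1 p.2) (1 + |p.2|) p.1.2), p.2), ⟨?_, ⟨?_, ?_⟩, ?_, ?_⟩, ?_⟩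
    · refine Continuous.prodMk (Continuous.prodMk (by fun_prop) ?_) (by fun_prop)
      exact continuous_push (by fun_prop) (by fun_prop) (by fun_prop) (by fun_prop) (fun p => hR _)
    · rintro ⟨⟨q, s⟩, h⟩ ⟨⟨q', s'⟩, h'⟩ hh
      simp only [Prod.mk.injEq] at hh
      obtain ⟨⟨rfl, hs⟩, rfl⟩ := hh
      rw [(push_bijective _ _ (hb q h)).1 hs]
    · rintro ⟨⟨q, s⟩, h⟩
      obtain ⟨s', hs'⟩ := (push_bijective 0 _ (hb q h)).2 s
      exact ⟨((q, s'), h), by simp [hs']⟩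
    · exact ⟨0, fun p => by simp⟩
    · refine ⟨fun h => 1 + |h|, by fun_prop, ?_⟩
      rintro ⟨q, s⟩ h hx
      rcases le_max_iff.1 hx with hq | hs
      · have : a q h = 0 := by
          simp only [a]
          rw [max_eq_left, zero_mul]
          simp only at hq
          linarith [abs_nonneg h]
        simp [this, push_zero]
      · rw [push_far _ _ (hR h)]
        simpa using hs
    · intro r
      simp [a, push_center]
  -- second push
  have h2 : ∃ g : (Q × ℝ) × ℝ → (Q × ℝ) × ℝ, BS g ∧
      ∀ r, g ((0, r), r) = (((c r).1.1, r), (c r).2) := by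
    set a : ℝ → Q × ℝ := fun s => ((c s).1.1, (c s).2 - s)
    have ha : Continuous a := by fun_prop
    set R : ℝ := K + C + 1
    have hR : 0 < R := by positivity
    have haR : ∀ s, ‖a s‖ < R := fun s => by
      rw [Prod.norm_def, max_lt_iff]
      refine ⟨?_, ?_⟩
      · have := hK s; simp only [R, a]; linarith
      · have := hC s; simp only [R, a, Real.norm_eq_abs]; linarith
    set P : ℝ → Q × ℝ → Q × ℝ := fun s v => push (0, s) (a s) R v
    have hP : ∀ s, Function.Bijective (P s) := fun s => push_bijective _ _ (haR s)
    refine ⟨fun p => (((P p.1.2 (p.1.1, p.2)).1, p.1.2), (P p.1.2 (p.1.1, p.2)).2),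
      ⟨?_, ⟨?_, ?_⟩, ?_, ?_⟩, ?_⟩
    · have : Continuous fun p : (Q × ℝ) × ℝ => P p.1.2 (p.1.1, p.2) :=
        continuous_push (by fun_prop) (by fun_prop) (by fun_prop) (by fun_prop) (fun p => hR)
      exact (this.fst.prodMk (by fun_prop)).prodMk this.snd
    · rintro ⟨⟨q, s⟩, h⟩ ⟨⟨q', s'⟩, h'⟩ hh
      simp only [Prod.mk.injEq] at hh
      obtain ⟨⟨e1, rfl⟩, e2⟩ := hh
      have := (hP s).1 (Prod.ext e1 e2)
      simp only [Prod.mk.injEq] at this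
      rw [this.1, this.2]
    · rintro ⟨⟨q, s⟩, h⟩
      obtain ⟨⟨q', h'⟩, e⟩ := (hP s).2 (q, h)
      exact ⟨((q', s), h'), by simp [e]⟩
    · refine ⟨C, ?_⟩
      rintro ⟨⟨q, s⟩, h⟩
      simp only [P, push, Prod.snd_add, Prod.smul_snd, add_sub_cancel_left, smul_eq_mul, abs_mul]
      have h1 := push_coef ((0, s) : Q × ℝ) hR (q, h)
      rw [abs_of_nonneg h1.1]
      calc _ ≤ 1 * C := mul_le_mul h1.2 (hC s) (abs_nonneg _) zero_le_one
        _ = C := one_mul C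
    · refine ⟨fun h => R + |h|, by fun_prop, ?_⟩
      rintro ⟨q, s⟩ h hx
      have : P s (q, h) = (q, h) := by
        apply push_far _ _ hR
        rw [Prod.norm_def]
        rcases le_max_iff.1 hx with hq | hs
        · apply le_max_of_le_left
          simp only [Prod.fst_sub, sub_zero] at hq ⊢
          linarith [abs_nonneg h]
        · apply le_max_of_le_right
          simp only [Prod.snd_sub, Real.norm_eq_abs] at hs ⊢
          have := abs_sub_abs_le_abs_sub s h
          rw [abs_sub_comm]
          linarith
      simp [this]
    · intro r
      simp [P, push_center, a]
  -- third push
  have h3 : ∃ g : (Q × ℝ) × ℝ → (Q × ℝ) × ℝ, BS g ∧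
      ∀ r, g (((c r).1.1, r), (c r).2) = c r := by
    have hcl : IsClosedEmbedding fun r => ((c r).1.1, (c r).2) := by
      refine IsClosedEmbedding.of_continuous_injective_isClosedMap (by fun_prop) hinj ?_
      refine IsProperMap.isClosedMap (isProperMap_iff_tendsto_cocompact.2 ⟨by fun_prop, ?_⟩)
      rw [hasBasis_cocompact.tendsto_right_iff]
      intro A hA
      obtain ⟨B, hB⟩ := isCompact_snd_bound hA
      refine mem_cocompact.2 ⟨Icc (-(B + C)) (B + C), isCompact_Icc, fun r hr hrA => hr ?_⟩
      have e1 := hB _ hrA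
      have e2 := hC r
      rw [abs_le] at e1 e2
      constructor <;> linarith
    obtain ⟨z, hz⟩ := ContinuousMap.exists_extension' hcl (⟨fun r => r, continuous_id⟩ : C(ℝ, ℝ))
    obtain ⟨b, hb⟩ := ContinuousMap.exists_extension' hcl
      (⟨fun r => (c r).1.2 - r, by fun_prop⟩ : C(ℝ, ℝ))
    set a : Q × ℝ → ℝ := fun y => max 0 (min 1 (K + 1 - ‖y.1‖)) * b y
    have ha : Continuous a := by fun_prop
    have hR : ∀ y, 0 < 1 + |a y| := fun y => by positivity
    have haR : ∀ y, ‖a y‖ < 1 + |a y| := fun y => by rw [Real.norm_eq_abs]; linarith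
    obtain ⟨S, hSc, hS⟩ := exists_sup_bound (isCompact_closedBall (0 : Q) (K + 1))
      (fun h q => |z (q, h)| + 1 + |a (q, h)|) (by fun_prop)
    refine ⟨fun p => ((p.1.1, push (z (p.1.1, p.2)) (a (p.1.1, p.2)) (1 + |a (p.1.1, p.2)|) p.1.2),
      p.2), ⟨?_, ⟨?_, ?_⟩, ?_, ?_⟩, ?_⟩
    · refine Continuous.prodMk (Continuous.prodMk (by fun_prop) ?_) (by fun_prop)
      exact continuous_push (by fun_prop) (by fun_prop) (by fun_prop) (by fun_prop) (fun p => hR _)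
    · rintro ⟨⟨q, s⟩, h⟩ ⟨⟨q', s'⟩, h'⟩ hh
      simp only [Prod.mk.injEq] at hh
      obtain ⟨⟨rfl, hs⟩, rfl⟩ := hh
      rw [(push_bijective _ _ (haR (q, h))).1 hs]
    · rintro ⟨⟨q, s⟩, h⟩
      obtain ⟨s', hs'⟩ := (push_bijective (z (q, h)) _ (haR (q, h))).2 s
      exact ⟨((q, s'), h), by simp [hs']⟩
    · exact ⟨0, fun p => by simp⟩
    · refine ⟨fun h => max (S h) (K + 1), by fun_prop, ?_⟩
      rintro ⟨q, s⟩ h hx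
      by_cases hq : K + 1 ≤ ‖q‖
      · have : a (q, h) = 0 := by
          simp only [a]
          rw [max_eq_left, zero_mul]
          exact (min_le_right _ _).trans (by linarith)
        simp [this, push_zero]
      · rcases le_max_iff.1 hx with hq' | hs
        · exact absurd ((le_max_right _ _).trans hq') hq
        · rw [push_far _ _ (hR _)]
          have e := hS h q (by simpa using (not_le.1 hq).le)
          simp only [Real.norm_eq_abs] at hs ⊢
          have := abs_sub_abs_le_abs_sub s (z (q, h))
          linarith [(le_max_left _ _).trans hs]
    · intro r
      have ez : z ((c r).1.1, (c r).2) = r := congrFun hz r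
      have eb : b ((c r).1.1, (c r).2) = (c r).1.2 - r := congrFun hb r
      have ea : a ((c r).1.1, (c r).2) = (c r).1.2 - r := by
        simp only [a, eb]
        rw [min_eq_left (by linarith [hK r]), max_eq_right zero_le_one, one_mul]
      simp only [ez, push_center, ea]
      simp
  obtain ⟨g1, hg1, e1⟩ := h1
  obtain ⟨g2, hg2, e2⟩ := h2
  obtain ⟨g3, hg3, e3⟩ := h3
  exact ⟨g3 ∘ (g2 ∘ g1), hg3.comp (hg2.comp hg1), fun r => by simp [e1, e2, e3]⟩

theorem pos_dist {X : Type*} [PseudoMetricSpace X] {O : Set X} (hO : IsOpen O) {c : ℝ → X}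
    (hc : Continuous c) (hcO : ∀ r, c r ∈ O) :
    ∃ ε : ℝ → ℝ, Continuous ε ∧ (∀ r, 0 < ε r) ∧ (∀ r, ε r ≤ 1) ∧
      ∀ r y, dist y (c r) < ε r → y ∈ O := by
  rcases eq_empty_or_nonempty Oᶜ with h | h
  · exact ⟨fun _ => 1, continuous_const, fun _ => one_pos, fun _ => le_rfl, fun r y _ => by
      rw [compl_empty_iff] at h; rw [h]; trivial⟩
  · refine ⟨fun r => min 1 (Metric.infDist (c r) Oᶜ), ?_, fun r => ?_, fun r => min_le_left _ _, fun r y hy => ?_⟩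
    · exact continuous_const.min ((Metric.continuous_infDist_pt _).comp hc)
    · refine lt_min one_pos ((hO.isClosed_compl.notMem_iff_infDist_pos h).1 (by simpa using hcO r))
    · by_contra hyO
      have := Metric.infDist_le_dist_of_mem (x := c r) (show y ∈ Oᶜ from hyO)
      rw [dist_comm] at this
      exact absurd (hy.trans_le (min_le_right _ _)) (not_lt.2 this)

theorem lemC1 (hd : 2 ≤ Module.finrank ℝ Q) (O : Set ((Q × ℝ) × ℝ)) (hO : IsOpen O)
    (c : ℝ → (Q × ℝ) × ℝ) (hc : Continuous c) (hcO : ∀ r, c r ∈ O)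
    (C : ℝ) (hC : ∀ r, |(c r).2 - r| ≤ C) (K : ℝ) (hK : ∀ r, ‖(c r).1‖ ≤ K) :
    ∃ g : (Q × ℝ) × ℝ → (Q × ℝ) × ℝ, BS g ∧ ∀ x r, ‖x‖ ≤ 1 → g (x, r) ∈ O := by
  have : CompleteSpace Q := FiniteDimensional.complete ℝ Q
  have : ProperSpace Q := FiniteDimensional.proper ℝ Q
  obtain ⟨ε, hεc, hε0, hε1, hεO⟩ := pos_dist hO hc hcO
  obtain ⟨γ, hγ, hγi, hγd⟩ := exists_injective_approx (V := Q × ℝ)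
    (by simp only [Module.finrank_prod, Module.finrank_self]; omega)
    (γ := fun r => ((c r).1.1, (c r).2)) (by fun_prop) hεc hε0
  obtain ⟨g, hg, hgc⟩ := lemC2 (fun r => (((γ r).1, (c r).1.2), (γ r).2)) (by fun_prop) (C + 1)
    (fun r => by
      have h1 : dist (γ r).2 (c r).2 ≤ 1 := ((le_max_right _ _).trans_lt (hγd r)).le.trans (hε1 r)
      have h2 := hC r
      rw [Real.dist_eq] at h1
      simp only
      rw [abs_le] at *
      constructor <;> linarith) (K + 1)
    (fun r => by
      have h1 : dist (γ r).1 (c r).1.1 ≤ 1 := ((le_max_left _ _).trans_lt (hγd r)).le.trans (hε1 r)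
      have h2 : ‖(c r).1.1‖ ≤ K := (le_max_left _ _).trans (hK r)
      rw [dist_eq_norm] at h1
      have := norm_sub_norm_le (γ r).1 (c r).1.1
      simp only
      linarith) hγi
  have hO' : IsOpen (g ⁻¹' O) := hO.preimage hg.cont
  obtain ⟨δ, hδc, hδ0, hδ1, hδO⟩ := pos_dist hO' (c := fun r => (((0, 0), r) : (Q × ℝ) × ℝ))
    (by fun_prop) (fun r => by
      rw [mem_preimage, hgc]
      apply hεO r
      refine max_lt (max_lt ?_ ?_) ?_
      · exact (le_max_left _ _).trans_lt (hγd r)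
      · simpa using hε0 r
      · exact (le_max_right _ _).trans_lt (hγd r))
  obtain ⟨g0, hg0, hg01, -, -⟩ := radial (F := Q × ℝ) (fun r => δ r / 2) (fun _ => 1) (by fun_prop)
    continuous_const (fun r => by have := hδ0 r; positivity) (fun r => by have := hδ1 r; linarith)
    (fun _ => one_pos)
  refine ⟨g ∘ g0, hg.comp hg0, fun x r hx => ?_⟩
  simp only [Function.comp]
  rw [hg01 x r hx]
  apply hδO r
  rw [Prod.dist_eq, max_lt_iff]
  refine ⟨?_, by simpa using hδ0 r⟩
  rw [dist_eq_norm]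
  have h0 := hδ0 r
  have : ‖(δ r / 2) • x‖ < δ r := by
    rw [norm_smul, Real.norm_of_nonneg (by positivity)]
    nlinarith
  rwa [show ((0, 0) : Q × ℝ) = 0 from rfl, sub_zero]

theorem BS.dil {F : Type*} [NormedAddCommGroup F] [NormedSpace ℝ F] {g : F × ℝ → F × ℝ} (hg : BS g)
    {ρ : ℝ → ℝ} (hρ : Continuous ρ) (hρ0 : ∀ r, 0 < ρ r) :
    BS fun p => (ρ (g ((ρ p.2)⁻¹ • p.1, p.2)).2 • (g ((ρ p.2)⁻¹ • p.1, p.2)).1,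
      (g ((ρ p.2)⁻¹ • p.1, p.2)).2) := by
  have hne : ∀ r, ρ r ≠ 0 := fun r => (hρ0 r).ne'
  refine ⟨?_, ⟨?_, ?_⟩, ?_, ?_⟩
  · have h0 : Continuous fun p : F × ℝ => ((ρ p.2)⁻¹ • p.1, p.2) := by
      fun_prop (disch := intro p; exact hne _)
    have h1 : Continuous fun p : F × ℝ => g ((ρ p.2)⁻¹ • p.1, p.2) := hg.cont.comp h0
    exact ((hρ.comp h1.snd).smul h1.fst).prodMk h1.snd
  · rintro ⟨x, r⟩ ⟨y, s⟩ h
    simp only [Prod.mk.injEq] at h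
    obtain ⟨h1, h2⟩ := h
    rw [h2] at h1
    have := hg.bij.1 (Prod.ext (smul_right_injective F (hne _) h1) h2)
    simp only [Prod.mk.injEq] at this
    obtain ⟨h3, rfl⟩ := this
    rw [smul_right_injective F (inv_ne_zero (hne r)) h3]
  · rintro ⟨y, s⟩
    obtain ⟨⟨x, r⟩, h⟩ := hg.bij.2 ((ρ s)⁻¹ • y, s)
    refine ⟨(ρ r • x, r), ?_⟩
    simp only [smul_smul, inv_mul_cancel₀ (hne r), one_smul, h, mul_inv_cancel₀ (hne s)]
  · obtain ⟨C, hC⟩ := hg.bdd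
    exact ⟨C, fun p => by simpa using hC ((ρ p.2)⁻¹ • p.1, p.2)⟩
  · obtain ⟨R, hR, h⟩ := hg.supp
    refine ⟨fun r => ρ r * R r, by fun_prop, fun x r hx => ?_⟩
    have : R r ≤ ‖(ρ r)⁻¹ • x‖ := by
      rw [norm_smul, norm_inv, Real.norm_of_nonneg (hρ0 r).le, le_inv_mul_iff₀ (hρ0 r)]
      exact hx
    simp only [h _ _ this, smul_smul, mul_inv_cancel₀ (hne r), one_smul]

theorem lemC (hd : 2 ≤ Module.finrank ℝ Q) (O : Set ((Q × ℝ) × ℝ)) (hO : IsOpen O)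
    (c : ℝ → (Q × ℝ) × ℝ) (hc : Continuous c) (hcO : ∀ r, c r ∈ O)
    (C : ℝ) (hC : ∀ r, |(c r).2 - r| ≤ C) :
    ∃ g : (Q × ℝ) × ℝ → (Q × ℝ) × ℝ, BS g ∧ ∀ x r, ‖x‖ ≤ 1 → g (x, r) ∈ O := by
  obtain ⟨S, hSc, hS⟩ := exists_sup_bound (isCompact_Icc (a := -C) (b := C))
    (fun h u => ‖(c (h + u)).1‖) (by fun_prop)
  set ρ : ℝ → ℝ := fun h => max 1 (S h)
  have hρ : Continuous ρ := by fun_prop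
  have hρ0 : ∀ h, 0 < ρ h := fun h => zero_lt_one.trans_le (le_max_left _ _)
  have hne : ∀ r, ρ r ≠ 0 := fun r => (hρ0 r).ne'
  have hdil : Continuous fun p : (Q × ℝ) × ℝ => (ρ p.2 • p.1, p.2) := by fun_prop
  obtain ⟨g, hg, hgO⟩ := lemC1 hd _ (hO.preimage hdil)
    (fun r => ((ρ (c r).2)⁻¹ • (c r).1, (c r).2)) (by fun_prop (disch := intro p; exact hne _))
    (fun r => by
      simp only [mem_preimage, smul_smul, mul_inv_cancel₀ (hne _), one_smul]
      exact hcO r) C hC 1 (fun r => by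
      simp only [norm_smul, norm_inv, Real.norm_of_nonneg (hρ0 _).le]
      rw [inv_mul_le_iff₀ (hρ0 _), mul_one]
      refine le_max_of_le_right ?_
      have h1 := hC r
      rw [abs_le] at h1
      have := hS (c r).2 (r - (c r).2) ⟨by linarith, by linarith⟩
      simpa using this)
  refine ⟨_, hg.dil hρ hρ0, fun x r hx => ?_⟩
  refine hgO _ r ?_
  simp only [norm_smul, norm_inv, Real.norm_of_nonneg (hρ0 _).le]
  rw [inv_mul_le_iff₀ (hρ0 _), mul_one]
  exact hx.trans (le_max_left _ _)

end LemC
end LFS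


open Filter Topology

namespace LFS
open Set

theorem lift_curve {X Y Z : Type*} [TopologicalSpace X] [TopologicalSpace Y] [TopologicalSpace Z]
    {τ : X → Y} (hτ : IsEmbedding τ) {c : Z → Y} (hc : Continuous c)
    (h : ∀ r, c r ∈ range τ) : ∃ c' : Z → X, Continuous c' ∧ ∀ r, τ (c' r) = c r := by
  choose c' hc' using h
  refine ⟨c', ?_, hc'⟩
  rw [hτ.continuous_iff]
  exact hc.congr fun r => (hc' r).symm

theorem usq_exists (F : Type*) [NormedAddCommGroup F] [NormedSpace ℝ F] :
    ∃ u : F → F, IsOpenEmbedding u ∧ range u = Metric.ball 0 1 ∧ u 0 = 0 ∧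
      ∀ y, ‖y‖ ≤ 1 / 2 → ∃ x, ‖x‖ ≤ 1 ∧ u x = y := by
  refine ⟨OpenPartialHomeomorph.univUnitBall, ?_, ?_, ?_, ?_⟩
  · exact OpenPartialHomeomorph.univUnitBall.to_isOpenEmbedding rfl
  · have := (OpenPartialHomeomorph.univUnitBall (E := F)).image_source_eq_target
    rw [← image_univ]
    exact this
  · simp
  · intro y hy
    refine ⟨OpenPartialHomeomorph.univUnitBall.symm y, ?_,
      OpenPartialHomeomorph.univUnitBall.right_inv ?_⟩
    · rw [OpenPartialHomeomorph.univUnitBall_symm_apply, norm_smul, norm_inv,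
        Real.norm_of_nonneg (Real.sqrt_nonneg _)]
      have h1 : 1 / 2 ≤ √(1 - ‖y‖ ^ 2) := by
        apply Real.le_sqrt_of_sq_le
        nlinarith [norm_nonneg y]
      rw [inv_mul_le_iff₀ (by linarith)]
      linarith
    · show y ∈ Metric.ball 0 1
      simp only [Metric.mem_ball, dist_zero_right]; linarith

section
variable {Q : Type*} [NormedAddCommGroup Q] [NormedSpace ℝ Q] [FiniteDimensional ℝ Q]

theorem T2 (hd : 2 ≤ Module.finrank ℝ Q) {τ : (Q × ℝ) × ℝ → OnePoint (Q × ℝ) × ℝ} (hτ : Tube τ)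
    {O : Set (OnePoint (Q × ℝ) × ℝ)} (hO : IsOpen O) {c : ℝ → OnePoint (Q × ℝ) × ℝ}
    (hc : Continuous c) {C : ℝ} (hC : ∀ r, |(c r).2 - r| ≤ C) (hcO : ∀ r, c r ∈ O)
    (hcτ : ∀ r, ∃ x s, ‖x‖ < 1 ∧ τ (x, s) = c r) :
    ∃ G : OnePoint (Q × ℝ) × ℝ ≃ₜ OnePoint (Q × ℝ) × ℝ, Bdd G ∧
      (∀ y, (∀ x r, ‖x‖ < 1 → τ (x, r) ≠ y) → G y = y) ∧
      ∀ x r, ‖x‖ ≤ 1 / 2 → G (τ (x, r)) ∈ O := by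
  have : ProperSpace Q := FiniteDimensional.proper ℝ Q
  obtain ⟨u, hu, hur, -, hu2⟩ := usq_exists (Q × ℝ)
  have hτ' : Tube (τ ∘ Prod.map u id) := by
    refine ⟨hτ.emb.comp (hu.prodMap IsOpenEmbedding.id), ?_⟩
    exact hτ.bdd.comp ⟨0, fun p => by simp⟩
  obtain ⟨c', hc', hcc⟩ := lift_curve hτ'.emb.isEmbedding hc (fun r => by
    obtain ⟨x, s, hx, h⟩ := hcτ r
    have : x ∈ range u := by rw [hur]; simpa using hx
    obtain ⟨w, rfl⟩ := this
    exact ⟨(w, s), h⟩)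
  obtain ⟨D, hD⟩ := hτ'.bdd
  obtain ⟨g, hg, hgO⟩ := lemC hd _ (hO.preimage hτ'.emb.continuous) c' hc'
    (fun r => by rw [mem_preimage, hcc]; exact hcO r) (C + D) (fun r => by
      have h1 := hC r
      have h2 := hD (c' r)
      rw [hcc] at h2
      rw [abs_le] at *
      constructor <;> linarith)
  obtain ⟨G, hG, hGτ, hGo⟩ := transport hτ' hg
  refine ⟨G, hG, fun y hy => hGo y ?_, fun x r hx => ?_⟩
  · rintro ⟨⟨w, s⟩, rfl⟩
    refine hy (u w) s ?_ rfl
    have : u w ∈ range u := mem_range_self w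
    rw [hur] at this
    simpa using this
  · obtain ⟨w, hw, rfl⟩ := hu2 x hx
    have := hGτ (w, r)
    simp only [Function.comp, Prod.map_apply, id] at this
    rw [this]
    exact hgO w r hw

end

section Sphere
variable {E : Type*} [NormedAddCommGroup E] [InnerProductSpace ℝ E] [FiniteDimensional ℝ E]

theorem sphere_swap (p q : Metric.sphere (0 : E) 1) :
    ∃ A : Metric.sphere (0 : E) 1 ≃ₜ Metric.sphere (0 : E) 1, A p = q := by
  set R := Submodule.reflection (ℝ ∙ ((p : E) - q))ᗮ
  refine ⟨R.toHomeomorph.subtype fun x => by simp, ?_⟩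
  ext
  exact Submodule.reflection_sub (by simp)

theorem curve_miss (hE : 3 ≤ Module.finrank ℝ E) {k : ℝ → Metric.sphere (0 : E) 1}
    (hk : Continuous k) {h : ℝ → ℝ} (hh : Continuous h) {O : Set (Metric.sphere (0 : E) 1 × ℝ)}
    (hO : IsOpen O) (hkO : ∀ r, (k r, h r) ∈ O) :
    ∃ k' : ℝ → Metric.sphere (0 : E) 1, Continuous k' ∧ (∀ r, (k' r, h r) ∈ O) ∧
      ∃ p, ∀ r, k' r ≠ p := by
  have hemb : IsEmbedding (fun x : Metric.sphere (0 : E) 1 × ℝ => ((x.1 : E), x.2)) :=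
    IsEmbedding.subtypeVal.prodMap IsEmbedding.id
  obtain ⟨O', hO', rfl⟩ := hemb.isInducing.isOpen_iff.1 hO
  set OE : Set (E × ℝ) := {v | v.1 ≠ 0} ∩ (fun v : E × ℝ => (‖v.1‖⁻¹ • v.1, v.2)) ⁻¹' O'
  have hOE : IsOpen OE := by
    refine ContinuousOn.isOpen_inter_preimage ?_ (isOpen_ne_fun (by fun_prop) (by fun_prop)) hO'
    have : ∀ v ∈ {v : E × ℝ | v.1 ≠ 0}, ‖v.1‖ ≠ 0 := fun v hv => norm_ne_zero_iff.2 hv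
    fun_prop (disch := assumption)
  obtain ⟨ε, hεc, hε0, -, hεO⟩ := pos_dist hOE (c := fun r => ((k r : E), h r)) (by fun_prop)
    (fun r => ⟨fun h0 => by
      have := norm_eq_of_mem_sphere (k r); simp only at h0; rw [h0] at this; simp at this, by
      have := hkO r
      simpa using this⟩)
  obtain ⟨k0, hk0, hk0d, -⟩ := (show Continuous fun r => (k r : E) by fun_prop).exists_contDiff_approx 1
    hεc hε0
  have hk0' : ContDiff ℝ 1 k0 := by exact_mod_cast hk0
  have hin : ∀ r, (k0 r, h r) ∈ OE := fun r => hεO r _ (by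
    rw [Prod.dist_eq]; exact max_lt (hk0d r) (by simpa using hε0 r))
  have hdense := ContDiff.dense_compl_range_of_finrank_lt_finrank
    (f := fun x : ℝ × ℝ => x.2 • k0 x.1) (contDiff_snd.smul (hk0'.comp contDiff_fst))
    (by simp only [Module.finrank_prod, Module.finrank_self]; omega)
  obtain ⟨p', hp'⟩ := hdense.nonempty
  have hp0 : p' ≠ 0 := fun h => hp' ⟨(0, 0), by simp [h]⟩
  have hn : ∀ v : E, v ≠ 0 → ‖v‖⁻¹ • v ∈ Metric.sphere (0 : E) 1 := fun v hv => by
    rw [mem_sphere_zero_iff_norm, norm_smul, norm_inv, norm_norm, inv_mul_cancel₀ (norm_ne_zero_iff.2 hv)]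
  refine ⟨fun r => ⟨_, hn (k0 r) (hin r).1⟩, ?_, fun r => (hin r).2, ⟨_, hn p' hp0⟩, fun r he => ?_⟩
  · apply Continuous.subtype_mk
    have := hk0'.continuous
    have : ∀ r, ‖k0 r‖ ≠ 0 := fun r => norm_ne_zero_iff.2 (hin r).1
    fun_prop (disch := assumption)
  · apply hp'
    have := congrArg Subtype.val he
    simp only at this
    refine ⟨(r, ‖p'‖ * ‖k0 r‖⁻¹), ?_⟩
    simp only
    rw [mul_smul, this, smul_smul, mul_inv_cancel₀ (norm_ne_zero_iff.2 hp0), one_smul]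

end Sphere

section
variable {Q : Type*} [NormedAddCommGroup Q] [NormedSpace ℝ Q] [FiniteDimensional ℝ Q]

theorem bdd_prodCongr {X Y : Type*} [TopologicalSpace X] [TopologicalSpace Y] (H : X ≃ₜ Y) :
    Bdd (H.prodCongr (Homeomorph.refl ℝ)) := ⟨0, fun p => by simp⟩

theorem T1 (hd : 2 ≤ Module.finrank ℝ Q) {τ : (Q × ℝ) × ℝ → OnePoint (Q × ℝ) × ℝ} (hτ : Tube τ) :
    ∃ α : OnePoint (Q × ℝ) × ℝ ≃ₜ OnePoint (Q × ℝ) × ℝ, Bdd α ∧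
      ∀ x r, ‖x‖ ≤ 2 → ∃ y s, ‖y‖ < 1 ∧ α (iota (x, r)) = τ (y, s) := by
  have : ProperSpace Q := FiniteDimensional.proper ℝ Q
  set d := Module.finrank ℝ (Q × ℝ) with hd'
  have hd3 : 3 ≤ d := by simp only [hd', Module.finrank_prod, Module.finrank_self]; omega
  let e : OnePoint (Q × ℝ) ≃ₜ Metric.sphere (0 : EuclideanSpace ℝ (Fin (d + 1))) 1 :=
    onePointEquivSphereOfFinrankEq (by simp [hd'])
  set O : Set (OnePoint (Q × ℝ) × ℝ) := τ '' {p | ‖p.1‖ < 1}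
  have hO : IsOpen O := hτ.emb.isOpenMap _ (isOpen_lt (by fun_prop) (by fun_prop))
  have hτc := hτ.emb.continuous
  have hO' : IsOpen ((fun z : Metric.sphere (0 : EuclideanSpace ℝ (Fin (d + 1))) 1 × ℝ =>
    (e.symm z.1, z.2)) ⁻¹' O) := hO.preimage (by fun_prop)
  obtain ⟨k', hk', hk'O, p, hp⟩ := curve_miss (by simp; omega)
    (k := fun r => e (τ (0, r)).1) (by fun_prop) (h := fun r => (τ (0, r)).2) (by fun_prop) hO'
    (fun r => by
      simp only [mem_preimage, Homeomorph.symm_apply_apply]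
      exact ⟨(0, r), by simp, rfl⟩)
  obtain ⟨A, hA⟩ := sphere_swap p (e OnePoint.infty)
  set H : OnePoint (Q × ℝ) ≃ₜ OnePoint (Q × ℝ) := (e.trans A).trans e.symm
  set α0 := H.prodCongr (Homeomorph.refl ℝ)
  obtain ⟨c, hc, hcc⟩ := lift_curve (tube_iota (F := Q × ℝ)).emb.isEmbedding
    (c := fun r => α0 (e.symm (k' r), (τ (0, r)).2)) (by fun_prop) (fun r => by
      have hne : e.symm (A (k' r)) ≠ OnePoint.infty := by
        intro h0
        have h1 : A (k' r) = A p := by rw [hA, ← h0]; simp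
        exact hp r (A.injective h1)
      obtain ⟨x, hx⟩ := OnePoint.ne_infty_iff_exists.1 hne
      exact ⟨(x, (τ (0, r)).2), by simp [α0, H, hx]⟩)
  obtain ⟨D, hD⟩ := hτ.bdd
  have hO2 : IsOpen {z | ∃ y ∈ O, α0 y = iota z} := by
    have : {z | ∃ y ∈ O, α0 y = iota z} = iota (F := Q × ℝ) ⁻¹' (α0 '' O) := by
      ext z; simp [iota]
    rw [this]
    exact (α0.isOpenMap _ hO).preimage tube_iota.emb.continuous
  obtain ⟨g, hg, hgO⟩ := lemC hd _ hO2 c hc (fun r => ⟨_, hk'O r, (hcc r).symm⟩) D (fun r => by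
    have h1 := congrArg Prod.snd (hcc r)
    have h2 := hD (0, r)
    have h3 : (c r).2 = (τ (0, r)).2 := by simpa [iota, α0] using h1
    rw [h3]; exact h2)
  obtain ⟨G, hG, hGτ, -⟩ := transport tube_iota hg
  set S : OnePoint (Q × ℝ) ≃ₜ OnePoint (Q × ℝ) :=
    (Homeomorph.smulOfNeZero (1 / 2 : ℝ) (by norm_num)).onePointCongr
  refine ⟨(((S.prodCongr (Homeomorph.refl ℝ)).trans G).trans α0.symm), ?_, ?_⟩
  · exact (Bdd.symm (bdd_prodCongr H)).comp (hG.comp (bdd_prodCongr S))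
  · intro x r hx
    have h1 : (S.prodCongr (Homeomorph.refl ℝ)) (iota (x, r)) = iota ((1 / 2 : ℝ) • x, r) := by
      rfl
    have h2 : ‖(1 / 2 : ℝ) • x‖ ≤ 1 := by rw [norm_smul]; norm_num; linarith
    obtain ⟨z, ⟨⟨y, s⟩, hys, rfl⟩, hz⟩ := hgO _ r h2
    refine ⟨y, s, hys, ?_⟩
    simp only [Homeomorph.trans_apply, h1, hGτ, ← hz, Homeomorph.symm_apply_apply]

end
end LFS


open Filter Topology

namespace LFS
open Set

section
variable {F : Type*} [NormedAddCommGroup F] [NormedSpace ℝ F]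

theorem tube_nbhd [ProperSpace F] {O : Set (F × ℝ)} (hO : IsOpen O)
    (h : ∀ x r, ‖x‖ ≤ 1 → (x, r) ∈ O) :
    ∃ ε : ℝ → ℝ, Continuous ε ∧ (∀ r, 0 < ε r) ∧ ∀ x r, ‖x‖ < 1 + ε r → (x, r) ∈ O := by
  rcases eq_empty_or_nonempty Oᶜ with hE | hE
  · exact ⟨fun _ => 1, continuous_const, fun _ => one_pos, fun x r _ => by
      rw [compl_empty_iff] at hE; rw [hE]; trivial⟩
  have hK : IsCompact (Metric.closedBall (0 : F) 1) := isCompact_closedBall _ _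
  have hne : (Metric.closedBall (0 : F) 1).Nonempty := ⟨0, by simp⟩
  have hfc : Continuous fun p : ℝ × F => Metric.infDist (p.2, p.1) Oᶜ :=
    (Metric.continuous_infDist_pt _).comp (by fun_prop)
  have hfr : ∀ r : ℝ, Continuous fun x : F => Metric.infDist (x, r) Oᶜ := fun r =>
    (Metric.continuous_infDist_pt _).comp (by fun_prop)
  refine ⟨fun r => sInf ((fun x => Metric.infDist (x, r) Oᶜ) '' Metric.closedBall (0 : F) 1),
    hK.continuous_sInf (f := fun r x => Metric.infDist (x, r) Oᶜ) hfc, fun r => ?_, fun x r hx => ?_⟩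
  · obtain ⟨x, hx, he⟩ := hK.exists_sInf_image_eq hne (hfr r).continuousOn
    simp only
    rw [he]
    refine (hO.isClosed_compl.notMem_iff_infDist_pos hE).1 ?_
    simpa using h x r (by simpa using hx)
  · set x' : F := (max 1 ‖x‖)⁻¹ • x
    have hm : 0 < max 1 ‖x‖ := zero_lt_one.trans_le (le_max_left _ _)
    have hx' : x' ∈ Metric.closedBall (0 : F) 1 := by
      simp only [Metric.mem_closedBall, dist_zero_right, x', norm_smul, norm_inv,
        Real.norm_of_nonneg hm.le]
      rw [inv_mul_le_iff₀ hm, mul_one]; exact le_max_right _ _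
    by_cases h1 : ‖x‖ ≤ 1
    · exact h x r h1
    by_contra hxO
    have h2 : Metric.infDist (x', r) Oᶜ ≤ dist (x', r) (x, r) :=
      Metric.infDist_le_dist_of_mem hxO
    have h3 : sInf ((fun x => Metric.infDist (x, r) Oᶜ) '' Metric.closedBall (0 : F) 1) ≤
        Metric.infDist (x', r) Oᶜ :=
      csInf_le (hK.image (hfr r)).bddBelow (mem_image_of_mem _ hx')
    have h4 : dist (x', r) (x, r) = ‖x‖ - 1 := by
      rw [Prod.dist_eq, dist_self, max_eq_left dist_nonneg, dist_eq_norm]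
      have hx0 : 0 < ‖x‖ := by linarith
      have : x' - x = (‖x‖⁻¹ - 1) • x := by
        simp only [x', max_eq_right (not_le.1 h1).le, sub_smul, one_smul]
      rw [this, norm_smul, Real.norm_eq_abs, abs_of_nonpos]
      · field_simp; ring
      · have : ‖x‖⁻¹ ≤ 1 := inv_le_one_of_one_le₀ (not_le.1 h1).le
        linarith
    linarith

theorem lift_on {X Y Z : Type*} [TopologicalSpace X] [TopologicalSpace Y] [TopologicalSpace Z]
    [Nonempty X] {τ : X → Y} (hτ : IsEmbedding τ) {s : Set Z} {c : Z → Y} (hc : ContinuousOn c s)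
    (h : ∀ r ∈ s, c r ∈ range τ) : ∃ c' : Z → X, ContinuousOn c' s ∧ ∀ r ∈ s, τ (c' r) = c r := by
  choose! c' hc' using h
  refine ⟨c', ?_, hc'⟩
  rw [hτ.isInducing.continuousOn_iff]
  exact hc.congr fun r hr => hc' r hr

end

section
variable {Q : Type*} [NormedAddCommGroup Q] [NormedSpace ℝ Q] [FiniteDimensional ℝ Q]

theorem lemT_a (hd : 2 ≤ Module.finrank ℝ Q) {T : (Q × ℝ) × ℝ → OnePoint (Q × ℝ) × ℝ}
    (hT : Tube T) (hT2 : ∀ x r, ‖x‖ ≤ 2 → ∃ y s, ‖y‖ < 1 ∧ T (y, s) = iota (x, r)) :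
    ∃ P S : OnePoint (Q × ℝ) × ℝ ≃ₜ OnePoint (Q × ℝ) × ℝ, Bdd P ∧ Bdd S ∧
      (∀ x r, ‖x‖ ≤ 1 → P (iota (x, r)) = iota ((1 / 2 : ℝ) • x, r)) ∧
      (∀ w, (∀ x r, ‖x‖ < 1 → T (x, r) ≠ w) → S w = w) ∧
      (∀ x r, ‖x‖ ≤ 1 → S (T ((1 / 2 : ℝ) • x, r)) = P (T (x, r))) ∧
      (∀ x r, ‖x‖ ≤ 1 → ∃ y s, ‖y‖ < 1 ∧ iota (y, s) = P (T (x, r))) := by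
  have : ProperSpace Q := FiniteDimensional.proper ℝ Q
  set B : Set ((Q × ℝ) × ℝ) := {p | ‖p.1‖ < 1} with hB
  set D : Set ((Q × ℝ) × ℝ) := {p | ‖p.1‖ ≤ 1} with hD
  have hBo : IsOpen B := isOpen_lt (by fun_prop) (by fun_prop)
  have hBD : B ⊆ D := fun p (hp : ‖p.1‖ < 1) => show ‖p.1‖ ≤ 1 from hp.le
  have hiB : IsOpen (iota '' B) := tube_iota.emb.isOpenMap _ hBo
  have hi2 : ∀ x r, ‖x‖ ≤ 2 → iota (x, r) ∈ T '' B := fun x r hx => by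
    obtain ⟨y, s, hy, h⟩ := hT2 x r hx; exact ⟨(y, s), hy, h⟩
  have hiBT : iota '' B ⊆ T '' B := by
    rintro _ ⟨⟨x, r⟩, hx, rfl⟩
    exact hi2 x r (by simp only [hB, mem_setOf_eq] at hx; linarith)
  have hTi := hT.emb.injective
  -- G
  obtain ⟨G, hG, hGid, hG2⟩ := T2 hd hT hiB (c := fun r => iota (0, r))
    tube_iota.emb.continuous.curry_right (C := 0) (fun r => by simp [iota])
    (fun r => ⟨(0, r), by simp [hB], rfl⟩) (fun r => hT2 0 r (by simp))
  have hGid' : ∀ w, w ∉ T '' B → G w = w := fun w hw => hGid w fun x r hx h => hw ⟨(x, r), hx, h⟩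
  -- s
  obtain ⟨g, hg, hg1, -, -⟩ := radial (F := Q × ℝ) (fun _ => 1 / 2) (fun _ => 1) continuous_const
    continuous_const (fun _ => by norm_num) (fun _ => by norm_num) (fun _ => one_pos)
  obtain ⟨s, hs, hsT, -⟩ := transport hT hg
  have hsT' : ∀ x r, ‖x‖ ≤ 1 → s (T (x, r)) = T ((1 / 2 : ℝ) • x, r) := fun x r hx => by
    rw [hsT, hg1 x r hx]
  have hhalf : ∀ x : Q × ℝ, ‖x‖ ≤ 1 → ‖(1 / 2 : ℝ) • x‖ ≤ 1 / 2 := fun x hx => by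
    rw [norm_smul]; norm_num; linarith
  -- P
  set P := s.trans G
  have hPT : ∀ x r, ‖x‖ ≤ 1 → P (T (x, r)) ∈ iota '' B := fun x r hx => by
    simp only [P, Homeomorph.trans_apply, hsT' x r hx]
    exact hG2 _ r (hhalf x hx)
  have hPb : Bdd P := hG.comp hs
  have hTP := hT.comp P hPb
  obtain ⟨D0, hD0⟩ := hTP.bdd
  obtain ⟨H, hH, hHid, hH2⟩ := T2 hd tube_iota (O := P '' (T '' B))
    (P.isOpenMap _ (hT.emb.isOpenMap _ hBo)) (c := fun r => P (T (0, r)))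
    hTP.emb.continuous.curry_right (C := D0) (fun r => hD0 (0, r))
    (fun r => ⟨_, ⟨(0, r), by simp [hB], rfl⟩, rfl⟩) (fun r => by
      obtain ⟨⟨x, t⟩, hx, h⟩ := hPT 0 r (by simp)
      exact ⟨x, t, hx, h⟩)
  have hHid' : ∀ w, w ∉ iota '' B → H w = w := fun w hw =>
    hHid w fun x r hx h => hw ⟨(x, r), hx, h⟩
  -- s1
  obtain ⟨g1, hg1', hg11, hg12, -⟩ := radial (F := Q × ℝ) (fun _ => 1 / 2) (fun _ => 1)
    continuous_const continuous_const (fun _ => by norm_num) (fun _ => by norm_num)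
    (fun _ => one_pos)
  obtain ⟨s1, hs1, hs1T, hs1o⟩ := transport tube_iota hg1'
  have hs1id : ∀ w, w ∉ T '' B → s1 w = w := fun w hw => by
    by_cases hr : w ∈ range (iota : (Q × ℝ) × ℝ → _)
    · obtain ⟨⟨x, r⟩, rfl⟩ := hr
      rw [hs1T, hg12]
      by_contra hlt
      exact hw (hi2 x r (by norm_num at hlt; exact hlt.le))
    · exact hs1o w hr
  -- s'
  obtain ⟨ε, hεc, hε0, hε⟩ := tube_nbhd (O := (P ∘ T) ⁻¹' (iota '' B))
    (hiB.preimage hTP.emb.continuous) (fun x r hx => hPT x r hx)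
  obtain ⟨g2, hg2', hg21, hg22, -⟩ := radial (F := Q × ℝ) (fun _ => 1 / 2) ε
    continuous_const hεc (fun _ => by norm_num) (fun _ => by norm_num) hε0
  obtain ⟨s2, hs2, hs2T, hs2o⟩ := transport hT hg2'
  have hs2T' : ∀ x r, ‖x‖ ≤ 1 → s2 (T (x, r)) = T ((1 / 2 : ℝ) • x, r) := fun x r hx => by
    rw [hs2T, hg21 x r hx]
  have hs2id : ∀ w, P w ∉ iota '' B → s2 w = w := fun w hw => by
    by_cases hr : w ∈ range T
    · obtain ⟨⟨x, r⟩, rfl⟩ := hr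
      rw [hs2T, hg22]
      by_contra hlt
      exact hw (hε x r (not_le.1 hlt))
    · exact hs2o w hr
  have mem_of_id : ∀ (A : OnePoint (Q × ℝ) × ℝ ≃ₜ OnePoint (Q × ℝ) × ℝ)
      (V : Set (OnePoint (Q × ℝ) × ℝ)), (∀ w, w ∉ V → A w = w) → ∀ w, w ∈ V → A w ∈ V := by
    intro A V hA w hw
    by_contra h
    have := hA _ h
    exact h (by rw [A.injective this]; exact hw)
  have symm_id : ∀ (A : OnePoint (Q × ℝ) × ℝ ≃ₜ OnePoint (Q × ℝ) × ℝ)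
      (V : Set (OnePoint (Q × ℝ) × ℝ)), (∀ w, w ∉ V → A w = w) → ∀ w, w ∉ V → A.symm w = w := by
    intro A V hA w hw
    rw [A.symm_apply_eq, hA w hw]
  set P' := s1.trans (H.trans (((s2.trans G).symm.trans P).trans H.symm))
  have hP' : ∀ w, P' w = H.symm (P (s2.symm (G.symm (H (s1 w))))) := fun w => rfl
  have hP'b : Bdd P' := by
    have h1 : Bdd (s2.trans G).symm := Bdd.symm (hG.comp hs2)
    exact ((hH.symm.comp (hPb.comp h1)).comp hH).comp hs1
  refine ⟨P', s.symm.trans P', hP'b, hP'b.comp hs.symm, fun x r hx => ?_, fun w hw => ?_,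
    fun x r hx => ?_, fun x r hx => ?_⟩
  · have h1 : s1 (iota (x, r)) = iota ((1 / 2 : ℝ) • x, r) := by rw [hs1T, hg11 x r hx]
    obtain ⟨_, ⟨⟨y, t⟩, hy, rfl⟩, hz⟩ := hH2 _ r (hhalf x hx)
    rw [hP', h1, ← hz]
    have h2 : s2.symm (G.symm (P (T (y, t)))) = T (y, t) := by
      rw [Homeomorph.symm_apply_eq, Homeomorph.symm_apply_eq, hs2T' y t (hBD hy)]
      simp only [P, Homeomorph.trans_apply, hsT' y t (hBD hy)]
    rw [h2, hz, Homeomorph.symm_apply_apply]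
  · have hwT : w ∉ T '' B := by rintro ⟨⟨x, r⟩, hx, h⟩; exact hw x r hx h
    obtain ⟨v, rfl⟩ := s.surjective w
    have hvT : v ∉ T '' B := by
      rintro ⟨⟨x, r⟩, hx, rfl⟩
      apply hwT
      refine ⟨((1 / 2 : ℝ) • x, r), ?_, (hsT' x r (hBD hx)).symm⟩
      have := hhalf x (hBD hx)
      simp only [hB, mem_setOf_eq]
      linarith
    have hvi : v ∉ iota '' B := fun h => hvT (hiBT h)
    have hPv : P v = s v := hGid' _ hwT
    have hs2v : s2.symm v = v := by
      rw [Homeomorph.symm_apply_eq, hs2id v]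
      rw [hPv]
      exact fun h => hwT (hiBT h)
    simp only [Homeomorph.trans_apply, Homeomorph.symm_apply_apply]
    rw [hP', hs1id v hvT, hHid' v hvi, symm_id G _ hGid' v hvT, hs2v, hPv,
      symm_id H _ hHid' _ (fun h => hwT (hiBT h))]
  · simp only [Homeomorph.trans_apply]
    rw [← hsT' x r hx, Homeomorph.symm_apply_apply]
  · have hTD : ∀ A : OnePoint (Q × ℝ) × ℝ ≃ₜ OnePoint (Q × ℝ) × ℝ, (∀ w, w ∉ T '' B → A w = w) →
        ∀ w ∈ T '' D, A w ∈ T '' D := fun A hA =>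
      mem_of_id A _ fun w hw => hA w fun h => hw (image_mono hBD h)
    have h1 : s1 (T (x, r)) ∈ T '' D := hTD s1 hs1id _ ⟨(x, r), hx, rfl⟩
    have h2 := hTD H (fun w hw => hHid' w fun h => hw (hiBT h)) _ h1
    have h3 := hTD G.symm (symm_id G _ hGid') _ h2
    have h4 : P (s2.symm (G.symm (H (s1 (T (x, r)))))) ∈ iota '' B := by
      by_contra hn
      have h5 := hs2id _ hn
      rw [Homeomorph.apply_symm_apply] at h5
      rw [← h5] at hn
      obtain ⟨⟨y, t⟩, hy, h6⟩ := h3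
      rw [← h6] at hn
      exact hn (hPT y t hy)
    have h5 := mem_of_id H.symm _ (symm_id H _ hHid') _ h4
    rw [← hP'] at h5
    obtain ⟨⟨y, t⟩, hy, h⟩ := h5
    exact ⟨y, t, hy, h⟩

end
end LFS


open Filter Topology

namespace LFS
open Set

section
variable {F : Type*} [NormedAddCommGroup F] [NormedSpace ℝ F]

/-- doubling on the first factor -/
noncomputable def dbl (F : Type*) [NormedAddCommGroup F] [NormedSpace ℝ F] : F × ℝ ≃ₜ F × ℝ :=
  (Homeomorph.smulOfNeZero (2 : ℝ) two_ne_zero).prodCongr (Homeomorph.refl ℝ)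

theorem dbl_apply (p : F × ℝ) : dbl F p = ((2 : ℝ) • p.1, p.2) := rfl

theorem dbl_zpow (k : ℤ) (p : F × ℝ) : (dbl F ^ k) p = ((2 : ℝ) ^ k • p.1, p.2) := by
  have hinv : ∀ p, (dbl F)⁻¹ p = ((2 : ℝ)⁻¹ • p.1, p.2) := fun p => by
    have : dbl F ((2 : ℝ)⁻¹ • p.1, p.2) = p := by rw [dbl_apply]; simp
    nth_rw 1 [← this]
    rw [← Homeomorph.mul_apply, inv_mul_cancel, Homeomorph.one_apply]
  induction k using Int.induction_on generalizing p with
  | zero => simp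
  | succ k ih =>
    rw [zpow_add_one, Homeomorph.mul_apply, ih, dbl_apply, smul_smul, zpow_add_one₀ two_ne_zero]
  | pred k ih =>
    rw [zpow_sub_one, Homeomorph.mul_apply, ih, hinv, smul_smul, zpow_sub_one₀ two_ne_zero]

theorem ell_close {x v : F} (hx : 1 ≤ ‖x‖) (h1 : ‖x‖ / 4 ≤ ‖v‖) (h2 : ‖v‖ ≤ 4 * ‖x‖) :
    |ell v - ell x| ≤ Real.log 4 := by
  have hx0 : 0 < ‖x‖ := by linarith
  simp only [ell, max_eq_right hx]
  have h3 : Real.log (max 1 ‖v‖) ≤ Real.log (4 * ‖x‖) :=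
    Real.log_le_log (by positivity) (max_le (by linarith) h2)
  have h4 : Real.log (‖x‖ / 4) ≤ Real.log (max 1 ‖v‖) :=
    Real.log_le_log (by positivity) (h1.trans (le_max_right _ _))
  rw [Real.log_mul (by norm_num) hx0.ne'] at h3
  rw [Real.log_div hx0.ne' (by norm_num)] at h4
  rw [abs_le]
  constructor <;> linarith

theorem lemT_b [ProperSpace F] {T : F × ℝ → OnePoint F × ℝ} (hT : Tube T)
    (hT2 : ∀ x r, ‖x‖ ≤ 1 → ∃ y s, ‖y‖ < 1 ∧ T (y, s) = iota (x, r))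
    (P S : OnePoint F × ℝ ≃ₜ OnePoint F × ℝ) (hP : Bdd P) (hS : Bdd S)
    (hPi : ∀ x r, ‖x‖ ≤ 1 → P (iota (x, r)) = iota ((1 / 2 : ℝ) • x, r))
    (hSid : ∀ w, (∀ x r, ‖x‖ < 1 → T (x, r) ≠ w) → S w = w)
    (hST : ∀ x r, ‖x‖ ≤ 1 → S (T ((1 / 2 : ℝ) • x, r)) = P (T (x, r)))
    (hPT : ∀ x r, ‖x‖ ≤ 1 → ∃ y s, ‖y‖ < 1 ∧ iota (y, s) = P (T (x, r))) :
    ∃ α : OnePoint F × ℝ ≃ₜ OnePoint F × ℝ, Bdd α ∧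
      ∀ x r, ‖x‖ ≤ 1 → α (iota (x, r)) = T (x, r) := by
  set D : Set (F × ℝ) := {p | ‖p.1‖ ≤ 1}
  have hDc : IsClosed D := isClosed_le (by fun_prop) (by fun_prop)
  have hTc := hT.emb.continuous
  have hTi := hT.emb.injective
  have hii := iota_injective (F := F)
  -- S preserves T(B)
  have hSB : ∀ p : F × ℝ, ‖p.1‖ < 1 → ∃ q : F × ℝ, ‖q.1‖ < 1 ∧ S (T p) = T q := fun p hp => by
    by_contra hcon
    push Not at hcon
    have := hSid (S (T p)) (fun x r hx h => hcon (x, r) hx h.symm)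
    exact hcon p hp (S.injective this)
  have hSB' : ∀ p : F × ℝ, ‖p.1‖ < 1 → ∃ q : F × ℝ, ‖q.1‖ < 1 ∧ S (T q) = T p := fun p hp => by
    by_contra hcon
    push Not at hcon
    have h1 := hSid (S.symm (T p)) (fun x r hx h => hcon (x, r) hx (by rw [h]; simp))
    rw [S.apply_symm_apply] at h1
    exact hcon p hp (by nth_rw 1 [h1]; simp)
  have hSb : ∀ p : F × ℝ, ‖p.1‖ = 1 → S (T p) = T p := fun p hp =>
    hSid _ fun x r hx h => by rw [← hTi h] at hp; simp only at hp; linarith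
  have hPT' : ∀ p : F × ℝ, ‖p.1‖ ≤ 1 → ∃ q : F × ℝ, ‖q.1‖ < 1 ∧ iota q = P (T p) := fun p hp => by
    obtain ⟨y, s, h1, h2⟩ := hPT p.1 p.2 hp
    exact ⟨(y, s), h1, h2⟩
  have hPST : ∀ p : F × ℝ, ‖p.1‖ ≤ 1 → ∃ q : F × ℝ, ‖q.1‖ < 1 ∧ iota q = P (S (T p)) :=
    fun p hp => by
    rcases hp.lt_or_eq with hp | hp
    · obtain ⟨q, hq, h⟩ := hSB p hp
      rw [h]; exact hPT' q hq.le
    · rw [hSb p hp]; exact hPT' p hp.le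
  obtain ⟨κ, hκc, hκ⟩ := lift_on (tube_iota (F := F)).emb.isEmbedding (s := D)
    (c := fun p => P (S (T p))) (by fun_prop) (fun p hp => by
      obtain ⟨q, -, h⟩ := hPST p hp; exact ⟨q, h⟩)
  obtain ⟨β0, hβc, hβ⟩ := lift_on (tube_iota (F := F)).emb.isEmbedding (s := D)
    (c := fun p => P (T p)) (by fun_prop) (fun p hp => by
      obtain ⟨q, -, h⟩ := hPT' p hp; exact ⟨q, h⟩)
  have hκ : ∀ p : F × ℝ, ‖p.1‖ ≤ 1 → iota (κ p) = P (S (T p)) := hκ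
  have hβ : ∀ p : F × ℝ, ‖p.1‖ ≤ 1 → iota (β0 p) = P (T p) := hβ
  have hκ1 : ∀ p : F × ℝ, ‖p.1‖ ≤ 1 → ‖(κ p).1‖ < 1 := fun p hp => by
    obtain ⟨q, h1, h2⟩ := hPST p hp
    rw [← hκ p hp] at h2
    rw [← hii h2]; exact h1
  have hβ1 : ∀ p : F × ℝ, ‖p.1‖ ≤ 1 → ‖(β0 p).1‖ < 1 := fun p hp => by
    obtain ⟨q, h1, h2⟩ := hPT' p hp
    rw [← hβ p hp] at h2
    rw [← hii h2]; exact h1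
  have hPi' : ∀ p : F × ℝ, ‖p.1‖ ≤ 1 → P (iota p) = iota ((1 / 2 : ℝ) • p.1, p.2) :=
    fun p hp => hPi p.1 p.2 hp
  have hST' : ∀ p : F × ℝ, ‖p.1‖ ≤ 1 → S (T ((1 / 2 : ℝ) • p.1, p.2)) = P (T p) :=
    fun p hp => hST p.1 p.2 hp
  set V : Set (F × ℝ) := {y | ∃ p : F × ℝ, ‖p.1‖ < 1 ∧ iota y = P (T p)}
  have f1 : ∀ p : F × ℝ, ‖p.1‖ = 1 → κ p = β0 p := fun p hp => by
    apply hii; rw [hκ p hp.le, hβ p hp.le, hSb p hp]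
  have hhalf : ∀ x : F, ‖(1 / 2 : ℝ) • x‖ = ‖x‖ / 2 := fun x => by
    rw [norm_smul]; norm_num; ring
  have f2 : ∀ p : F × ℝ, ‖p.1‖ ≤ 1 → dbl F (κ ((1 / 2 : ℝ) • p.1, p.2)) = β0 p := fun p hp => by
    have h1 : κ ((1 / 2 : ℝ) • p.1, p.2) = ((1 / 2 : ℝ) • (β0 p).1, (β0 p).2) := by
      apply hii
      rw [hκ _ (by simp only [hhalf]; linarith [norm_nonneg p.1]), hST' p hp, ← hβ p hp,
        hPi' _ (hβ1 p hp).le]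
    rw [h1, dbl_apply]; simp
  have f3 : ∀ y ∈ V, ‖y.1‖ < 1 := fun y ⟨p, hp, h⟩ => by
    rw [← hβ p hp.le] at h
    rw [hii h]; exact hβ1 p hp.le
  have f3' : ∀ y : F × ℝ, ‖y.1‖ ≤ 1 / 2 → y ∈ V := fun y hy => by
    obtain ⟨x, s, hx, h⟩ := hT2 ((2 : ℝ) • y.1) y.2 (by rw [norm_smul]; norm_num; linarith)
    refine ⟨(x, s), hx, ?_⟩
    rw [h, hPi _ _ (by rw [norm_smul]; norm_num; linarith)]
    simp [smul_smul]
  have hdn : ∀ y : F × ℝ, ‖(dbl F y).1‖ = 2 * ‖y.1‖ := fun y => by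
    rw [dbl_apply, norm_smul]; norm_num
  have f4 : ∀ y, dbl F y ∈ V → y ∈ V := fun y hy => by
    have := f3 _ hy
    rw [hdn] at this
    exact f3' y (by linarith)
  have f5 : ∀ p : F × ℝ, 1 / 2 ≤ ‖p.1‖ → ‖p.1‖ ≤ 1 → dbl F (κ p) ∉ V := fun p h1 h2 hV => by
    have h3 := f3 _ hV
    obtain ⟨u, hu, h⟩ := hV
    have h4 := hPi' _ h3.le
    rw [h, ← hST' u hu.le] at h4
    have h5 : iota ((1 / 2 : ℝ) • (dbl F (κ p)).1, (dbl F (κ p)).2) = P (S (T p)) := by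
      rw [← hκ p h2]; simp [dbl_apply, smul_smul]
    rw [h5] at h4
    have h6 := hTi (S.injective (P.injective h4))
    have h7 : ‖p.1‖ = ‖u.1‖ / 2 := by rw [← h6, hhalf]
    linarith
  have f6 : ∀ p : F × ℝ, ‖p.1‖ < 1 → κ p ∈ V := fun p hp => by
    obtain ⟨q, hq, h⟩ := hSB p hp
    exact ⟨q, hq, by rw [hκ p hp.le, h]⟩
  have f7 : ∀ y ∈ V, dbl F y ∉ V → ∃ p : F × ℝ, 1 / 2 ≤ ‖p.1‖ ∧ ‖p.1‖ < 1 ∧ κ p = y := by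
    rintro y ⟨u, hu, h⟩ hyV
    obtain ⟨w, hw, hwu⟩ := hSB' u hu
    have hκw : κ w = y := by apply hii; rw [hκ w hw.le, h, hwu]
    refine ⟨w, ?_, hw, hκw⟩
    by_contra hlt
    apply hyV
    have h2 : ‖(dbl F w).1‖ < 1 := by rw [hdn]; linarith
    have := f2 (dbl F w) h2.le
    have e : ((1 / 2 : ℝ) • (dbl F w).1, (dbl F w).2) = w := by simp [dbl_apply, smul_smul]
    rw [e, hκw] at this
    rw [this]
    exact ⟨dbl F w, h2, hβ _ h2.le⟩
  have f8 : ∀ p q : F × ℝ, ‖p.1‖ ≤ 1 → ‖q.1‖ ≤ 1 → κ p = κ q → p = q := fun p q hp hq h => by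
    have := congrArg iota h
    rw [hκ p hp, hκ q hq] at this
    exact hTi (S.injective (P.injective this))
  have f8' : ∀ p q : F × ℝ, ‖p.1‖ ≤ 1 → ‖q.1‖ ≤ 1 → β0 p = β0 q → p = q := fun p q hp hq h => by
    have := congrArg iota h
    rw [hβ p hp, hβ q hq] at this
    exact hTi (P.injective this)
  have f9 : ∀ p : F × ℝ, 1 / 2 ≤ ‖p.1‖ → ‖p.1‖ ≤ 1 → 1 / 4 < ‖(κ p).1‖ := fun p h1 h2 => by
    by_contra hlt
    exact f5 p h1 h2 (f3' _ (by rw [hdn]; linarith))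
  have g2 : ∀ (j : ℕ) y, y ∈ V → (dbl F ^ (-(j : ℤ))) y ∈ V := fun j y hy => by
    induction j with
    | zero => simpa using hy
    | succ j ih =>
      apply f4
      rw [← Homeomorph.mul_apply, ← zpow_one_add]
      convert ih using 3
      push_cast; ring
  have f5' : ∀ p : F × ℝ, 1 / 2 ≤ ‖p.1‖ → ‖p.1‖ ≤ 1 → ∀ j : ℤ, 1 ≤ j → (dbl F ^ j) (κ p) ∉ V := by
    intro p h1 h2 j hj hV
    obtain ⟨i, rfl⟩ : ∃ i : ℕ, j = i + 1 := ⟨(j - 1).toNat, by omega⟩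
    have := g2 i _ hV
    rw [← Homeomorph.mul_apply, ← zpow_add, show -(i : ℤ) + (i + 1) = 1 by ring, zpow_one] at this
    exact f5 p h1 h2 this
  -- the periodic extension
  let X := {p : F × ℝ // p.1 ≠ 0}
  let μ : X ≃ₜ X := (dbl F).subtype fun p => by simp [dbl_apply]
  let t : X → ℝ := fun x => Real.logb 2 ‖x.1.1‖ + 1
  have hn0 : ∀ x : X, ‖x.1.1‖ ≠ 0 := fun x => norm_ne_zero_iff.2 x.2
  have hn0' : ∀ x : X, 0 < ‖x.1.1‖ := fun x => norm_pos_iff.2 x.2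
  have ht : Continuous t := by
    simp only [t, Real.logb]
    have : Continuous fun x : X => ‖x.1.1‖ := by fun_prop
    exact ((this.log hn0).div_const _).add_const _
  have hμ : ∀ x, t (μ x) = t x + 1 := fun x => by
    have : ‖(μ x).1.1‖ = 2 * ‖x.1.1‖ := hdn x.1
    simp only [t, this]
    rw [Real.logb_mul two_ne_zero (hn0 x), Real.logb_self_eq_one one_lt_two]
    ring
  have ht0 : ∀ x : X, 0 ≤ t x ↔ 1 / 2 ≤ ‖x.1.1‖ := fun x => by
    simp only [t]
    rw [← sub_le_iff_le_add, zero_sub, Real.le_logb_iff_rpow_le one_lt_two (hn0' x),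
      Real.rpow_neg_one]
    norm_num
  have ht1 : ∀ x : X, t x ≤ 1 ↔ ‖x.1.1‖ ≤ 1 := fun x => by
    simp only [t]
    rw [add_le_iff_nonpos_left, Real.logb_nonpos_iff one_lt_two (hn0' x)]
  have ht1' : ∀ x : X, t x < 1 ↔ ‖x.1.1‖ < 1 := fun x => by
    simp only [t]
    rw [add_lt_iff_neg_right, Real.logb_neg_iff one_lt_two (hn0' x)]
  obtain ⟨K, hKc, hKμ, hKκ⟩ := periodic_ext ht hμ (dbl F) (fun x => κ x.1)
    (hκc.comp continuous_subtype_val.continuousOn fun x hx => (ht1 x).1 hx.2) (fun x hx => by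
      have h1 : ‖x.1.1‖ = 1 / 2 := by
        apply le_antisymm
        · by_contra h
          have h2 : t (μ x) = 1 := by rw [hμ, hx, zero_add]
          have h3 := (ht1 _).1 h2.le
          have h4 : ‖(μ x).1.1‖ = 2 * ‖x.1.1‖ := hdn x.1
          linarith
        · exact (ht0 x).1 hx.ge
      have h2 : ‖(μ x).1.1‖ = 1 := by
        have h4 : ‖(μ x).1.1‖ = 2 * ‖x.1.1‖ := hdn x.1
        rw [h4, h1]; norm_num
      rw [f1 _ h2, ← f2 _ h2.le]
      congr 2
      show ((1 / 2 : ℝ) • (dbl F x.1).1, (dbl F x.1).2) = x.1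
      simp [dbl_apply, smul_smul])
  have hKval : ∀ x : X, ∃ u : X, t u = t x - ⌊t x⌋ ∧ 0 ≤ t u ∧ t u < 1 ∧ x = (μ ^ ⌊t x⌋) u ∧
      K x = (dbl F ^ ⌊t x⌋) (κ u.1) := fun x => by
    have h1 : t ((μ ^ (-⌊t x⌋)) x) = t x - ⌊t x⌋ := by
      rw [t_zpow hμ]; push_cast; ring
    have h2 := Int.floor_le (t x)
    have h3 := Int.lt_floor_add_one (t x)
    have h4 : x = (μ ^ ⌊t x⌋) ((μ ^ (-⌊t x⌋)) x) := by
      rw [← Homeomorph.mul_apply, ← zpow_add, add_neg_cancel, zpow_zero, Homeomorph.one_apply]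
    refine ⟨(μ ^ (-⌊t x⌋)) x, h1, by linarith, by linarith, h4, ?_⟩
    nth_rw 1 [h4]
    rw [equiv_zpow hKμ, hKκ _ (by linarith) (by linarith)]
  have hμv : ∀ (k : ℤ) (x : X), ((μ ^ k) x).1 = (dbl F ^ k) x.1 := fun k x =>
    equiv_zpow (K := fun x : X => x.1) (μ := μ) (ν := dbl F) (fun x => rfl) k x
  have hKinj : Function.Injective K := by
    have key : ∀ x y : X, K x = K y → ⌊t x⌋ ≤ ⌊t y⌋ → x = y := fun x y h hle => by
      obtain ⟨u, -, hu0, hu1, hxu, hKx⟩ := hKval x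
      obtain ⟨w, -, hw0, hw1, hyw, hKy⟩ := hKval y
      rw [hKx, hKy] at h
      have h2 : κ u.1 = (dbl F ^ (⌊t y⌋ - ⌊t x⌋)) (κ w.1) := by
        have := congrArg (dbl F ^ (-⌊t x⌋)) h
        rw [← Homeomorph.mul_apply, ← Homeomorph.mul_apply, ← zpow_add, ← zpow_add, neg_add_cancel,
          zpow_zero, Homeomorph.one_apply] at this
        rw [this, sub_eq_neg_add]
      rcases hle.lt_or_eq with hlt | heq
      · exfalso
        refine f5' w.1 ((ht0 w).1 hw0) ((ht1 w).1 hw1.le) (⌊t y⌋ - ⌊t x⌋) (by omega) ?_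
        rw [← h2]
        exact f6 _ ((ht1' u).1 hu1)
      · rw [heq, sub_self, zpow_zero, Homeomorph.one_apply] at h2
        have := f8 _ _ ((ht1 u).1 hu1.le) ((ht1 w).1 hw1.le) h2
        rw [hxu, hyw, heq, Subtype.ext this]
    intro x y h
    rcases le_total ⌊t x⌋ ⌊t y⌋ with hle | hle
    · exact key x y h hle
    · exact (key y x h.symm hle).symm
  have hKV : ∀ x : X, 1 ≤ ‖x.1.1‖ → K x ∉ V := fun x hx => by
    obtain ⟨u, -, hu0, hu1, hxu, hKx⟩ := hKval x
    rw [hKx]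
    refine f5' _ ((ht0 u).1 hu0) ((ht1 u).1 hu1.le) _ ?_
    rw [Int.le_floor]
    by_contra hlt
    push_cast at hlt
    exact absurd ((ht1' x).1 (not_le.1 hlt)) (not_lt.2 hx)
  have hKsurj : ∀ y, y ∉ V → ∃ x : X, 1 ≤ ‖x.1.1‖ ∧ K x = y := fun y hy => by
    have hex : ∃ k : ℕ, (dbl F ^ (-(k : ℤ))) y ∈ V := by
      obtain ⟨k, hk⟩ := pow_unbounded_of_one_lt (2 * ‖y.1‖) one_lt_two
      refine ⟨k, f3' _ ?_⟩
      rw [dbl_zpow, norm_smul, zpow_neg, zpow_natCast, norm_inv, norm_pow, Real.norm_two,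
        inv_mul_le_iff₀ (by positivity)]
      linarith
    classical
    have hk := Nat.find_spec hex
    have hkm := fun m => Nat.find_min hex (m := m)
    set k := Nat.find hex
    obtain ⟨i, hi⟩ : ∃ i, k = i + 1 := by
      apply Nat.exists_eq_succ_of_ne_zero
      intro h0
      rw [h0] at hk
      exact hy (by simpa using hk)
    obtain ⟨p, hp1, hp2, hp⟩ := f7 _ hk (by
      have h1 := hkm i (by omega)
      rw [← Homeomorph.mul_apply, ← zpow_one_add, hi]
      convert h1 using 3
      push_cast; ring)
    have hp0 : p.1 ≠ 0 := by
      intro h0; rw [h0, norm_zero] at hp1; norm_num at hp1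
    refine ⟨(μ ^ (k : ℤ)) ⟨p, hp0⟩, ?_, ?_⟩
    · rw [hμv, dbl_zpow, norm_smul, zpow_natCast, norm_pow, Real.norm_two, hi, pow_succ]
      have : (1 : ℝ) ≤ 2 ^ i := one_le_pow₀ (by norm_num)
      simp only
      nlinarith
    · rw [equiv_zpow hKμ, hKκ _ ((ht0 _).2 hp1) ((ht1 _).2 hp2.le), hp, ← Homeomorph.mul_apply,
        ← zpow_add, add_neg_cancel, zpow_zero, Homeomorph.one_apply]
  have hKnorm : ∀ x : X, ‖x.1.1‖ / 4 ≤ ‖(K x).1‖ ∧ ‖(K x).1‖ ≤ 4 * ‖x.1.1‖ := fun x => by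
    obtain ⟨u, -, hu0, hu1, hxu, hKx⟩ := hKval x
    have h1 : ‖x.1.1‖ = 2 ^ ⌊t x⌋ * ‖u.1.1‖ := by
      nth_rw 1 [hxu]
      rw [hμv, dbl_zpow, norm_smul, norm_zpow, Real.norm_two]
    have h2 : ‖(K x).1‖ = 2 ^ ⌊t x⌋ * ‖(κ u.1).1‖ := by
      rw [hKx, dbl_zpow, norm_smul, norm_zpow, Real.norm_two]
    rw [h1, h2]
    have h3 : (0 : ℝ) < 2 ^ ⌊t x⌋ := by positivity
    have h4 := f9 u.1 ((ht0 u).1 hu0) ((ht1 u).1 hu1.le)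
    have h5 := hκ1 u.1 ((ht1 u).1 hu1.le)
    have h6 := (ht0 u).1 hu0
    have h7 := (ht1' u).1 hu1
    constructor <;> nlinarith
  obtain ⟨C1, hC1⟩ := hP.comp (hS.comp hT.bdd)
  obtain ⟨C2, hC2⟩ := hP.comp hT.bdd
  have hκb : ∀ p : F × ℝ, ‖p.1‖ ≤ 1 → |(κ p).2 - p.2| ≤ C1 := fun p hp => by
    have h1 := hC1 p
    simp only [Function.comp] at h1
    rwa [← hκ p hp] at h1
  have hβb : ∀ p : F × ℝ, ‖p.1‖ ≤ 1 → |(β0 p).2 - p.2| ≤ C2 := fun p hp => by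
    have h1 := hC2 p
    simp only [Function.comp] at h1
    rwa [← hβ p hp] at h1
  have hKb : ∀ x : X, |(K x).2 - x.1.2| ≤ C1 := fun x => by
    obtain ⟨u, -, hu0, hu1, hxu, hKx⟩ := hKval x
    have h1 : x.1.2 = u.1.2 := by nth_rw 1 [hxu]; rw [hμv, dbl_zpow]
    rw [hKx, dbl_zpow, h1]
    exact hκb u.1 ((ht1 u).1 hu1.le)
  -- β
  classical
  let β : F × ℝ → F × ℝ := fun p => if h : ‖p.1‖ ≤ 1 then β0 p else
    K ⟨p, fun h0 => h (by rw [h0, norm_zero]; exact zero_le_one)⟩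
  have hβin : ∀ p : F × ℝ, ‖p.1‖ ≤ 1 → β p = β0 p := fun p hp => dif_pos hp
  have hβout : ∀ x : X, 1 ≤ ‖x.1.1‖ → β x.1 = K x := fun x hx => by
    rcases hx.lt_or_eq with h | h
    · exact dif_neg (not_le.2 h)
    · rw [hβin _ h.ge, ← f1 _ h.symm, hKκ x ((ht0 x).2 (by linarith)) ((ht1 x).2 h.ge)]
  have hbig : ∀ p : F × ℝ, 1 ≤ ‖p.1‖ → p.1 ≠ 0 := fun p hp h0 => by
    rw [h0, norm_zero] at hp; linarith
  have hβcont : Continuous β := by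
    have hc1 : ContinuousOn β {p | ‖p.1‖ ≤ 1} := hβc.congr fun p hp => hβin p hp
    have hc2 : ContinuousOn β {p | 1 ≤ ‖p.1‖} := by
      rw [continuousOn_iff_continuous_domRestrict]
      have : ({p : F × ℝ | 1 ≤ ‖p.1‖}.domRestrict β) = fun p => K ⟨p.1, hbig p.1 p.2⟩ := by
        ext1 p
        exact hβout ⟨p.1, hbig p.1 p.2⟩ p.2
      rw [this]
      fun_prop
    have := hc1.union_of_isClosed hc2 (isClosed_le (by fun_prop) (by fun_prop))
      (isClosed_le (by fun_prop) (by fun_prop))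
    rw [← continuousOn_univ]
    exact this.mono fun p _ => le_total ‖p.1‖ 1
  have hcross : ∀ p q : F × ℝ, ‖p.1‖ ≤ 1 → 1 ≤ ‖q.1‖ → β p = β q → p = q := fun p q hp hq h => by
    have h1 : β q ∉ V := by rw [hβout ⟨q, hbig q hq⟩ hq]; exact hKV _ hq
    have h2 : 1 ≤ ‖p.1‖ := by
      by_contra hlt
      apply h1
      rw [← h, hβin p hp]
      exact ⟨p, not_le.1 hlt, hβ p hp⟩
    rw [hβout ⟨q, hbig q hq⟩ hq, hβout ⟨p, hbig p h2⟩ h2] at h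
    exact congrArg Subtype.val (hKinj h)
  have hβbij : Function.Bijective β := by
    constructor
    · intro p q h
      rcases le_total ‖p.1‖ 1 with hp | hp <;> rcases le_total ‖q.1‖ 1 with hq | hq
      · rw [hβin p hp, hβin q hq] at h; exact f8' p q hp hq h
      · exact hcross p q hp hq h
      · exact (hcross q p hq hp h.symm).symm
      · rw [hβout ⟨q, hbig q hq⟩ hq, hβout ⟨p, hbig p hp⟩ hp] at h
        exact congrArg Subtype.val (hKinj h)
    · intro y
      by_cases hy : y ∈ V
      · obtain ⟨p, hp, h⟩ := hy
        rw [← hβ p hp.le] at h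
        exact ⟨p, by rw [hβin p hp.le, hii h]⟩
      · obtain ⟨x, hx, h⟩ := hKsurj y hy
        exact ⟨x.1, by rw [hβout x hx, h]⟩
  have hβbdd : Bdd β := by
    refine ⟨max C1 C2, fun p => ?_⟩
    rcases le_total ‖p.1‖ 1 with hp | hp
    · rw [hβin p hp]; exact (hβb p hp).trans (le_max_right _ _)
    · rw [hβout ⟨p, hbig p hp⟩ hp]
      exact (hKb ⟨p, hbig p hp⟩).trans (le_max_left _ _)
  obtain ⟨Θ, hΘ, -, hΘβ, -⟩ := squeeze β hβcont hβbij hβbdd ⟨Real.log 4, fun p => by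
    rcases le_total ‖p.1‖ 1 with hp | hp
    · rw [hβin p hp, ell_zero hp, ell_zero (hβ1 p hp).le]
      simp only [sub_zero, abs_zero]
      exact Real.log_nonneg (by norm_num)
    · rw [hβout ⟨p, hbig p hp⟩ hp]
      have := hKnorm ⟨p, hbig p hp⟩
      exact ell_close hp this.1 this.2⟩
  refine ⟨Θ.trans P.symm, hP.symm.comp hΘ, fun x r hx => ?_⟩
  have h1 := hΘβ x r hx (by rw [hβin _ hx]; exact (hβ1 (x, r) hx).le)
  rw [hβin _ hx, hβ _ hx] at h1
  rw [Homeomorph.trans_apply, Homeomorph.symm_apply_eq]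
  exact h1

end

/-- every tube is standard near its core -/
theorem lemT {Q : Type*} [NormedAddCommGroup Q] [NormedSpace ℝ Q] [FiniteDimensional ℝ Q]
    (hd : 2 ≤ Module.finrank ℝ Q) {T : (Q × ℝ) × ℝ → OnePoint (Q × ℝ) × ℝ} (hT : Tube T) :
    ∃ α : OnePoint (Q × ℝ) × ℝ ≃ₜ OnePoint (Q × ℝ) × ℝ, Bdd α ∧
      ∀ x r, ‖x‖ ≤ 1 → α (iota (x, r)) = T (x, r) := by
  have : ProperSpace Q := FiniteDimensional.proper ℝ Q
  obtain ⟨α1, hα1, h1⟩ := T1 hd hT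
  have hT' := hT.comp α1.symm hα1.symm
  have h2 : ∀ x r, ‖x‖ ≤ 2 → ∃ y s, ‖y‖ < 1 ∧ (α1.symm ∘ T) (y, s) = iota (x, r) := fun x r hx => by
    obtain ⟨y, s, hy, h⟩ := h1 x r hx
    exact ⟨y, s, hy, by simp only [Function.comp]; rw [← h, Homeomorph.symm_apply_apply]⟩
  obtain ⟨P, S, hP, hS, a1, a2, a3, a4⟩ := lemT_a hd hT' h2
  obtain ⟨α, hα, h3⟩ := lemT_b hT' (fun x r hx => h2 x r (by linarith)) P S hP hS a1 a2 a3 a4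
  refine ⟨α.trans α1, hα1.comp hα, fun x r hx => ?_⟩
  rw [Homeomorph.trans_apply, h3 x r hx]
  simp

end LFS


open Filter Topology

namespace LFS
open Set

section Swindle
variable {Q : Type*} [NormedAddCommGroup Q]

/-- the closed solid tube -/
def DD (Q : Type*) [NormedAddCommGroup Q] : Set ((Q × ℝ) × ℝ) := {p | ‖p.1‖ ≤ 1}

theorem mem_DD {p : (Q × ℝ) × ℝ} : p ∈ DD Q ↔ ‖p.1.1‖ ≤ 1 ∧ |p.1.2| ≤ 1 := by
  show ‖p.1‖ ≤ 1 ↔ _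
  rw [Prod.norm_def, max_le_iff, Real.norm_eq_abs]

theorem norm_lt_one_iff {p : (Q × ℝ) × ℝ} : ‖p.1‖ < 1 ↔ ‖p.1.1‖ < 1 ∧ |p.1.2| < 1 := by
  rw [Prod.norm_def, max_lt_iff, Real.norm_eq_abs]

theorem isClosed_DD : IsClosed (DD Q) := isClosed_le (by fun_prop) (by fun_prop)

theorem bd_cases {p : (Q × ℝ) × ℝ} (hp : p ∈ DD Q) (h : ¬ ‖p.1‖ < 1) :
    ‖p.1‖ = 1 ∧ (‖p.1.1‖ = 1 ∨ p.1.2 = 1 ∨ p.1.2 = -1) := by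
  have h1 : ‖p.1‖ = 1 := le_antisymm hp (not_lt.1 h)
  refine ⟨h1, ?_⟩
  rw [norm_lt_one_iff, not_and_or, not_lt, not_lt] at h
  obtain ⟨ha, hb⟩ := mem_DD.1 hp
  rcases h with h | h
  · exact Or.inl (le_antisymm ha h)
  · have : |p.1.2| = 1 := le_antisymm hb h
    rcases abs_eq (by norm_num) |>.1 this with h | h
    · exact Or.inr (Or.inl h)
    · exact Or.inr (Or.inr h)

/-- data for the swindle -/
structure Swin (τp τm ep em : (Q × ℝ) × ℝ → OnePoint (Q × ℝ) × ℝ)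
    (c : OnePoint (Q × ℝ) × ℝ → AddCircle (1 : ℝ)) : Prop where
  tp : Tube τp
  tm : Tube τm
  Ep : Tube ep
  Em : Tube em
  h1p : ∀ p, ‖p.1‖ = 1 → ep p = τp p
  h1m : ∀ p, ‖p.1‖ = 1 → em p = τm p
  h2p : ∀ z, (∃ p ∈ DD Q, ep p = z) ↔ ¬ ∃ p, ‖p.1‖ < 1 ∧ τp p = z
  h2m : ∀ z, (∃ p ∈ DD Q, em p = z) ↔ ¬ ∃ p, ‖p.1‖ < 1 ∧ τm p = z
  h3 : ∀ p, ‖p.1.1‖ = 1 → τp p = τm p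
  h4 : ∀ p ∈ DD Q, ∀ p' ∈ DD Q, τp p = τm p' → ‖p.1.1‖ = 1
  cc : Continuous c
  hcp : ∀ p ∈ DD Q, c (τp p) = ((p.1.2 / 2 : ℝ) : AddCircle (1 : ℝ))
  hcm : ∀ p ∈ DD Q, c (τm p) = ((p.1.2 / 2 : ℝ) : AddCircle (1 : ℝ))
  hc0 : ∀ z, (∀ p ∈ DD Q, τp p ≠ z) → (∀ p ∈ DD Q, τm p ≠ z) →
    c z = ((1 / 2 : ℝ) : AddCircle (1 : ℝ))

theorem half_lift {L : ℝ} (h : (L : AddCircle (1 : ℝ)) = ((1 / 2 : ℝ) : AddCircle (1 : ℝ))) :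
    1 / 2 ≤ L ∨ L ≤ -(1 / 2) := by
  have h1 : ((L - 1 / 2 : ℝ) : AddCircle (1 : ℝ)) = 0 := by
    rw [AddCircle.coe_sub, h, sub_self]
  obtain ⟨k, hk⟩ := (AddCircle.coe_eq_zero_iff (1 : ℝ)).1 h1
  rw [zsmul_eq_mul, mul_one] at hk
  rcases le_or_gt 0 k with h0 | h0
  · left
    have : (0 : ℝ) ≤ k := by exact_mod_cast h0
    linarith
  · right
    have : (k : ℝ) ≤ -1 := by exact_mod_cast Int.le_sub_one_of_lt h0
    linarith

variable {τp τm ep em : (Q × ℝ) × ℝ → OnePoint (Q × ℝ) × ℝ}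
    {c : OnePoint (Q × ℝ) × ℝ → AddCircle (1 : ℝ)}

/-- inverse of an injective map on the tube -/
noncomputable def inv1 [Nonempty ((Q × ℝ) × ℝ)] (e : (Q × ℝ) × ℝ → OnePoint (Q × ℝ) × ℝ) :
    OnePoint (Q × ℝ) × ℝ → (Q × ℝ) × ℝ := Function.invFun e

theorem inv1_apply {e : (Q × ℝ) × ℝ → OnePoint (Q × ℝ) × ℝ} (he : Tube e) (p) :
    inv1 e (e p) = p := Function.leftInverse_invFun he.emb.injective p

theorem inv1_cont {e : (Q × ℝ) × ℝ → OnePoint (Q × ℝ) × ℝ} (he : Tube e) :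
    ContinuousOn (inv1 e) (range e) := by
  rintro _ ⟨p, rfl⟩
  apply ContinuousAt.continuousWithinAt
  rw [he.emb.continuousAt_iff.symm]
  have : inv1 e ∘ e = id := funext fun p => inv1_apply he p
  rw [this]
  exact continuousAt_id

theorem Swin.ep_mem (S : Swin τp τm ep em c) {p : (Q × ℝ) × ℝ} (hp : p ∈ DD Q) :
    inv1 ep (τm p) ∈ DD Q ∧ ep (inv1 ep (τm p)) = τm p := by
  obtain ⟨y, hy, h⟩ := (S.h2p (τm p)).2 (by
    rintro ⟨b, hb, h⟩
    have := S.h4 b hb.le p hp h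
    exact absurd (norm_lt_one_iff.1 hb).1 (by rw [this]; simp))
  rw [← h, inv1_apply S.Ep]
  exact ⟨hy, rfl⟩

theorem Swin.em_mem (S : Swin τp τm ep em c) {p : (Q × ℝ) × ℝ} (hp : p ∈ DD Q) :
    ∃ y ∈ DD Q, em y = τp p := by
  refine (S.h2m (τp p)).2 ?_
  rintro ⟨b, hb, h⟩
  have h1 := S.h4 p hp b hb.le h.symm
  rw [S.h3 p h1] at h
  have := S.tm.emb.injective h
  rw [this] at hb
  exact absurd (norm_lt_one_iff.1 hb).1 (by rw [h1]; simp)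

/-- e₊ y = τ₊ p forces y = p on the boundary -/
theorem Swin.bd_p (S : Swin τp τm ep em c) {y p : (Q × ℝ) × ℝ} (hy : y ∈ DD Q) (hp : p ∈ DD Q)
    (h : ep y = τp p) : y = p ∧ ¬ ‖p.1‖ < 1 := by
  have h1 : ¬ ‖p.1‖ < 1 := fun hp1 => (S.h2p (τp p)).1 ⟨y, hy, h⟩ ⟨p, hp1, rfl⟩
  refine ⟨?_, h1⟩
  rw [← S.h1p p (bd_cases hp h1).1] at h
  exact S.Ep.emb.injective h

theorem Swin.bd_m (S : Swin τp τm ep em c) {y p : (Q × ℝ) × ℝ} (hy : y ∈ DD Q) (hp : p ∈ DD Q)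
    (h : em y = τm p) : y = p ∧ ¬ ‖p.1‖ < 1 := by
  have h1 : ¬ ‖p.1‖ < 1 := fun hp1 => (S.h2m (τm p)).1 ⟨y, hy, h⟩ ⟨p, hp1, rfl⟩
  refine ⟨?_, h1⟩
  rw [← S.h1m p (bd_cases hp h1).1] at h
  exact S.Em.emb.injective h

variable [NormedSpace ℝ Q]

theorem retr_cont : Continuous fun p : (Q × ℝ) × ℝ => (((max 1 ‖p.1‖)⁻¹ • p.1, p.2) : (Q × ℝ) × ℝ) := by
  have : ∀ p : (Q × ℝ) × ℝ, max 1 ‖p.1‖ ≠ 0 := fun p => by positivity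
  fun_prop (disch := assumption)

/-- the lifted height function -/
theorem Swin.exists_L [Nontrivial Q] (S : Swin τp τm ep em c) : ∃ L : (Q × ℝ) × ℝ → ℝ, Continuous L ∧
    (∀ p ∈ DD Q, ∀ p' ∈ DD Q, ep p = τm p' → L p = p'.1.2 / 2) ∧
    (∀ p ∈ DD Q, p.1.2 = 1 → L p = 1 / 2) ∧
    (∀ p ∈ DD Q, p.1.2 = -1 → L p = -(1 / 2)) ∧
    (∀ p ∈ DD Q, ‖p.1.1‖ = 1 → L p = p.1.2 / 2) ∧
    (∀ p ∈ DD Q, (∀ p' ∈ DD Q, ep p ≠ τm p') → 1 / 2 ≤ L p ∨ L p ≤ -(1 / 2)) := by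
  have cov := AddCircle.isCoveringMap_coe (1 : ℝ)
  have hz : (0 : (Q × ℝ) × ℝ) ∈ DD Q := by show ‖_‖ ≤ _; simp
  set p0 := inv1 ep (τm 0) with hp0
  have hp0m := S.ep_mem hz
  set g : (Q × ℝ) × ℝ → AddCircle (1 : ℝ) := fun p => c (ep ((max 1 ‖p.1‖)⁻¹ • p.1, p.2)) with hg
  have hgc : Continuous g := S.cc.comp (S.Ep.emb.continuous.comp retr_cont)
  have hgD : ∀ p ∈ DD Q, g p = c (ep p) := fun p hp => by
    have h : ‖p.1‖ ≤ 1 := hp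
    simp only [hg]
    rw [max_eq_left h, inv_one, one_smul]
  obtain ⟨L, ⟨hL0, hL⟩, -⟩ := cov.existsUnique_continuousMap_lifts ⟨g, hgc⟩ p0 (0 : ℝ) (by
    show ((0 : ℝ) : AddCircle (1 : ℝ)) = g p0
    rw [hgD _ hp0m.1, hp0m.2, S.hcm 0 hz]; simp)
  have hLg : ∀ p ∈ DD Q, ((L p : ℝ) : AddCircle (1 : ℝ)) = c (ep p) := fun p hp => by
    rw [← hgD p hp]; exact congrFun hL p
  have hconv : IsPreconnected (DD Q) := by
    have : DD Q = (Metric.closedBall (0 : Q × ℝ) 1) ×ˢ univ := by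
      ext p; simp [DD]
    rw [this]
    exact ((convex_closedBall _ _).prod convex_univ).isPreconnected
  have hb : ∀ p ∈ DD Q, ∀ p' ∈ DD Q, ep p = τm p' → L p = p'.1.2 / 2 := by
    have key : EqOn (fun p' => L (inv1 ep (τm p'))) (fun p' => p'.1.2 / 2) (DD Q) := by
      refine cov.eqOn_of_comp_eqOn hconv ?_ (by fun_prop) ?_ hz ?_
      · refine L.continuous.comp_continuousOn ((inv1_cont S.Ep).comp
          S.tm.emb.continuous.continuousOn ?_)
        intro p hp
        exact ⟨_, (S.ep_mem hp).2⟩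
      · intro p hp
        simp only [Function.comp]
        rw [hLg _ (S.ep_mem hp).1, (S.ep_mem hp).2, S.hcm p hp]
      · show L p0 = _
        rw [hL0]; simp
    intro p hp p' hp' h
    have := key hp'
    simp only [← h, inv1_apply S.Ep] at this
    exact this
  have hd : ∀ p ∈ DD Q, ‖p.1.1‖ = 1 → L p = p.1.2 / 2 := fun p hp h => by
    refine hb p hp p hp ?_
    rw [S.h1p p ?_, S.h3 p h]
    refine le_antisymm hp ?_
    rw [← h]; exact norm_fst_le p.1
  obtain ⟨q1, hq1⟩ := exists_norm_eq Q (zero_le_one (α := ℝ))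
  have hface : ∀ s : ℝ, |s| = 1 → ∀ p ∈ DD Q, p.1.2 = s → L p = s / 2 := by
    intro s hs
    have hcv : IsPreconnected {p : (Q × ℝ) × ℝ | ‖p.1.1‖ ≤ 1 ∧ p.1.2 = s} := by
      have : {p : (Q × ℝ) × ℝ | ‖p.1.1‖ ≤ 1 ∧ p.1.2 = s}
          = (Metric.closedBall (0 : Q) 1 ×ˢ {s}) ×ˢ univ := by
        ext p; simp
      rw [this]
      exact (((convex_closedBall _ _).prod (convex_singleton s)).prod convex_univ).isPreconnected
    have hsub : ∀ p : (Q × ℝ) × ℝ, ‖p.1.1‖ ≤ 1 ∧ p.1.2 = s → p ∈ DD Q := fun p hp => by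
      rw [mem_DD, hp.2, hs]; exact ⟨hp.1, le_rfl⟩
    have key : EqOn L (fun _ => s / 2) {p : (Q × ℝ) × ℝ | ‖p.1.1‖ ≤ 1 ∧ p.1.2 = s} := by
      have h0 : ((q1, s), (0 : ℝ)) ∈ {p : (Q × ℝ) × ℝ | ‖p.1.1‖ ≤ 1 ∧ p.1.2 = s} := ⟨hq1.le, rfl⟩
      refine cov.eqOn_of_comp_eqOn hcv (by fun_prop) (by fun_prop) ?_ h0 ?_
      · intro p hp
        simp only [Function.comp]
        rw [hLg p (hsub p hp), S.h1p p ?_, S.hcp p (hsub p hp), hp.2]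
        refine le_antisymm (hsub p hp) ?_
        calc (1 : ℝ) = ‖p.1.2‖ := by rw [hp.2, Real.norm_eq_abs, hs]
          _ ≤ _ := norm_snd_le p.1
      · exact hd _ (hsub _ h0) hq1
    intro p hp h
    exact key ⟨(mem_DD.1 hp).1, h⟩
  refine ⟨L, L.continuous, hb, fun p hp h => by rw [hface 1 (by simp) p hp h],
    fun p hp h => by rw [hface (-1) (by simp) p hp h]; ring, hd, fun p hp h => ?_⟩
  by_cases h1 : ∃ p' ∈ DD Q, τp p' = ep p
  · obtain ⟨p', hp', h1⟩ := h1
    obtain ⟨rfl, h2⟩ := S.bd_p hp hp' h1.symm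
    rcases (bd_cases hp h2).2 with h3 | h3 | h3
    · exact absurd (h1.symm.trans (S.h3 p h3)) (h p hp)
    · exact Or.inl (hface 1 (by simp) p hp h3).ge
    · refine Or.inr ?_
      rw [hface (-1) (by simp) p hp h3]; norm_num
  · apply half_lift
    rw [hLg p hp]
    refine S.hc0 _ (fun p' hp' h2 => h1 ⟨p', hp', h2⟩) fun p' hp' h2 => h p' hp' h2.symm

end Swindle
end LFS


open Filter Topology

namespace LFS
open Set

section Swindle2
variable {Q : Type*} [NormedAddCommGroup Q]

/-- flip of the block -/
def flp (p : (Q × ℝ) × ℝ) : (Q × ℝ) × ℝ := ((p.1.1, 2 - p.1.2), p.2)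

/-- shift by four -/
noncomputable def shf (Q : Type*) [NormedAddCommGroup Q] : (Q × ℝ) × ℝ ≃ₜ (Q × ℝ) × ℝ :=
  ((Homeomorph.refl Q).prodCongr (Homeomorph.addRight (4 : ℝ))).prodCongr (Homeomorph.refl ℝ)

theorem shf_apply (p : (Q × ℝ) × ℝ) : shf Q p = ((p.1.1, p.1.2 + 4), p.2) := rfl
theorem flp_flp (p : (Q × ℝ) × ℝ) : flp (flp p) = p := by
  simp [flp]
theorem flp_cont : Continuous (flp : (Q × ℝ) × ℝ → (Q × ℝ) × ℝ) := by unfold flp; fun_prop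

theorem shf_tt (p : (Q × ℝ) × ℝ) : ((shf Q p).1.2 + 1) / 4 = (p.1.2 + 1) / 4 + 1 := by
  rw [shf_apply]; ring

theorem shf_zpow (k : ℤ) (p : (Q × ℝ) × ℝ) : (shf Q ^ k) p = ((p.1.1, p.1.2 + 4 * k), p.2) := by
  have h1 := t_zpow (μ := shf Q) (t := fun p => (p.1.2 + 1) / 4) shf_tt k p
  have h2 := equiv_zpow (μ := shf Q) (ν := Homeomorph.refl _)
    (K := fun p : (Q × ℝ) × ℝ => (p.1.1, p.2)) (fun x => rfl) k p
  have h3 : (Homeomorph.refl (Q × ℝ)) ^ k = Homeomorph.refl (Q × ℝ) := one_zpow k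
  rw [h3] at h2
  have h4 := congrArg Prod.fst h2
  have h5 := congrArg Prod.snd h2
  ext1
  · ext1
    · exact h4
    · simp only at h1 ⊢; linarith
  · exact h5

theorem shf_fund (p : (Q × ℝ) × ℝ) : ∃ (k : ℤ) (p0 : (Q × ℝ) × ℝ), p = (shf Q ^ k) p0 ∧
    -1 ≤ p0.1.2 ∧ p0.1.2 < 3 := by
  set k := ⌊(p.1.2 + 1) / 4⌋ with hk
  refine ⟨k, ((p.1.1, p.1.2 - 4 * k), p.2), ?_, ?_, ?_⟩
  · rw [shf_zpow]; simp
  · have := Int.floor_le ((p.1.2 + 1) / 4)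
    simp only; rw [← hk] at this; linarith
  · have := Int.lt_floor_add_one ((p.1.2 + 1) / 4)
    simp only; rw [← hk] at this; linarith

theorem flp_mem {p : (Q × ℝ) × ℝ} (h : ‖p.1.1‖ ≤ 1) (h1 : 1 ≤ p.1.2) (h3 : p.1.2 ≤ 3) :
    flp p ∈ DD Q := by
  rw [mem_DD]
  exact ⟨h, abs_le.2 ⟨by simp only [flp]; linarith, by simp only [flp]; linarith⟩⟩

variable {τp τm ep em : (Q × ℝ) × ℝ → OnePoint (Q × ℝ) × ℝ}
    {c : OnePoint (Q × ℝ) × ℝ → AddCircle (1 : ℝ)}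

open Classical in
/-- regluing map -/
noncomputable def psi (τp ep : (Q × ℝ) × ℝ → OnePoint (Q × ℝ) × ℝ) (L : (Q × ℝ) × ℝ → ℝ)
    (z : OnePoint (Q × ℝ) × ℝ) : (Q × ℝ) × ℝ :=
  if ∃ p ∈ DD Q, τp p = z then flp (inv1 τp z) else
  if 0 ≤ L (inv1 ep z) then inv1 ep z else shf Q (inv1 ep z)

variable [NormedSpace ℝ Q] [FiniteDimensional ℝ Q]

theorem Swin.exists_Omega [Nontrivial Q] (S : Swin τp τm ep em c) :
    ∃ Ω : (Q × ℝ) × ℝ → (Q × ℝ) × ℝ, Continuous Ω ∧ Function.Bijective Ω ∧ Bdd Ω ∧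
      (∃ C : ℝ, ∀ p, |ell (Ω p).1 - ell p.1| ≤ C) ∧
      (∀ p ∈ DD Q, Ω p ∈ DD Q ∧ ep (Ω p) = τm p) ∧ (∀ p, 1 ≤ ‖p.1.1‖ → Ω p = p) := by
  classical
  have : ProperSpace Q := FiniteDimensional.proper ℝ Q
  obtain ⟨L, hLc, La, Lt, Lb, Ls, Ld⟩ := S.exists_L
  have flip1 : ∀ p : (Q × ℝ) × ℝ, p.1.2 = 1 → flp p = p := fun p h => by
    ext1
    · ext1
      · rfl
      · simp only [flp, h]; norm_num
    · rfl
  have flip3 : ∀ p : (Q × ℝ) × ℝ, p.1.2 = -1 → flp p = shf Q p := fun p h => by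
    ext1
    · ext1
      · rfl
      · simp only [flp, h, shf_apply]; norm_num
    · rfl
  have bq : ∀ p ∈ DD Q, ‖p.1.1‖ = 1 → ‖p.1‖ = 1 := fun p hp h => by
    refine le_antisymm hp ?_
    rw [← h]; exact norm_fst_le p.1
  set Ψ := psi τp ep L with hΨ
  have Ψ1 : ∀ p ∈ DD Q, Ψ (τp p) = flp p := fun p hp => by
    rw [hΨ, psi, if_pos ⟨p, hp, rfl⟩, inv1_apply S.tp]
  have Ψ2 : ∀ p ∈ DD Q, 1 / 2 ≤ L p → Ψ (ep p) = p := fun p hp hL => by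
    rw [hΨ, psi]
    split_ifs with h1 h2
    · obtain ⟨p', hp', h⟩ := h1
      obtain ⟨rfl, hb⟩ := S.bd_p hp hp' h.symm
      rw [← h, inv1_apply S.tp]
      apply flip1
      rcases (bd_cases hp hb).2 with h3 | h3 | h3
      · rw [Ls p hp h3] at hL
        have := abs_le.1 (mem_DD.1 hp).2
        linarith
      · exact h3
      · rw [Lb p hp h3] at hL; norm_num at hL
    · exact inv1_apply S.Ep p
    · rw [inv1_apply S.Ep] at h2
      linarith
  have Ψ3 : ∀ p ∈ DD Q, L p ≤ -(1 / 2) → Ψ (ep p) = shf Q p := fun p hp hL => by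
    rw [hΨ, psi]
    split_ifs with h1 h2
    · obtain ⟨p', hp', h⟩ := h1
      obtain ⟨rfl, hb⟩ := S.bd_p hp hp' h.symm
      rw [← h, inv1_apply S.tp]
      apply flip3
      rcases (bd_cases hp hb).2 with h3 | h3 | h3
      · rw [Ls p hp h3] at hL
        have := abs_le.1 (mem_DD.1 hp).2
        linarith
      · rw [Lt p hp h3] at hL; norm_num at hL
      · exact h3
    · rw [inv1_apply S.Ep] at h2
      linarith
    · rw [inv1_apply S.Ep]
  -- continuity of Ψ
  set PT := τp '' DD Q with hPT
  set PX := ep '' {p | p ∈ DD Q ∧ 1 / 2 ≤ L p} with hPX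
  set PY := ep '' {p | p ∈ DD Q ∧ L p ≤ -(1 / 2)} with hPY
  have cT : IsClosed PT := S.tp.isClosed_image isClosed_DD (R := fun _ => 1) continuous_const
    fun p hp => hp
  have cX : IsClosed PX := S.Ep.isClosed_image
    (isClosed_DD.inter (isClosed_le continuous_const hLc)) (R := fun _ => 1) continuous_const
    fun p hp => hp.1
  have cY : IsClosed PY := S.Ep.isClosed_image
    (isClosed_DD.inter (isClosed_le hLc continuous_const)) (R := fun _ => 1) continuous_const
    fun p hp => hp.1
  have ΨT : ContinuousOn Ψ PT := by
    refine ContinuousOn.congr (f := fun z => flp (inv1 τp z)) ?_ ?_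
    · exact flp_cont.comp_continuousOn ((inv1_cont S.tp).mono (image_subset_range _ _))
    · rintro _ ⟨p, hp, rfl⟩
      simp only; rw [Ψ1 p hp, inv1_apply S.tp]
  have ΨX : ContinuousOn Ψ PX := by
    refine ContinuousOn.congr (f := inv1 ep) ?_ ?_
    · exact ((inv1_cont S.Ep).mono (image_subset_range _ _))
    · rintro _ ⟨p, hp, rfl⟩
      rw [Ψ2 p hp.1 hp.2, inv1_apply S.Ep]
  have ΨY : ContinuousOn Ψ PY := by
    refine ContinuousOn.congr (f := fun z => shf Q (inv1 ep z)) ?_ ?_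
    · exact (shf Q).continuous.comp_continuousOn ((inv1_cont S.Ep).mono (image_subset_range _ _))
    · rintro _ ⟨p, hp, rfl⟩
      simp only; rw [Ψ3 p hp.1 hp.2, inv1_apply S.Ep]
  have Ψc := (ΨT.union_of_isClosed ΨX cT cX).union_of_isClosed ΨY (cT.union cX) cY
  -- coverage
  have cover0 : ∀ z, (∀ p ∈ DD Q, τm p ≠ z) →
      (∃ p ∈ DD Q, |p.1.2| < 1 ∧ τp p = z) ∨ (∃ p ∈ DD Q, 1 / 2 ≤ L p ∧ ep p = z) ∨
        (∃ p ∈ DD Q, L p ≤ -(1 / 2) ∧ ep p = z) := by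
    intro z hz
    by_cases h1 : ∃ p ∈ DD Q, τp p = z
    · obtain ⟨p, hp, rfl⟩ := h1
      rcases (mem_DD.1 hp).2.lt_or_eq with h | h
      · exact Or.inl ⟨p, hp, h, rfl⟩
      · have hb : ‖p.1‖ = 1 := by
          refine le_antisymm hp ?_
          rw [← h, ← Real.norm_eq_abs]; exact norm_snd_le p.1
        rcases (abs_eq (by norm_num)).1 h with h | h
        · exact Or.inr (Or.inl ⟨p, hp, (Lt p hp h).ge, S.h1p p hb⟩)
        · exact Or.inr (Or.inr ⟨p, hp, (Lb p hp h).le, S.h1p p hb⟩)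
    · obtain ⟨y, hy, rfl⟩ := (S.h2p z).2 fun ⟨p, hp, h⟩ => h1 ⟨p, hp.le, h⟩
      rcases Ld y hy (fun p' hp' h => hz p' hp' h.symm) with h | h
      · exact Or.inr (Or.inl ⟨y, hy, h, rfl⟩)
      · exact Or.inr (Or.inr ⟨y, hy, h, rfl⟩)
  have cover : ∀ p ∈ DD Q, em p ∈ PT ∪ PX ∪ PY := by
    intro p hp
    by_cases h1 : ∃ p' ∈ DD Q, τm p' = em p
    · obtain ⟨p', hp', h⟩ := h1
      obtain ⟨rfl, hb⟩ := S.bd_m hp hp' h.symm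
      obtain ⟨hy, hy2⟩ := S.ep_mem hp
      have hL := La _ hy p hp hy2
      rcases (bd_cases hp hb).2 with h3 | h3 | h3
      · exact Or.inl (Or.inl ⟨p, hp, by rw [← h, S.h3 p h3]⟩)
      · exact Or.inl (Or.inr ⟨_, ⟨hy, by rw [hL, h3]⟩, by rw [hy2, h]⟩)
      · exact Or.inr ⟨_, ⟨hy, by rw [hL, h3]; norm_num⟩, by rw [hy2, h]⟩
    · rcases cover0 (em p) (fun p' hp' h => h1 ⟨p', hp', h⟩) with
        ⟨y, hy, _, h⟩ | ⟨y, hy, h2, h⟩ | ⟨y, hy, h2, h⟩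
      · exact Or.inl (Or.inl ⟨y, hy, h⟩)
      · exact Or.inl (Or.inr ⟨y, ⟨hy, h2⟩, h⟩)
      · exact Or.inr ⟨y, ⟨hy, h2⟩, h⟩
  -- the map on a fundamental domain
  set κ : (Q × ℝ) × ℝ → (Q × ℝ) × ℝ := fun p => if 1 ≤ ‖p.1.1‖ then p else
    if p.1.2 ≤ 1 then inv1 ep (τm p) else Ψ (em (flp p)) with hκ
  have κ0 : ∀ p, 1 ≤ ‖p.1.1‖ → κ p = p := fun p hp => if_pos hp
  have κ1 : ∀ p ∈ DD Q, κ p = inv1 ep (τm p) := fun p hp => by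
    simp only [hκ]
    split_ifs with h1 h2
    · have h : ‖p.1.1‖ = 1 := le_antisymm (mem_DD.1 hp).1 h1
      rw [← S.h3 p h, ← S.h1p p (bq p hp h), inv1_apply S.Ep]
    · rfl
    · exact absurd (abs_le.1 (mem_DD.1 hp).2).2 h2
  have κ2 : ∀ p, ‖p.1.1‖ ≤ 1 → 1 ≤ p.1.2 → p.1.2 ≤ 3 → κ p = Ψ (em (flp p)) := by
    intro p hp h1 h3
    have hfp := flp_mem hp h1 h3
    simp only [hκ]
    split_ifs with hq h2
    · have h : ‖p.1.1‖ = 1 := le_antisymm hp hq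
      have h' : ‖(flp p).1.1‖ = 1 := h
      rw [S.h1m _ (bq _ hfp h'), ← S.h3 _ h', Ψ1 _ hfp, flp_flp]
    · have ht : p.1.2 = 1 := le_antisymm h2 h1
      rw [flip1 p ht] at hfp ⊢
      obtain ⟨hy, hy2⟩ := S.ep_mem hfp
      have hL := La _ hy p hfp hy2
      have hb : ‖p.1‖ = 1 := by
        refine le_antisymm hfp ?_
        calc (1 : ℝ) = ‖p.1.2‖ := by rw [ht]; simp
          _ ≤ _ := norm_snd_le p.1
      rw [S.h1m _ hb, ← hy2, Ψ2 _ hy (by rw [hL, ht]), inv1_apply S.Ep]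
    · rfl
  have κc : ContinuousOn κ {p | 0 ≤ (p.1.2 + 1) / 4 ∧ (p.1.2 + 1) / 4 ≤ 1} := by
    have c0 : ContinuousOn κ {p | 1 ≤ ‖p.1.1‖} := continuousOn_id.congr fun p hp => κ0 p hp
    have c1 : ContinuousOn κ (DD Q) := by
      refine ContinuousOn.congr (f := fun p => inv1 ep (τm p)) ?_ κ1
      refine (inv1_cont S.Ep).comp S.tm.emb.continuous.continuousOn ?_
      intro p hp
      exact ⟨_, (S.ep_mem hp).2⟩
    have c2 : ContinuousOn κ {p | ‖p.1.1‖ ≤ 1 ∧ 1 ≤ p.1.2 ∧ p.1.2 ≤ 3} := by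
      refine ContinuousOn.congr (f := fun p => Ψ (em (flp p))) ?_ fun p hp => κ2 p hp.1 hp.2.1 hp.2.2
      refine Ψc.comp (S.Em.emb.continuous.comp flp_cont).continuousOn ?_
      intro p hp
      exact cover _ (flp_mem hp.1 hp.2.1 hp.2.2)
    have f0 : IsClosed {p : (Q × ℝ) × ℝ | 1 ≤ ‖p.1.1‖} := isClosed_le (by fun_prop) (by fun_prop)
    have f2 : IsClosed {p : (Q × ℝ) × ℝ | ‖p.1.1‖ ≤ 1 ∧ 1 ≤ p.1.2 ∧ p.1.2 ≤ 3} := by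
      have a : IsClosed {p : (Q × ℝ) × ℝ | ‖p.1.1‖ ≤ 1} := isClosed_le (by fun_prop) (by fun_prop)
      have b : IsClosed {p : (Q × ℝ) × ℝ | 1 ≤ p.1.2} := isClosed_le (by fun_prop) (by fun_prop)
      have c : IsClosed {p : (Q × ℝ) × ℝ | p.1.2 ≤ 3} := isClosed_le (by fun_prop) (by fun_prop)
      exact a.inter (b.inter c)
    refine ((c0.union_of_isClosed c1 f0 isClosed_DD).union_of_isClosed c2
      (f0.union isClosed_DD) f2).mono ?_
    rintro p ⟨h1, h2⟩
    rcases le_total 1 ‖p.1.1‖ with h | h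
    · exact Or.inl (Or.inl h)
    rcases le_total p.1.2 1 with h' | h'
    · exact Or.inl (Or.inr (mem_DD.2 ⟨h, abs_le.2 ⟨by linarith, h'⟩⟩))
    · exact Or.inr ⟨h, h', by linarith⟩
  have glue : ∀ p : (Q × ℝ) × ℝ, (p.1.2 + 1) / 4 = 0 → κ (shf Q p) = shf Q (κ p) := by
    intro p h
    have ht : p.1.2 = -1 := by linarith
    rcases le_total 1 ‖p.1.1‖ with hq | hq
    · rw [κ0 p hq, κ0 (shf Q p) hq]
    · have hp : p ∈ DD Q := mem_DD.2 ⟨hq, by rw [ht]; simp⟩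
      have hs : (shf Q p).1.2 = 3 := by rw [shf_apply]; simp only [ht]; norm_num
      rw [κ1 p hp, κ2 (shf Q p) hq (by rw [hs]; norm_num) hs.le, ← flip3 p ht, flp_flp]
      obtain ⟨hy, hy2⟩ := S.ep_mem hp
      have hL := La _ hy p hp hy2
      have hb : ‖p.1‖ = 1 := by
        refine le_antisymm hp ?_
        calc (1 : ℝ) = ‖p.1.2‖ := by rw [ht]; simp
          _ ≤ _ := norm_snd_le p.1
      rw [S.h1m _ hb, ← hy2, Ψ3 _ hy (by rw [hL, ht]; norm_num), inv1_apply S.Ep]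
  obtain ⟨Ω, Ωc, Ωs, Ωκ'⟩ := periodic_ext (μ := shf Q) (t := fun p : (Q × ℝ) × ℝ => (p.1.2 + 1) / 4)
    (by fun_prop) shf_tt (shf Q) κ κc glue
  have Ωκ : ∀ p : (Q × ℝ) × ℝ, -1 ≤ p.1.2 → p.1.2 ≤ 3 → Ω p = κ p := fun p h1 h3 =>
    Ωκ' p (by linarith) (by linarith)
  have Ωz := equiv_zpow Ωs
  -- left inverse
  set J0 : (Q × ℝ) × ℝ → (Q × ℝ) × ℝ := fun y => if 1 ≤ ‖y.1.1‖ then y else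
    if 1 < y.1.2 then flp (inv1 em (τp (flp y))) else
    if ∃ p ∈ DD Q, τm p = ep y then inv1 τm (ep y) else
    if 0 ≤ L y then flp (inv1 em (ep y)) else (shf Q).symm (flp (inv1 em (ep y))) with hJ0
  obtain ⟨J, Js, JJ0'⟩ := periodic_fun (μ := shf Q) (t := fun p : (Q × ℝ) × ℝ => (p.1.2 + 1) / 4)
    shf_tt (shf Q) J0
  have JJ0 : ∀ p : (Q × ℝ) × ℝ, -1 ≤ p.1.2 → p.1.2 < 3 → J p = J0 p := fun p h1 h3 =>
    JJ0' p (by linarith) (by linarith)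
  have Jz := equiv_zpow Js
  have JDD : ∀ y ∈ DD Q, J y = J0 y := fun y hy => by
    have := abs_le.1 (mem_DD.1 hy).2
    exact JJ0 y (by linarith) (by linarith)
  have left0 : ∀ p : (Q × ℝ) × ℝ, -1 ≤ p.1.2 → p.1.2 < 3 → J (κ p) = p := by
    intro p h1 h3
    rcases le_or_gt 1 ‖p.1.1‖ with hq | hq
    · rw [κ0 p hq, JJ0 p h1 h3]
      exact if_pos hq
    rcases le_or_gt p.1.2 1 with ht | ht
    · have hp : p ∈ DD Q := mem_DD.2 ⟨hq.le, abs_le.2 ⟨h1, ht⟩⟩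
      rw [κ1 p hp]
      obtain ⟨hy, hy2⟩ := S.ep_mem hp
      set y := inv1 ep (τm p)
      have hyq : ¬ 1 ≤ ‖y.1.1‖ := fun h => by
        have h' : ‖y.1.1‖ = 1 := le_antisymm (mem_DD.1 hy).1 h
        rw [S.h1p y (bq y hy h'), S.h3 y h'] at hy2
        have := S.tm.emb.injective hy2
        rw [this] at h; linarith
      rw [JDD y hy]
      simp only [hJ0]
      rw [if_neg hyq, if_neg (not_lt.2 (abs_le.1 (mem_DD.1 hy).2).2), if_pos ⟨p, hp, hy2.symm⟩,
        hy2, inv1_apply S.tm]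
    · have hfp := flp_mem hq.le ht.le h3.le
      have hfi : ‖(flp p).1‖ < 1 := norm_lt_one_iff.2
        ⟨hq, abs_lt.2 ⟨by simp only [flp]; linarith, by simp only [flp]; linarith⟩⟩
      have hz : ∀ p' ∈ DD Q, τm p' ≠ em (flp p) := fun p' hp' h => by
        obtain ⟨h4, h5⟩ := S.bd_m hfp hp' h.symm
        rw [← h4] at h5; exact h5 hfi
      have hz' : ∀ y ∈ DD Q, ep y = em (flp p) → ¬ 1 ≤ ‖y.1.1‖ := fun y hy h h' => by
        have h' : ‖y.1.1‖ = 1 := le_antisymm (mem_DD.1 hy).1 h'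
        rw [S.h1p y (bq y hy h'), S.h3 y h'] at h
        exact hz y hy h
      rw [κ2 p hq.le ht.le h3.le]
      rcases cover0 (em (flp p)) hz with ⟨y, hy, hy1, h⟩ | ⟨y, hy, h2, h⟩ | ⟨y, hy, h2, h⟩
      · rw [← h, Ψ1 y hy]
        rw [abs_lt] at hy1
        have e1 : (flp y).1.2 = 2 - y.1.2 := rfl
        rw [JJ0 _ (by linarith) (by linarith)]
        have hyq : ¬ 1 ≤ ‖(flp y).1.1‖ := fun h' => by
          have h' : ‖y.1.1‖ = 1 := le_antisymm (mem_DD.1 hy).1 h'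
          rw [S.h3 y h'] at h
          exact hz y hy h
        simp only [hJ0]
        rw [if_neg hyq, if_pos (by linarith), flp_flp, h, inv1_apply S.Em, flp_flp]
      · rw [← h, Ψ2 y hy h2, JDD y hy]
        simp only [hJ0]
        rw [if_neg (hz' y hy h), if_neg (not_lt.2 (abs_le.1 (mem_DD.1 hy).2).2),
          if_neg (by rw [h]; rintro ⟨p', hp', h'⟩; exact hz p' hp' h'), if_pos (by linarith), h,
          inv1_apply S.Em, flp_flp]
      · rw [← h, Ψ3 y hy h2, Js, JDD y hy]
        simp only [hJ0]
        rw [if_neg (hz' y hy h), if_neg (not_lt.2 (abs_le.1 (mem_DD.1 hy).2).2),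
          if_neg (by rw [h]; rintro ⟨p', hp', h'⟩; exact hz p' hp' h'), if_neg (by linarith), h,
          inv1_apply S.Em, flp_flp, Homeomorph.apply_symm_apply]
  have left : ∀ p, J (Ω p) = p := fun p => by
    obtain ⟨k, p0, rfl, h1, h3⟩ := shf_fund p
    rw [Ωz, Jz, Ωκ p0 h1 h3.le, left0 p0 h1 h3]
  have right0 : ∀ y : (Q × ℝ) × ℝ, -1 ≤ y.1.2 → y.1.2 < 3 → ∃ p, Ω p = y := by
    intro y h1 h3
    rcases le_or_gt 1 ‖y.1.1‖ with hq | hq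
    · exact ⟨y, by rw [Ωκ y h1 h3.le, κ0 y hq]⟩
    have flpem : ∀ p' ∈ DD Q, Ω (flp p') = Ψ (em p') := fun p' hp' => by
      obtain ⟨ha, hb⟩ := mem_DD.1 hp'
      rw [abs_le] at hb
      have e1 : (flp p').1.2 = 2 - p'.1.2 := rfl
      rw [Ωκ _ (by linarith) (by linarith), κ2 (flp p') ha (by linarith) (by linarith), flp_flp]
    rcases le_or_gt y.1.2 1 with ht | ht
    · have hy : y ∈ DD Q := mem_DD.2 ⟨hq.le, abs_le.2 ⟨h1, ht⟩⟩
      by_cases h : ∃ p ∈ DD Q, τm p = ep y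
      · obtain ⟨p, hp, h⟩ := h
        have := abs_le.1 (mem_DD.1 hp).2
        exact ⟨p, by rw [Ωκ p (by linarith) (by linarith), κ1 p hp, h, inv1_apply S.Ep]⟩
      · obtain ⟨p', hp', h'⟩ := (S.h2m (ep y)).2 fun ⟨p, hp, h'⟩ => h ⟨p, hp.le, h'⟩
        rcases Ld y hy (fun p hp h' => h ⟨p, hp, h'.symm⟩) with h4 | h4
        · exact ⟨flp p', by rw [flpem p' hp', h', Ψ2 y hy h4]⟩
        · refine ⟨(shf Q).symm (flp p'), ?_⟩
          apply (shf Q).injective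
          rw [← Ωs, Homeomorph.apply_symm_apply, flpem p' hp', h', Ψ3 y hy h4]
    · have hy := flp_mem hq.le ht.le h3.le
      obtain ⟨p', hp', h'⟩ := S.em_mem hy
      exact ⟨flp p', by rw [flpem p' hp', h', Ψ1 _ hy, flp_flp]⟩
  have right : ∀ y, ∃ p, Ω p = y := fun y => by
    obtain ⟨k, y0, rfl, h1, h3⟩ := shf_fund y
    obtain ⟨p, rfl⟩ := right0 y0 h1 h3
    exact ⟨(shf Q ^ k) p, Ωz k p⟩
  -- bounds
  obtain ⟨C1, hC1⟩ := S.tp.bdd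
  obtain ⟨C2, hC2⟩ := S.tm.bdd
  obtain ⟨C3, hC3⟩ := S.Ep.bdd
  obtain ⟨C4, hC4⟩ := S.Em.bdd
  have hC1p := (abs_nonneg _).trans (hC1 0)
  have hC2p := (abs_nonneg _).trans (hC2 0)
  have hC3p := (abs_nonneg _).trans (hC3 0)
  have hC4p := (abs_nonneg _).trans (hC4 0)
  have bound0 : ∀ p : (Q × ℝ) × ℝ, -1 ≤ p.1.2 → p.1.2 < 3 → ‖p.1.1‖ ≤ 1 →
      ‖(κ p).1.1‖ ≤ 1 ∧ |(κ p).1.2 - p.1.2| ≤ 6 ∧ |(κ p).2 - p.2| ≤ C1 + C2 + C3 + C4 := by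
    intro p h1 h3 hq
    rcases le_or_gt p.1.2 1 with ht | ht
    · have hp : p ∈ DD Q := mem_DD.2 ⟨hq, abs_le.2 ⟨h1, ht⟩⟩
      obtain ⟨hy, hy2⟩ := S.ep_mem hp
      rw [κ1 p hp]
      set y := inv1 ep (τm p)
      obtain ⟨ha, hb⟩ := mem_DD.1 hy
      rw [abs_le] at hb
      refine ⟨ha, abs_le.2 ⟨by linarith, by linarith⟩, ?_⟩
      have e1 := abs_le.1 (hC3 y)
      have e2 := abs_le.1 (hC2 p)
      rw [hy2] at e1
      exact abs_le.2 ⟨by linarith, by linarith⟩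
    · have hfp := flp_mem hq ht.le h3.le
      rw [κ2 p hq ht.le h3.le]
      have e2 := abs_le.1 (hC4 (flp p))
      have ee : (flp p).2 = p.2 := rfl
      rw [ee] at e2
      rcases cover _ hfp with (⟨y, hy, h⟩ | ⟨y, ⟨hy, hy2⟩, h⟩) | ⟨y, ⟨hy, hy2⟩, h⟩
      · obtain ⟨ha, hb⟩ := mem_DD.1 hy
        rw [abs_le] at hb
        have e1 := abs_le.1 (hC1 y)
        rw [← h] at e2
        rw [← h, Ψ1 y hy]
        have e3 : (flp y).1.2 = 2 - y.1.2 := rfl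
        have e4 : (flp y).2 = y.2 := rfl
        refine ⟨ha, abs_le.2 ⟨by linarith, by linarith⟩, abs_le.2 ⟨by linarith, by linarith⟩⟩
      · obtain ⟨ha, hb⟩ := mem_DD.1 hy
        rw [abs_le] at hb
        have e1 := abs_le.1 (hC3 y)
        rw [← h] at e2
        rw [← h, Ψ2 y hy hy2]
        refine ⟨ha, abs_le.2 ⟨by linarith, by linarith⟩, abs_le.2 ⟨by linarith, by linarith⟩⟩
      · obtain ⟨ha, hb⟩ := mem_DD.1 hy
        rw [abs_le] at hb
        have e1 := abs_le.1 (hC3 y)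
        rw [← h] at e2
        rw [← h, Ψ3 y hy hy2]
        have e3 : (shf Q y).1.2 = y.1.2 + 4 := rfl
        have e4 : (shf Q y).2 = y.2 := rfl
        refine ⟨ha, abs_le.2 ⟨by linarith, by linarith⟩, abs_le.2 ⟨by linarith, by linarith⟩⟩
  have bound : ∀ p : (Q × ℝ) × ℝ, ‖p.1.1‖ ≤ 1 →
      ‖(Ω p).1.1‖ ≤ 1 ∧ |(Ω p).1.2 - p.1.2| ≤ 6 ∧ |(Ω p).2 - p.2| ≤ C1 + C2 + C3 + C4 := by
    intro p hq
    obtain ⟨k, p0, rfl, h1, h3⟩ := shf_fund p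
    rw [Ωz, Ωκ p0 h1 h3.le]
    simp only [shf_zpow] at hq ⊢
    have := bound0 p0 h1 h3 hq
    simpa using this
  have ident : ∀ p, 1 ≤ ‖p.1.1‖ → Ω p = p := fun p hp => by
    obtain ⟨k, p0, rfl, h1, h3⟩ := shf_fund p
    rw [Ωz, Ωκ p0 h1 h3.le, κ0 p0 (by simpa [shf_zpow] using hp)]
  refine ⟨Ω, Ωc, ⟨Function.LeftInverse.injective left, right⟩, ⟨C1 + C2 + C3 + C4, fun p => ?_⟩,
    ⟨6, fun p => ?_⟩, fun p hp => ?_, ident⟩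
  · rcases le_total 1 ‖p.1.1‖ with h | h
    · rw [ident p h]; simp; positivity
    · exact (bound p h).2.2
  · rcases le_total 1 ‖p.1.1‖ with h | h
    · rw [ident p h]; simp
    · obtain ⟨ha, hb, -⟩ := bound p h
      have key : ∀ x : Q × ℝ, ‖x.1‖ ≤ 1 → ell x = Real.log (max 1 |x.2|) := fun x hx => by
        rw [ell, Prod.norm_def, ← max_assoc, max_eq_left hx, Real.norm_eq_abs]
      rw [key _ ha, key _ h]
      have lip : ∀ a b : ℝ, 1 ≤ a → 1 ≤ b → Real.log a - Real.log b ≤ |a - b| := fun a b ha hb => by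
        rw [← Real.log_div (by positivity) (by positivity)]
        refine (Real.log_le_sub_one_of_pos (by positivity)).trans ?_
        rw [div_sub_one (by positivity)]
        calc (a - b) / b ≤ |a - b| / b := by gcongr; exact le_abs_self _
          _ ≤ |a - b| := div_le_self (abs_nonneg _) hb
      have lip2 : abs (max 1 |(Ω p).1.2| - max 1 |p.1.2| ) ≤ 6 := by
        rw [max_comm 1, max_comm 1]
        refine (abs_max_sub_max_le_abs _ _ _).trans ?_
        exact (abs_abs_sub_abs_le_abs_sub _ _).trans hb
      refine abs_le.2 ⟨?_, ?_⟩
      · have := lip (max 1 |p.1.2|) (max 1 |(Ω p).1.2|) (le_max_left _ _) (le_max_left _ _)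
        rw [abs_sub_comm] at this
        linarith
      · exact (lip _ _ (le_max_left _ _) (le_max_left _ _)).trans lip2
  · have := abs_le.1 (mem_DD.1 hp).2
    rw [Ωκ p (by linarith) (by linarith), κ1 p hp]
    exact S.ep_mem hp

end Swindle2
end LFS


open Filter Topology

namespace LFS
open Set

section Inv
variable {V : Type*} [NormedAddCommGroup V] [NormedSpace ℝ V]

open Classical in
/-- inversion -/
noncomputable def ivf : OnePoint V → OnePoint V
  | none => ((0 : V) : OnePoint V)
  | some x => if x = 0 then OnePoint.infty else (((‖x‖ ^ 2)⁻¹ • x : V) : OnePoint V)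

theorem ivf_infty : ivf (OnePoint.infty : OnePoint V) = ((0 : V) : OnePoint V) := rfl
theorem ivf_zero : ivf ((0 : V) : OnePoint V) = OnePoint.infty := if_pos rfl
theorem ivf_coe {x : V} (hx : x ≠ 0) : ivf (x : OnePoint V) = (((‖x‖ ^ 2)⁻¹ • x : V) : OnePoint V) :=
  if_neg hx

theorem norm_ivs {x : V} (hx : x ≠ 0) : ‖(‖x‖ ^ 2)⁻¹ • x‖ = ‖x‖⁻¹ := by
  have := norm_ne_zero_iff.2 hx
  rw [norm_smul, norm_inv, norm_pow, norm_norm]; field_simp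

theorem ivf_ivf (z : OnePoint V) : ivf (ivf z) = z := by
  induction z using OnePoint.rec with
  | infty => rw [ivf_infty, ivf_zero]
  | coe x =>
    by_cases hx : x = 0
    · subst hx; rw [ivf_zero, ivf_infty]
    · have h := norm_ne_zero_iff.2 hx
      have h2 : (‖x‖ ^ 2)⁻¹ • x ≠ 0 := smul_ne_zero (by positivity) hx
      rw [ivf_coe hx, ivf_coe h2, norm_ivs hx, smul_smul]
      congr 1
      rw [show (‖x‖⁻¹ ^ 2)⁻¹ * (‖x‖ ^ 2)⁻¹ = 1 by field_simp, one_smul]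

theorem ivf_cont [ProperSpace V] : Continuous (ivf : OnePoint V → OnePoint V) := by
  have key : Tendsto (fun x : V => ivf (x : OnePoint V)) (𝓝[≠] 0) (𝓝 OnePoint.infty) := by
    have h1 : Tendsto (fun x : V => (‖x‖ ^ 2)⁻¹ • x) (𝓝[≠] 0) (cocompact V) := by
      rw [← Metric.cobounded_eq_cocompact, ← comap_norm_atTop, tendsto_comap_iff]
      refine (tendsto_inv_nhdsGT_zero.comp (tendsto_norm_nhdsNE_zero (E := V))).congr' ?_
      filter_upwards [self_mem_nhdsWithin] with x hx
      exact (norm_ivs hx).symm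
    rw [← coclosedCompact_eq_cocompact] at h1
    refine (OnePoint.tendsto_coe_infty.comp h1).congr' ?_
    filter_upwards [self_mem_nhdsWithin] with x hx
    exact (ivf_coe hx).symm
  rw [OnePoint.continuous_iff]
  constructor
  · rw [ivf_infty, coclosedCompact_eq_cocompact, ← Metric.cobounded_eq_cocompact]
    have h1 : Tendsto (fun x : V => (‖x‖ ^ 2)⁻¹ • x) (Bornology.cobounded V) (𝓝 0) := by
      rw [tendsto_zero_iff_norm_tendsto_zero]
      refine (tendsto_inv_atTop_zero.comp tendsto_norm_cobounded_atTop).congr' ?_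
      filter_upwards [tendsto_norm_cobounded_atTop.eventually_gt_atTop (0 : ℝ)] with x hx
      exact (norm_ivs (norm_pos_iff.1 hx)).symm
    refine ((OnePoint.continuous_coe.tendsto (0 : V)).comp h1).congr' ?_
    filter_upwards [tendsto_norm_cobounded_atTop.eventually_gt_atTop (0 : ℝ)] with x hx
    exact (ivf_coe (norm_pos_iff.1 hx)).symm
  · rw [continuous_iff_continuousAt]
    intro x
    by_cases hx : x = 0
    · subst hx
      have h3 : ContinuousWithinAt (fun x : V => ivf (x : OnePoint V)) {0}ᶜ 0 := by
        unfold ContinuousWithinAt; beta_reduce; rw [ivf_zero]; exact key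
      exact continuousWithinAt_compl_self.1 h3
    · have h1 : ContinuousAt (fun x : V => (((‖x‖ ^ 2)⁻¹ • x : V) : OnePoint V)) x := by
        refine OnePoint.continuous_coe.continuousAt.comp ?_
        refine ContinuousAt.smul (ContinuousAt.inv₀ (by fun_prop) ?_) continuousAt_id
        have := norm_ne_zero_iff.2 hx
        positivity
      refine h1.congr ?_
      filter_upwards [isOpen_ne.mem_nhds hx] with y hy
      exact (ivf_coe hy).symm

/-- inversion homeomorphism -/
noncomputable def ivh (V : Type*) [NormedAddCommGroup V] [NormedSpace ℝ V] [ProperSpace V] :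
    OnePoint V ≃ₜ OnePoint V where
  toFun := ivf
  invFun := ivf
  left_inv := ivf_ivf
  right_inv := ivf_ivf
  continuous_toFun := ivf_cont
  continuous_invFun := ivf_cont

theorem ivh_apply [ProperSpace V] (z : OnePoint V) : ivh V z = ivf z := rfl

theorem ivf_unit {x : V} (hx : ‖x‖ = 1) : ivf (x : OnePoint V) = x := by
  rw [ivf_coe (by rintro rfl; simp at hx), hx]; simp

/-- which points are images of the closed unit ball -/
theorem ivf_ball {z : OnePoint V} : (∃ x : V, ‖x‖ ≤ 1 ∧ ivf (x : OnePoint V) = z) ↔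
    ¬ ∃ x : V, ‖x‖ < 1 ∧ (x : OnePoint V) = z := by
  constructor
  · rintro ⟨x, hx, rfl⟩ ⟨y, hy, h⟩
    by_cases h0 : x = 0
    · subst h0; rw [ivf_zero] at h; exact OnePoint.coe_ne_infty y h
    · rw [ivf_coe h0, OnePoint.coe_eq_coe] at h
      rw [h, norm_ivs h0] at hy
      have := (one_le_inv₀ (norm_pos_iff.2 h0)).2 hx
      linarith
  · intro h
    rcases eq_or_ne z OnePoint.infty with rfl | hz
    · exact ⟨0, by simp, ivf_zero⟩
    · obtain ⟨y, rfl⟩ := OnePoint.ne_infty_iff_exists.1 hz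
      have hy : 1 ≤ ‖y‖ := by
        by_contra h'
        exact h ⟨y, not_le.1 h', rfl⟩
      have h0 : y ≠ 0 := by rintro rfl; simp at hy; linarith
      refine ⟨(‖y‖ ^ 2)⁻¹ • y, ?_, ?_⟩
      · rw [norm_ivs h0]; exact inv_le_one_of_one_le₀ hy
      · rw [← ivf_coe h0, ivf_ivf]

end Inv

section ThmL
variable {Q : Type*} [NormedAddCommGroup Q] [NormedSpace ℝ Q] [FiniteDimensional ℝ Q]

/-- half of the Swin data -/
theorem half_data (hd : 2 ≤ Module.finrank ℝ Q) {τ : (Q × ℝ) × ℝ → OnePoint (Q × ℝ) × ℝ}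
    (hτ : Tube τ) : ∃ E : OnePoint (Q × ℝ) × ℝ ≃ₜ OnePoint (Q × ℝ) × ℝ, Bdd E ∧
      (∀ p : (Q × ℝ) × ℝ, ‖p.1‖ = 1 → E (iota p) = τ p) ∧
      (∀ z, (∃ p ∈ DD Q, E (iota p) = z) ↔ ¬ ∃ p : (Q × ℝ) × ℝ, ‖p.1‖ < 1 ∧ τ p = z) ∧
      ∀ (x : Q × ℝ) r, ‖x‖ ≤ 1 → E (ivf (x : OnePoint (Q × ℝ)), r) = τ (x, r) := by
  have : ProperSpace Q := FiniteDimensional.proper ℝ Q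
  obtain ⟨α, hα, hατ⟩ := lemT hd hτ
  set J := (ivh (Q × ℝ)).prodCongr (Homeomorph.refl ℝ) with hJ
  have hJa : ∀ z r, J (z, r) = (ivf z, r) := fun z r => rfl
  refine ⟨J.trans α, hα.comp (bdd_prodCongr _), ?_, ?_, ?_⟩
  · rintro ⟨x, r⟩ hx
    rw [iota_mk, Homeomorph.trans_apply, hJa, ivf_unit hx]
    exact hατ x r hx.le
  · intro z
    obtain ⟨⟨w, r⟩, rfl⟩ := α.surjective z
    have h := ivf_ball (z := w)
    constructor
    · rintro ⟨⟨x, s⟩, hx, h1⟩ ⟨⟨y, s'⟩, hy, h2⟩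
      have h3 := α.injective h1
      have h4 : ivf (x : OnePoint (Q × ℝ)) = w := congrArg Prod.fst h3
      rw [← hατ _ _ hy.le] at h2
      have h6 := α.injective h2
      exact h.1 ⟨x, hx, h4⟩ ⟨y, hy, congrArg Prod.fst h6⟩
    · intro hz
      obtain ⟨x, hx, hxw⟩ := h.2 (by
        rintro ⟨y, hy, rfl⟩
        exact hz ⟨(y, r), hy, (hατ y r hy.le).symm⟩)
      refine ⟨(x, r), hx, ?_⟩
      rw [iota_mk, Homeomorph.trans_apply, hJa, hxw]
  · intro x r hx
    rw [Homeomorph.trans_apply, hJa, ivf_ivf]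
    exact hατ x r hx

theorem thmL (hd : 2 ≤ Module.finrank ℝ Q)
    {Φ : (OnePoint Q × ℝ) × ℝ → OnePoint (Q × ℝ) × ℝ} (hΦ : IsOpenEmbedding Φ) (hb : Bdd Φ) :
    ∃ Θ : OnePoint (Q × ℝ) × ℝ ≃ₜ OnePoint (Q × ℝ) × ℝ, Bdd Θ ∧
      (∀ (q : Q) r, Θ (((q, (0 : ℝ)) : Q × ℝ), r) = Φ ((q, 0), r)) ∧
      ∀ r, Θ (OnePoint.infty, r) = Φ ((OnePoint.infty, 0), r) := by
  have : ProperSpace Q := FiniteDimensional.proper ℝ Q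
  have : Nontrivial Q := Module.nontrivial_of_finrank_pos (R := ℝ) (by omega)
  set τm : (Q × ℝ) × ℝ → OnePoint (Q × ℝ) × ℝ := fun p => Φ ((p.1.1, p.1.2), p.2) with hτm
  set τp : (Q × ℝ) × ℝ → OnePoint (Q × ℝ) × ℝ := fun p => Φ ((ivf p.1.1, p.1.2), p.2) with hτp
  have tm : Tube τm := by
    refine ⟨hΦ.comp ((OnePoint.isOpenEmbedding_coe.prodMap IsOpenEmbedding.id).prodMap
      IsOpenEmbedding.id), ?_⟩
    obtain ⟨C, hC⟩ := hb
    exact ⟨C, fun p => hC ((p.1.1, p.1.2), p.2)⟩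
  have tp : Tube τp := by
    refine ⟨hΦ.comp ((((ivh Q).isOpenEmbedding.comp OnePoint.isOpenEmbedding_coe).prodMap
      IsOpenEmbedding.id).prodMap IsOpenEmbedding.id), ?_⟩
    obtain ⟨C, hC⟩ := hb
    exact ⟨C, fun p => hC ((ivf p.1.1, p.1.2), p.2)⟩
  obtain ⟨Ep, hEb, hE1, hE2, hE3⟩ := half_data hd tp
  obtain ⟨Em, hMb, hM1, hM2, -⟩ := half_data hd tm
  -- coordinate to the circle
  classical
  set g : ℝ → AddCircle (1 : ℝ) := fun t => ((max (-1) (min 1 t) / 2 : ℝ) : AddCircle (1 : ℝ)) with hg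
  have gc : Continuous g := (AddCircle.continuous_mk' 1).comp (by fun_prop)
  have hhalf : (((-1) / 2 : ℝ) : AddCircle (1 : ℝ)) = ((1 / 2 : ℝ) : AddCircle (1 : ℝ)) := by
    rw [← AddCircle.coe_add_period (1 : ℝ) ((-1) / 2)]; norm_num
  have g1 : ∀ t : ℝ, 1 ≤ |t| → g t = ((1 / 2 : ℝ) : AddCircle (1 : ℝ)) := fun t ht => by
    rcases le_abs.1 ht with h | h
    · simp only [hg]; rw [min_eq_left h, max_eq_right (by norm_num)]
    · simp only [hg]; rw [min_eq_right (by linarith), max_eq_left (by linarith), hhalf]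
  have g0 : ∀ t : ℝ, |t| ≤ 1 → g t = ((t / 2 : ℝ) : AddCircle (1 : ℝ)) := fun t ht => by
    rw [abs_le] at ht
    simp only [hg]; rw [min_eq_right ht.2, max_eq_right ht.1]
  set c : OnePoint (Q × ℝ) × ℝ → AddCircle (1 : ℝ) := fun z =>
    if h : ∃ p, Φ p = z then g h.choose.1.2 else ((1 / 2 : ℝ) : AddCircle (1 : ℝ)) with hc
  have cΦ : ∀ p, c (Φ p) = g p.1.2 := fun p => by
    have h : ∃ p', Φ p' = Φ p := ⟨p, rfl⟩
    simp only [hc]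
    rw [dif_pos h, hΦ.injective h.choose_spec]
  have cn : ∀ z, z ∉ range Φ → c z = ((1 / 2 : ℝ) : AddCircle (1 : ℝ)) := fun z hz => dif_neg hz
  have Kcl : IsClosed (Φ '' {p | |p.1.2| ≤ 1}) := by
    obtain ⟨C, hC⟩ := hb
    rw [← closure_subset_iff_isClosed]
    intro y hy
    set K : Set ((OnePoint Q × ℝ) × ℝ) := (univ ×ˢ Icc (-1) 1) ×ˢ Icc (y.2 - 1 - C) (y.2 + 1 + C)
    have hK : IsCompact K := (isCompact_univ.prod isCompact_Icc).prod isCompact_Icc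
    have hKc := (hK.image hΦ.continuous).isClosed
    have hsub : Φ '' K ⊆ Φ '' {p | |p.1.2| ≤ 1} := by
      refine image_mono fun p hp => abs_le.2 ⟨hp.1.2.1, hp.1.2.2⟩
    refine hsub (hKc.closure_subset_iff.2 (Subset.refl _) ?_)
    rw [mem_closure_iff_nhds] at hy ⊢
    intro t ht
    have hs : {z : OnePoint (Q × ℝ) × ℝ | |z.2 - y.2| < 1} ∈ 𝓝 y := by
      refine IsOpen.mem_nhds (isOpen_lt (by fun_prop) (by fun_prop)) ?_
      show |y.2 - y.2| < 1
      simp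
    obtain ⟨z, ⟨hz1, hz2⟩, ⟨p, hp, rfl⟩⟩ := hy _ (inter_mem ht hs)
    refine ⟨_, hz1, p, ?_, rfl⟩
    have h1 := abs_lt.1 (show |(Φ p).2 - y.2| < 1 from hz2)
    have h2 := abs_le.1 (hC p)
    have h3 := abs_le.1 (show |p.1.2| ≤ 1 from hp)
    exact ⟨⟨mem_univ _, h3.1, h3.2⟩, by linarith, by linarith⟩
  have cc : Continuous c := by
    rw [continuous_iff_continuousAt]
    intro z
    by_cases hz : z ∈ range Φ
    · obtain ⟨p, rfl⟩ := hz
      rw [← hΦ.continuousAt_iff (x := p)]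
      have : c ∘ Φ = fun p => g p.1.2 := funext cΦ
      rw [this]; fun_prop
    · have h0 : z ∈ (Φ '' {p | |p.1.2| ≤ 1})ᶜ := fun ⟨p, _, h⟩ => hz ⟨p, h⟩
      have : c =ᶠ[𝓝 z] fun _ => ((1 / 2 : ℝ) : AddCircle (1 : ℝ)) := by
        filter_upwards [Kcl.isOpen_compl.mem_nhds h0] with y hy
        by_cases hy' : y ∈ range Φ
        · obtain ⟨p, rfl⟩ := hy'
          rw [cΦ]
          refine g1 _ ?_
          by_contra h
          exact hy ⟨p, (not_le.1 h).le, rfl⟩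
        · exact cn y hy'
      exact continuousAt_const.congr this.symm
  have hinj : ∀ p ∈ DD Q, ∀ p' ∈ DD Q, τp p = τm p' → ‖p.1.1‖ = 1 := by
    intro p hp p' hp' h
    have h1 := congrArg (fun x => x.1.1) (hΦ.injective h)
    simp only at h1
    by_contra hne
    have hlt : ‖p.1.1‖ < 1 := lt_of_le_of_ne (mem_DD.1 hp).1 hne
    refine ivf_ball.1 ⟨p'.1.1, (mem_DD.1 hp').1, ?_⟩ ⟨p.1.1, hlt, rfl⟩
    rw [← h1, ivf_ivf]
  have S : Swin τp τm (Ep ∘ iota) (Em ∘ iota) c :=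
    { tp := tp, tm := tm, Ep := tube_iota.comp Ep hEb, Em := tube_iota.comp Em hMb
      h1p := hE1, h1m := hM1, h2p := hE2, h2m := hM2
      h3 := fun p hp => by
        simp only [hτp, hτm]; rw [ivf_unit hp]
      h4 := hinj, cc := cc
      hcp := fun p hp => by
        simp only [hτp]; rw [cΦ]; exact g0 _ (mem_DD.1 hp).2
      hcm := fun p hp => by
        simp only [hτm]; rw [cΦ]; exact g0 _ (mem_DD.1 hp).2
      hc0 := fun z h1 h2 => by
        by_cases hz : z ∈ range Φ
        · obtain ⟨⟨⟨s, t⟩, r⟩, rfl⟩ := hz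
          rw [cΦ]
          refine g1 _ ?_
          by_contra h
          have ht : |t| ≤ 1 := (not_le.1 h).le
          by_cases hs : ∃ x : Q, ‖x‖ < 1 ∧ (x : OnePoint Q) = s
          · obtain ⟨x, hx, rfl⟩ := hs
            exact h2 ((x, t), r) (mem_DD.2 ⟨hx.le, ht⟩) rfl
          · obtain ⟨x, hx, rfl⟩ := ivf_ball.2 hs
            exact h1 ((x, t), r) (mem_DD.2 ⟨hx, ht⟩) rfl
        · exact cn z hz }
  obtain ⟨Ω, Ωc, Ωb, Ωbd, Ωl, ΩD, Ωid⟩ := S.exists_Omega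
  obtain ⟨Λ, hΛb, hΛi, hΛ1, hΛ2⟩ := squeeze Ω Ωc Ωb Ωbd Ωl
  refine ⟨Λ.trans Ep, hEb.comp hΛb, ?_, ?_⟩
  · intro q r
    rw [Homeomorph.trans_apply]
    rcases le_total ‖q‖ 1 with h | h
    · have hm : ((q, (0 : ℝ)), r) ∈ DD Q := mem_DD.2 ⟨h, by simp⟩
      obtain ⟨a, b⟩ := ΩD _ hm
      rw [hΛ1 _ r hm a]
      exact b
    · rw [hΛ2 (q, 0) (fun r => Ωid ((q, 0), r) h) r]
      have h0 : q ≠ 0 := by rintro rfl; simp at h; linarith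
      have h1 : ((‖q‖ ^ 2)⁻¹ • q) ≠ 0 := smul_ne_zero (by have := norm_pos_iff.2 h0; positivity) h0
      have h2 := hE3 ((‖q‖ ^ 2)⁻¹ • q, 0) r (by
        rw [Prod.norm_def]; simp only [norm_ivs h0, norm_zero]
        exact max_le (inv_le_one_of_one_le₀ h) zero_le_one)
      have h3 : ivf ((((‖q‖ ^ 2)⁻¹ • q, (0 : ℝ)) : Q × ℝ) : OnePoint (Q × ℝ)) = (((q, 0) : Q × ℝ) : OnePoint (Q × ℝ)) := by
        have hq0 : ((q, 0) : Q × ℝ) ≠ 0 := fun h => h0 (congrArg Prod.fst h)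
        have hn : ‖((q, 0) : Q × ℝ)‖ = ‖q‖ := by simp [Prod.norm_def]
        rw [← ivf_ivf (((q, 0) : Q × ℝ) : OnePoint (Q × ℝ)), ivf_coe hq0, hn]
        simp
      rw [h3] at h2
      rw [h2]
      simp only [hτp]
      rw [← ivf_coe h0, ivf_ivf]
  · intro r
    rw [Homeomorph.trans_apply, hΛi]
    have h2 := hE3 (0, 0) r (by simp [Prod.norm_def])
    rw [show (((0 : Q), (0 : ℝ)) : Q × ℝ) = 0 from rfl, ivf_zero] at h2
    rw [h2]
    show Φ ((ivf ((0 : Q) : OnePoint Q), (0 : ℝ)), r) = _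
    rw [ivf_zero]

end ThmL
end LFS


open Filter Topology

namespace LFS
open Set

theorem openEmb_of_inv {X Y : Type*} [TopologicalSpace X] [TopologicalSpace Y] {f : X → Y}
    (hf : Continuous f) {R : Set Y} (hR : IsOpen R) (g : Y → X) (hg : ContinuousOn g R)
    (hfR : ∀ x, f x ∈ R) (h1 : ∀ x, g (f x) = x) (h2 : ∀ y ∈ R, f (g y) = y) :
    IsOpenEmbedding f := by
  refine IsOpenEmbedding.of_continuous_injective_isOpenMap hf
    (Function.LeftInverse.injective h1) fun O hO => ?_
  have : f '' O = R ∩ g ⁻¹' O := by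
    ext y; constructor
    · rintro ⟨x, hx, rfl⟩; exact ⟨hfR x, by rw [mem_preimage, h1]; exact hx⟩
    · rintro ⟨hy, hy2⟩; exact ⟨g y, hy2, h2 y hy⟩
  rw [this]
  exact hg.isOpen_inter_preimage hR hO

section Polar
variable {E : Type*} [NormedAddCommGroup E] [NormedSpace ℝ E]

/-- polar coordinates -/
noncomputable def pol (E : Type*) [NormedAddCommGroup E] [NormedSpace ℝ E] :
    Metric.sphere (0 : E) 1 × ℝ ≃ₜ ({0}ᶜ : Set E) where
  toFun p := ⟨Real.exp p.2 • (p.1 : E), by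
    have : (p.1 : E) ≠ 0 := by
      intro h
      have := norm_eq_of_mem_sphere p.1
      rw [h] at this; simp at this
    exact smul_ne_zero (Real.exp_pos _).ne' this⟩
  invFun x := (⟨‖(x : E)‖⁻¹ • (x : E), by
    have : ‖(x : E)‖ ≠ 0 := norm_ne_zero_iff.2 x.2
    rw [mem_sphere_zero_iff_norm, norm_smul, norm_inv, norm_norm, inv_mul_cancel₀ this]⟩,
    Real.log ‖(x : E)‖)
  left_inv p := by
    have h1 : ‖Real.exp p.2 • (p.1 : E)‖ = Real.exp p.2 := by
      rw [norm_smul, norm_eq_of_mem_sphere, mul_one, Real.norm_eq_abs, abs_of_pos (Real.exp_pos _)]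
    ext1
    · ext1
      simp only [h1]
      rw [smul_smul, inv_mul_cancel₀ (Real.exp_pos _).ne', one_smul]
    · simp only [h1, Real.log_exp]
  right_inv x := by
    have : 0 < ‖(x : E)‖ := norm_pos_iff.2 x.2
    ext1
    simp only
    rw [Real.exp_log this, smul_smul, mul_inv_cancel₀ this.ne', one_smul]
  continuous_toFun := by fun_prop
  continuous_invFun := by
    have h : ∀ x : ({0}ᶜ : Set E), ‖(x : E)‖ ≠ 0 := fun x => norm_ne_zero_iff.2 x.2
    refine Continuous.prodMk (Continuous.subtype_mk (Continuous.smul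
      (Continuous.inv₀ (by fun_prop) h) (by fun_prop)) _) (Continuous.log (by fun_prop) h)

theorem pol_coe (p : Metric.sphere (0 : E) 1 × ℝ) : ((pol E p : ({0}ᶜ : Set E)) : E) =
    Real.exp p.2 • (p.1 : E) := rfl

theorem norm_pol (p : Metric.sphere (0 : E) 1 × ℝ) : ‖((pol E p : ({0}ᶜ : Set E)) : E)‖ =
    Real.exp p.2 := by
  rw [pol_coe, norm_smul, norm_eq_of_mem_sphere, mul_one, Real.norm_eq_abs,
    abs_of_pos (Real.exp_pos _)]

theorem pol_symm_snd (x : ({0}ᶜ : Set E)) : ((pol E).symm x).2 = Real.log ‖(x : E)‖ := rfl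
theorem pol_symm_fst (x : ({0}ᶜ : Set E)) : (((pol E).symm x).1 : E) = ‖(x : E)‖⁻¹ • (x : E) := rfl

open Classical in
/-- extension over zero -/
noncomputable def ext0 (g : Metric.sphere (0 : E) 1 × ℝ → Metric.sphere (0 : E) 1 × ℝ) (x : E) : E :=
  if h : x = 0 then 0 else pol E (g ((pol E).symm ⟨x, h⟩))

theorem ext0_zero (g : Metric.sphere (0 : E) 1 × ℝ → Metric.sphere (0 : E) 1 × ℝ) :
    ext0 g 0 = 0 := dif_pos rfl

theorem ext0_coe (g : Metric.sphere (0 : E) 1 × ℝ → Metric.sphere (0 : E) 1 × ℝ)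
    (x : ({0}ᶜ : Set E)) : ext0 g x = pol E (g ((pol E).symm x)) := dif_neg x.2

theorem ext0_cont {g : Metric.sphere (0 : E) 1 × ℝ → Metric.sphere (0 : E) 1 × ℝ}
    (hg : Continuous g) (hb : Bdd g) : Continuous (ext0 g) := by
  rw [continuous_iff_continuousAt]
  intro x
  by_cases hx : x = 0
  · subst hx
    obtain ⟨C, hC⟩ := hb
    rw [ContinuousAt, ext0_zero]
    refine squeeze_zero_norm (a := fun x => Real.exp C * ‖x‖) ?_ ?_
    · intro x
      by_cases h : x = 0
      · subst h; rw [ext0_zero]; simp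
      · have e := ext0_coe g ⟨x, h⟩
        simp only at e
        rw [e, norm_pol]
        have h1 := (abs_le.1 (hC ((pol E).symm ⟨x, h⟩))).2
        rw [pol_symm_snd] at h1
        have hp : 0 < ‖x‖ := norm_pos_iff.2 h
        calc _ ≤ Real.exp (C + Real.log ‖x‖) := Real.exp_le_exp.2 (by simp only at h1; linarith)
          _ = _ := by rw [Real.exp_add, Real.exp_log hp]
    · have : Tendsto (fun x : E => Real.exp C * ‖x‖) (𝓝 0) (𝓝 (Real.exp C * ‖(0 : E)‖)) :=
        (by fun_prop : Continuous fun x : E => Real.exp C * ‖x‖).tendsto 0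
      simpa using this
  · have he : IsOpenEmbedding (Subtype.val : ({0}ᶜ : Set E) → E) :=
      isOpen_compl_singleton.isOpenEmbedding_subtypeVal
    have := he.continuousAt_iff (g := ext0 g) (x := ⟨x, hx⟩)
    rw [← this]
    have h2 : ext0 g ∘ Subtype.val = fun x : ({0}ᶜ : Set E) => ((pol E (g ((pol E).symm x)) :
      ({0}ᶜ : Set E)) : E) := funext fun x => ext0_coe g x
    rw [h2]
    exact (continuous_subtype_val.comp
      ((pol E).continuous.comp (hg.comp (pol E).symm.continuous))).continuousAt

theorem ext0_ext0 {g g' : Metric.sphere (0 : E) 1 × ℝ → Metric.sphere (0 : E) 1 × ℝ}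
    (h : ∀ p, g (g' p) = p) (x : E) : ext0 g (ext0 g' x) = x := by
  by_cases hx : x = 0
  · subst hx; rw [ext0_zero, ext0_zero]
  · have e := ext0_coe g' ⟨x, hx⟩
    simp only at e
    rw [e, ext0_coe, Homeomorph.symm_apply_apply, h, Homeomorph.apply_symm_apply]

end Polar

section G
variable {d : ℕ}

theorem corL (hd : 2 ≤ d) {A B : Type*} [TopologicalSpace A] [TopologicalSpace B]
    (eA : OnePoint (EuclideanSpace ℝ (Fin d)) ≃ₜ A)
    (eB : OnePoint (EuclideanSpace ℝ (Fin d) × ℝ) ≃ₜ B)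
    {Φ Ψ : (A × ℝ) × ℝ → B × ℝ} (hΦ : IsOpenEmbedding Φ) (hΦb : Bdd Φ)
    (hΨ : IsOpenEmbedding Ψ) (hΨb : Bdd Ψ) :
    ∃ Θ : B × ℝ ≃ₜ B × ℝ, Bdd Θ ∧ ∀ s r, Θ (Φ ((s, 0), r)) = Ψ ((s, 0), r) := by
  have aux : ∀ {Φ : (A × ℝ) × ℝ → B × ℝ}, IsOpenEmbedding Φ → Bdd Φ →
      ∃ Θ : OnePoint (EuclideanSpace ℝ (Fin d) × ℝ) × ℝ ≃ₜ B × ℝ, Bdd Θ ∧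
      (∀ (q : EuclideanSpace ℝ (Fin d)) r,
        Θ (((q, (0 : ℝ)) : EuclideanSpace ℝ (Fin d) × ℝ), r) = Φ ((eA q, 0), r)) ∧
      ∀ r, Θ (OnePoint.infty, r) = Φ ((eA OnePoint.infty, 0), r) := by
    intro Φ h hb
    set eB' := eB.prodCongr (Homeomorph.refl ℝ)
    set eA' := (eA.prodCongr (Homeomorph.refl ℝ)).prodCongr (Homeomorph.refl ℝ)
    obtain ⟨Θ, h1, h2, h3⟩ := thmL (Q := EuclideanSpace ℝ (Fin d)) (by simpa using hd)
      (Φ := eB'.symm ∘ Φ ∘ eA')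
      (eB'.symm.isOpenEmbedding.comp (h.comp eA'.isOpenEmbedding))
      ((bdd_prodCongr eB).symm.comp (hb.comp (bdd_prodCongr _)))
    refine ⟨Θ.trans eB', (bdd_prodCongr eB).comp h1, ?_, ?_⟩
    · intro q r
      rw [Homeomorph.trans_apply, h2]; simp [eA']
    · intro r
      rw [Homeomorph.trans_apply, h3]; simp [eA']
  obtain ⟨Θ1, a1, a2, a3⟩ := aux hΦ hΦb
  obtain ⟨Θ2, b1, b2, b3⟩ := aux hΨ hΨb
  refine ⟨Θ1.symm.trans Θ2, b1.comp a1.symm, ?_⟩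
  intro s r
  obtain ⟨s, rfl⟩ := eA.surjective s
  rw [Homeomorph.trans_apply]
  induction s using OnePoint.rec with
  | infty => rw [← a3, Homeomorph.symm_apply_apply, b3]
  | coe x => rw [← a2, Homeomorph.symm_apply_apply, b2]

variable {V E : Type*} [NormedAddCommGroup V] [NormedSpace ℝ V] [NormedAddCommGroup E]
  [NormedSpace ℝ E]

theorem kappa_exists (spl : E ≃L[ℝ] V × ℝ) :
    ∃ κ : Metric.sphere (0 : V) 1 × ℝ → Metric.sphere (0 : E) 1, IsOpenEmbedding κ ∧
      ∀ s t, ∃ a : ℝ, 0 < a ∧ (κ (s, t) : E) = a • spl.symm (s, t) := by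
  have h0 : ∀ p : Metric.sphere (0 : V) 1 × ℝ, (spl.symm ((p.1 : V), p.2)) ∈ ({0}ᶜ : Set E) := by
    intro p h
    have h1 : ((p.1 : V), p.2) = 0 := by
      have h2 := congrArg spl (show spl.symm ((p.1 : V), p.2) = 0 from h)
      simpa using h2
    have h3 := norm_eq_of_mem_sphere p.1
    rw [show (p.1 : V) = 0 from congrArg Prod.fst h1] at h3; simp at h3
  set R : Set (Metric.sphere (0 : E) 1) := {b | (spl (b : E)).1 ∈ ({0}ᶜ : Set V)}
  have hR : IsOpen R := isOpen_compl_singleton.preimage (by fun_prop)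
  set κ : Metric.sphere (0 : V) 1 × ℝ → Metric.sphere (0 : E) 1 := fun p =>
    ((pol E).symm ⟨_, h0 p⟩).1
  have hk : ∀ p, (κ p : E) = ‖spl.symm ((p.1 : V), p.2)‖⁻¹ • spl.symm ((p.1 : V), p.2) := fun p => rfl
  have hk0 : ∀ p : Metric.sphere (0 : V) 1 × ℝ, 0 < ‖spl.symm ((p.1 : V), p.2)‖⁻¹ := fun p =>
    inv_pos.2 (norm_pos_iff.2 (h0 p))
  classical
  by_cases hne : Nonempty (Metric.sphere (0 : V) 1)
  swap
  · refine ⟨κ, ?_, fun s => (hne ⟨s⟩).elim⟩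
    have : IsEmpty (Metric.sphere (0 : V) 1 × ℝ) := ⟨fun p => hne ⟨p.1⟩⟩
    exact IsOpenEmbedding.of_continuous_injective_isOpenMap
      (continuous_of_const fun x => isEmptyElim x) (fun x => isEmptyElim x)
      fun O _ => by rw [show O = ∅ from Subsingleton.elim _ _]; simp
  obtain ⟨s0⟩ := hne
  have hkp : ∀ p, spl (κ p : E) = (‖spl.symm ((p.1 : V), p.2)‖⁻¹ • (p.1 : V),
      ‖spl.symm ((p.1 : V), p.2)‖⁻¹ * p.2) := fun p => by rw [hk]; simp
  set g : Metric.sphere (0 : E) 1 → Metric.sphere (0 : V) 1 × ℝ := fun b =>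
    if h : b ∈ R then (((pol V).symm ⟨_, h⟩).1, ‖(spl (b : E)).1‖⁻¹ * (spl (b : E)).2) else (s0, 0)
  have hκR : ∀ p, κ p ∈ R := fun p h => by
    have h' : (spl (κ p : E)).1 = 0 := h
    rw [hkp] at h'
    rcases smul_eq_zero.1 h' with h1 | h1
    · exact (hk0 p).ne' h1
    · have h3 := norm_eq_of_mem_sphere p.1
      rw [h1] at h3; simp at h3
  refine ⟨κ, openEmb_of_inv ?_ hR g ?_ hκR ?_ ?_, fun s t => ⟨_, hk0 (s, t), hk (s, t)⟩⟩
  · exact continuous_fst.comp ((pol E).symm.continuous.comp (by fun_prop))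
  · rw [continuousOn_iff_continuous_domRestrict]
    have : R.domRestrict g = fun b : R => (((pol V).symm ⟨_, b.2⟩).1,
      ‖(spl ((b : Metric.sphere (0 : E) 1) : E)).1‖⁻¹ * (spl ((b : Metric.sphere (0 : E) 1) : E)).2) := by
      ext1 b
      exact dif_pos b.2
    rw [this]
    refine Continuous.prodMk (continuous_fst.comp ((pol V).symm.continuous.comp (by fun_prop)))
      (Continuous.mul (Continuous.inv₀ (by fun_prop) fun b => norm_ne_zero_iff.2 b.2) (by fun_prop))
  · intro p
    have h1 := hk0 p
    have h2 : ‖(spl (κ p : E)).1‖ = ‖spl.symm ((p.1 : V), p.2)‖⁻¹ := by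
      rw [hkp]; simp only; rw [norm_smul, norm_eq_of_mem_sphere, mul_one, Real.norm_eq_abs, abs_of_pos h1]
    have : g (κ p) = (((pol V).symm ⟨_, hκR p⟩).1,
      ‖(spl (κ p : E)).1‖⁻¹ * (spl (κ p : E)).2) := dif_pos (hκR p)
    rw [this]
    ext1
    · ext1
      simp only [pol_symm_fst]
      rw [h2, hkp, smul_smul, inv_mul_cancel₀ h1.ne', one_smul]
    · simp only
      rw [h2, hkp, ← mul_assoc, inv_mul_cancel₀ h1.ne', one_mul]
  · intro b hb
    have e : g b = (((pol V).symm ⟨_, hb⟩).1, ‖(spl (b : E)).1‖⁻¹ * (spl (b : E)).2) := dif_pos hb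
    have hp : 0 < ‖(spl (b : E)).1‖⁻¹ := inv_pos.2 (norm_pos_iff.2 hb)
    have e2 : spl.symm (((g b).1 : V), (g b).2) = ‖(spl (b : E)).1‖⁻¹ • (b : E) := by
      rw [e, pol_symm_fst]; simp only
      apply spl.injective
      rw [ContinuousLinearEquiv.apply_symm_apply, map_smul]; rfl
    ext1
    rw [hk, e2, norm_smul, norm_eq_of_mem_sphere, mul_one, Real.norm_eq_abs, abs_of_pos hp, smul_smul,
      inv_mul_cancel₀ hp.ne', one_smul]

theorem lemG (hd : 2 ≤ d) 
    (eA : OnePoint (EuclideanSpace ℝ (Fin d)) ≃ₜ Metric.sphere (0 : V) 1)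
    (eB : OnePoint (EuclideanSpace ℝ (Fin d) × ℝ) ≃ₜ Metric.sphere (0 : E) 1)
    (spl : E ≃L[ℝ] V × ℝ)
    {Ψ : (Metric.sphere (0 : V) 1 × ℝ) × ℝ → ({0}ᶜ : Set E)} (hΨ : IsOpenEmbedding Ψ)
    (hb : ∃ C : ℝ, ∀ p, |Real.log ‖(Ψ p : E)‖ - p.2| ≤ C) :
    ∃ H : E ≃ₜ E, H 0 = 0 ∧ ∀ x, x ≠ 0 →
      ((spl x).2 = 0 ↔ ∃ s r, H x = Ψ ((s, 0), r)) := by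
  obtain ⟨κ, hκ, hκ2⟩ := kappa_exists spl
  obtain ⟨Θ, hΘ, hΘ2⟩ := corL hd eA eB (Φ := fun p => (κ p.1, p.2)) (Ψ := fun p => (pol E).symm (Ψ p))
    (hκ.prodMap IsOpenEmbedding.id) ⟨0, fun p => by simp⟩
    ((pol E).symm.isOpenEmbedding.comp hΨ) (by
      obtain ⟨C, hC⟩ := hb
      exact ⟨C, fun p => by rw [pol_symm_snd]; exact hC p⟩)
  set H : E ≃ₜ E :=
    { toFun := ext0 Θ, invFun := ext0 Θ.symm
      left_inv := ext0_ext0 (by simp), right_inv := ext0_ext0 (by simp)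
      continuous_toFun := ext0_cont Θ.continuous hΘ
      continuous_invFun := ext0_cont Θ.symm.continuous hΘ.symm } with hH
  have Ha : ∀ x, H x = ext0 Θ x := fun x => rfl
  have key : ∀ s r, H (pol E (κ (s, 0), r)) = Ψ ((s, 0), r) := fun s r => by
    rw [Ha, ext0_coe, Homeomorph.symm_apply_apply, hΘ2, Homeomorph.apply_symm_apply]
  refine ⟨H, ext0_zero _, fun x hx => ?_⟩
  constructor
  · intro h
    have hx1 : (spl x).1 ≠ 0 := fun h1 => hx (by
      have : spl x = 0 := Prod.ext h1 h
      simpa using this)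
    have hn := norm_pos_iff.2 hx1
    set s := ((pol V).symm ⟨_, hx1⟩).1
    obtain ⟨a, ha, hs⟩ := hκ2 s 0
    have hs' : spl.symm ((s : V), (0 : ℝ)) = ‖(spl x).1‖⁻¹ • x := by
      apply spl.injective
      rw [ContinuousLinearEquiv.apply_symm_apply, map_smul]
      ext1
      · rfl
      · simp [h]
    have hpos : 0 < (a * ‖(spl x).1‖⁻¹)⁻¹ := by positivity
    refine ⟨s, Real.log (a * ‖(spl x).1‖⁻¹)⁻¹, ?_⟩
    rw [← key]
    congr 1
    rw [pol_coe]
    simp only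
    rw [hs, hs', Real.exp_log hpos, smul_smul, smul_smul, mul_assoc, inv_mul_cancel₀ (by positivity),
      one_smul]
  · rintro ⟨s, r, h⟩
    rw [← key] at h
    have := H.injective h
    obtain ⟨a, ha, hs⟩ := hκ2 s 0
    rw [this, pol_coe]
    simp only
    rw [hs]
    simp

end G
end LFS


open Filter Topology

namespace LFS
open Set

section GM
variable {d : ℕ} {V E M : Type*} [NormedAddCommGroup V] [NormedSpace ℝ V] [NormedAddCommGroup E]
  [NormedSpace ℝ E] [TopologicalSpace M]

theorem fund {a : V × ℝ → V × ℝ} (na1 : ∀ p, ‖(a p).1‖ = 2 * ‖p.1‖)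
    (na2 : ∀ p, |(a p).2| = |p.2| / 2) (as : Function.Surjective a) (p : V × ℝ) (hp : p.1 ≠ 0) :
    ∃ p' : V × ℝ, 1 ≤ ‖p'.1‖ ∧ ‖p'.1‖ ≤ 2 ∧ ‖p'.1‖ * |p'.2| = ‖p.1‖ * |p.2| ∧
      ∀ P : V × ℝ → Prop, (∀ q, P (a q) ↔ P q) → P p' → P p := by
  have it : ∀ (j : ℕ) q, ‖(a^[j] q).1‖ = 2 ^ j * ‖q.1‖ ∧
      ‖(a^[j] q).1‖ * |(a^[j] q).2| = ‖q.1‖ * |q.2| ∧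
      ∀ P : V × ℝ → Prop, (∀ q, P (a q) ↔ P q) → (P (a^[j] q) ↔ P q) := by
    intro j
    induction j with
    | zero => intro q; simp
    | succ j ih =>
      intro q
      rw [Function.iterate_succ_apply']
      obtain ⟨h1, h2, h3⟩ := ih q
      refine ⟨?_, ?_, ?_⟩
      · rw [na1, h1]; ring
      · rw [na1, na2, ← h2]; ring
      · intro P hP; rw [hP, h3 P hP]
  obtain ⟨n, hn1, hn2⟩ := exists_mem_Ico_zpow (norm_pos_iff.2 hp) (one_lt_two (α := ℝ))
  have h2n : (0 : ℝ) < 2 ^ n := by positivity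
  rw [zpow_add_one₀ two_ne_zero] at hn2
  rcases Int.eq_nat_or_neg n with ⟨j, rfl | rfl⟩
  · obtain ⟨q, hq⟩ := as.iterate j p
    obtain ⟨h1, h2, h3⟩ := it j q
    rw [hq] at h1 h2 h3
    rw [zpow_natCast] at *
    refine ⟨q, ?_, ?_, h2.symm, fun P hP h => (h3 P hP).2 h⟩
    · rw [h1] at hn1; exact (le_mul_iff_one_le_right h2n).1 hn1
    · rw [h1] at hn2; exact (lt_of_mul_lt_mul_left hn2 h2n.le).le
  · obtain ⟨h1, h2, h3⟩ := it j p
    rw [zpow_neg, zpow_natCast] at *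
    have h2j : (0 : ℝ) < 2 ^ j := by positivity
    refine ⟨a^[j] p, ?_, ?_, h2, fun P hP h => (h3 P hP).1 h⟩
    · rw [h1]; rwa [inv_le_iff_one_le_mul₀' h2j] at hn1
    · rw [h1]
      have := mul_lt_mul_of_pos_left hn2 h2j
      rw [← mul_assoc, mul_inv_cancel₀ h2j.ne', one_mul] at this
      exact this.le

/-- the data of a saddle chart and a sink chart -/
structure Dat (F : M ≃ₜ M) (jU : V × ℝ → M) (jW : E → M) (a : V × ℝ → V × ℝ) (b : E → E) (k : ℕ) :
    Prop where
  oU : IsOpenEmbedding jU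
  oW : IsOpenEmbedding jW
  cU : ∀ p, F (jU p) = jU (a p)
  cW : ∀ p, F (jW p) = jW (b p)
  na1 : ∀ p, ‖(a p).1‖ = 2 * ‖p.1‖
  na2 : ∀ p, |(a p).2| = |p.2| / 2
  as : Function.Surjective a
  nb : ∀ y, ‖b y‖ = (2 ^ k)⁻¹ * ‖y‖
  bs : Function.Surjective b
  hk : 0 < k
  h0 : jW 0 ∉ range jU
  hUW : ∀ x : V, x ≠ 0 → jU (x, 0) ∈ range jW

variable {F : M ≃ₜ M} {jU : V × ℝ → M} {jW : E → M} {a : V × ℝ → V × ℝ} {b : E → E} {k : ℕ}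

theorem Dat.exists_c [ProperSpace V] (D : Dat F jU jW a b k) :
    ∃ (c : ℝ) (G : V × ℝ → E), 0 < c ∧
      (∀ p : V × ℝ, p.1 ≠ 0 → ‖p.1‖ * |p.2| ≤ c → jW (G p) = jU p ∧ G p ≠ 0) ∧
      ∃ C : ℝ, ∀ p : V × ℝ, p.1 ≠ 0 → ‖p.1‖ * |p.2| ≤ c →
        |Real.log ‖G p‖ + k * Real.log ‖p.1‖| ≤ C := by
  have : Nonempty E := ⟨0⟩
  set G : V × ℝ → E := fun p => Function.invFun jW (jU p) with hG
  set Z : Set (V × ℝ) := jU ⁻¹' range jW with hZ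
  have Zo : IsOpen Z := D.oW.isOpen_range.preimage D.oU.continuous
  have GZ : ∀ p ∈ Z, jW (G p) = jU p := fun p hp => Function.invFun_eq hp
  have GW : ∀ p y, jW y = jU p → G p = y := fun p y h => by
    simp only [hG]; rw [← h, Function.leftInverse_invFun D.oW.injective]
  have G0 : ∀ p ∈ Z, G p ≠ 0 := fun p hp h => D.h0 ⟨p, by rw [← GZ p hp, h]⟩
  have Gc : ContinuousOn G Z := by
    intro p hp
    have h1 : ContinuousAt (Function.invFun jW) (jU p) := by
      obtain ⟨y, hy⟩ := hp
      rw [← hy, ← D.oW.continuousAt_iff]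
      have : Function.invFun jW ∘ jW = id := funext (Function.leftInverse_invFun D.oW.injective)
      rw [this]; exact continuousAt_id
    exact (h1.comp D.oU.continuous.continuousAt).continuousWithinAt
  have Za : ∀ p, a p ∈ Z ↔ p ∈ Z := fun p => by
    constructor
    · rintro ⟨y, hy⟩
      obtain ⟨y', rfl⟩ := D.bs y
      rw [← D.cW, ← D.cU] at hy
      exact ⟨y', F.injective hy⟩
    · rintro ⟨y, hy⟩
      exact ⟨b y, by rw [← D.cW, hy, D.cU]⟩
  have Ga : ∀ p ∈ Z, G (a p) = b (G p) := fun p hp => GW _ _ (by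
    rw [← D.cW, GZ p hp, D.cU])
  have an : ∀ p, (a p).1 ≠ 0 ↔ p.1 ≠ 0 := fun p => by
    rw [← norm_ne_zero_iff, ← norm_ne_zero_iff, D.na1]; simp
  have am : ∀ p, ‖(a p).1‖ * |(a p).2| = ‖p.1‖ * |p.2| := fun p => by
    rw [D.na1, D.na2]; ring
  -- the constant
  have Ac : IsCompact {x : V | 1 ≤ ‖x‖ ∧ ‖x‖ ≤ 2} := by
    refine (isCompact_closedBall (0 : V) 2).of_isClosed_subset ?_ ?_
    · have e1 : IsClosed {x : V | 1 ≤ ‖x‖} := isClosed_le (by fun_prop) (by fun_prop)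
      have e2 : IsClosed {x : V | ‖x‖ ≤ 2} := isClosed_le (by fun_prop) (by fun_prop)
      exact e1.inter e2
    · intro x hx; simpa using hx.2
  obtain ⟨u, v, hu, hv, h1, h2, h3⟩ := generalized_tube_lemma Ac (isCompact_singleton (x := (0 : ℝ)))
    Zo (by
      rintro ⟨x, t⟩ ⟨hx, ht⟩
      have ht : t = 0 := ht
      subst ht
      exact D.hUW x (norm_pos_iff.1 (by linarith [hx.1])))
  obtain ⟨c, hc, hcv⟩ := Metric.nhds_basis_closedBall.mem_iff.1 (hv.mem_nhds (h2 rfl))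
  have cZ : ∀ p : V × ℝ, p.1 ≠ 0 → ‖p.1‖ * |p.2| ≤ c → p ∈ Z := by
    intro p hp hpc
    obtain ⟨p', h4, h5, h6, h7⟩ := fund D.na1 D.na2 D.as p hp
    refine h7 _ Za (h3 ⟨h1 ⟨h4, h5⟩, hcv ?_⟩)
    rw [mem_closedBall_zero_iff, Real.norm_eq_abs]
    rw [← h6] at hpc
    refine le_trans ?_ hpc
    exact le_mul_of_one_le_left (abs_nonneg _) h4
  refine ⟨c, G, hc, fun p h h' => ⟨GZ p (cZ p h h'), G0 p (cZ p h h')⟩, ?_⟩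
  set K : Set (V × ℝ) := ({x : V | 1 ≤ ‖x‖ ∧ ‖x‖ ≤ 2} ×ˢ Icc (-c) c) ∩ {p | ‖p.1‖ * |p.2| ≤ c} with hK
  have Kc : IsCompact K := (Ac.prod isCompact_Icc).inter_right
    (isClosed_le (by fun_prop) (by fun_prop))
  have K1 : ∀ p ∈ K, p.1 ≠ 0 := fun p hp => norm_pos_iff.1 (by linarith [hp.1.1.1])
  obtain ⟨C, hC⟩ := Kc.exists_bound_of_continuousOn
    (f := fun p => Real.log ‖G p‖ + k * Real.log ‖p.1‖) (by
      have hKZ : K ⊆ Z := fun p hp => cZ p (K1 p hp) hp.2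
      refine ContinuousOn.add (ContinuousOn.log (Gc.mono hKZ).norm
        fun p hp => norm_ne_zero_iff.2 (G0 p (hKZ hp))) (continuousOn_const.mul
        (ContinuousOn.log (by fun_prop) fun p hp => norm_ne_zero_iff.2 (K1 p hp))))
  refine ⟨C, fun p hp hpc => ?_⟩
  obtain ⟨p', h4, h5, h6, h7⟩ := fund D.na1 D.na2 D.as p hp
  refine h7 (fun p => p.1 ≠ 0 → ‖p.1‖ * |p.2| ≤ c →
        |Real.log ‖G p‖ + k * Real.log ‖p.1‖| ≤ C) ?_ ?_ hp hpc
  · intro q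
    beta_reduce
    rw [an, am]
    refine imp_congr_right fun hq => imp_congr_right fun hqc => ?_
    have hqZ := cZ q hq hqc
    have e1 : Real.log ‖G (a q)‖ = Real.log ‖G q‖ - k * Real.log 2 := by
      rw [Ga q hqZ, D.nb, Real.log_mul (by positivity) (norm_ne_zero_iff.2 (G0 q hqZ)), Real.log_inv,
        Real.log_pow]; ring
    have e2 : Real.log ‖(a q).1‖ = Real.log 2 + Real.log ‖q.1‖ := by
      rw [D.na1, Real.log_mul two_ne_zero (norm_ne_zero_iff.2 hq)]
    rw [e1, e2]
    rw [show Real.log ‖G q‖ - k * Real.log 2 + k * (Real.log 2 + Real.log ‖q.1‖) =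
      Real.log ‖G q‖ + k * Real.log ‖q.1‖ by ring]
  · intro _ hpc'
    refine hC p' ⟨⟨⟨h4, h5⟩, ?_⟩, hpc'⟩
    refine abs_le.1 (le_trans ?_ hpc')
    exact le_mul_of_one_le_left (abs_nonneg _) h4

theorem Dat.tendsto [ProperSpace V] (D : Dat F jU jW a b k) :
    Tendsto (fun x : V => jU (x, 0)) (cocompact V) (𝓝 (jW 0)) := by
  obtain ⟨c, G, hc, h1, C, h2⟩ := D.exists_c
  have hc0 : ∀ x : V, ‖((x, (0 : ℝ)) : V × ℝ).1‖ * |((x, (0 : ℝ)) : V × ℝ).2| ≤ c := fun x => by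
    simp [hc.le]
  rw [← Metric.cobounded_eq_cocompact]
  have hk : (0 : ℝ) < k := Nat.cast_pos.2 D.hk
  have hG : Tendsto (fun x : V => G (x, 0)) (Bornology.cobounded V) (𝓝 0) := by
    refine squeeze_zero_norm' (a := fun x => Real.exp (C - k * Real.log ‖x‖)) ?_ ?_
    · filter_upwards [tendsto_norm_cobounded_atTop.eventually_gt_atTop (0 : ℝ)] with x hx
      have hx' := norm_pos_iff.1 hx
      have h3 := (abs_le.1 (h2 (x, 0) hx' (hc0 x))).2
      have h4 := norm_pos_iff.2 (h1 (x, 0) hx' (hc0 x)).2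
      rw [← Real.log_le_iff_le_exp h4]
      simp only at h3; linarith
    · refine Real.tendsto_exp_atBot.comp ?_
      refine tendsto_atBot_add_const_left _ C ?_ |>.congr fun x => (sub_eq_add_neg _ _).symm
      exact tendsto_neg_atTop_atBot.comp ((Real.tendsto_log_atTop.comp
        tendsto_norm_cobounded_atTop).const_mul_atTop hk)
  refine ((D.oW.continuous.tendsto 0).comp hG).congr' ?_
  filter_upwards [tendsto_norm_cobounded_atTop.eventually_gt_atTop (0 : ℝ)] with x hx
  exact (h1 (x, 0) (norm_pos_iff.1 hx) (hc0 x)).1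

theorem chi_exists {c : ℝ} (hc : 0 < c) {k : ℝ} (hk : 0 < k) (s0 : Metric.sphere (0 : V) 1) :
    IsOpenEmbedding (fun q : (Metric.sphere (0 : V) 1 × ℝ) × ℝ =>
      ((Real.exp (- q.2 / k) • (q.1.1 : V), c * Real.exp (q.2 / k) * q.1.2) : V × ℝ)) := by
  classical
  set g : V × ℝ → (Metric.sphere (0 : V) 1 × ℝ) × ℝ := fun p =>
    if h : p.1 ∈ ({0}ᶜ : Set V) then ((((pol V).symm ⟨_, h⟩).1, ‖p.1‖ / c * p.2), - k * Real.log ‖p.1‖)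
    else ((s0, 0), 0) with hg
  have hn : ∀ q : (Metric.sphere (0 : V) 1 × ℝ) × ℝ, ‖Real.exp (- q.2 / k) • (q.1.1 : V)‖ =
      Real.exp (- q.2 / k) := fun q => by
    rw [norm_smul, norm_eq_of_mem_sphere, mul_one, Real.norm_eq_abs, abs_of_pos (Real.exp_pos _)]
  have hR : IsOpen {p : V × ℝ | p.1 ∈ ({0}ᶜ : Set V)} :=
    isOpen_compl_singleton.preimage continuous_fst
  have hm : ∀ q : (Metric.sphere (0 : V) 1 × ℝ) × ℝ, Real.exp (- q.2 / k) • (q.1.1 : V) ∈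
      ({0}ᶜ : Set V) := fun q => norm_pos_iff.1 (by rw [hn]; exact Real.exp_pos _)
  refine openEmb_of_inv (by fun_prop) hR g ?_ hm ?_ ?_
  · rw [continuousOn_iff_continuous_domRestrict]
    have : {p : V × ℝ | p.1 ∈ ({0}ᶜ : Set V)}.domRestrict g =
      fun p : {p : V × ℝ | p.1 ∈ ({0}ᶜ : Set V)} => ((((pol V).symm ⟨(p : V × ℝ).1, p.2⟩).1,
      ‖(p : V × ℝ).1‖ / c * (p : V × ℝ).2), - k * Real.log ‖(p : V × ℝ).1‖) := by
      ext1 p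
      exact dif_pos p.2
    rw [this]
    refine Continuous.prodMk (Continuous.prodMk
      (continuous_fst.comp ((pol V).symm.continuous.comp (by fun_prop))) (by fun_prop)) ?_
    exact continuous_const.mul (Continuous.log (by fun_prop) fun p => norm_ne_zero_iff.2 p.2)
  · intro q
    simp only [hg]
    rw [dif_pos (hm q)]
    ext1
    · ext1
      · ext1
        simp only [pol_symm_fst]
        rw [hn, smul_smul, inv_mul_cancel₀ (Real.exp_pos _).ne', one_smul]
      · simp only
        rw [hn, neg_div, Real.exp_neg]
        have := Real.exp_pos (q.2 / k)
        field_simp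
    · simp only
      rw [hn, Real.log_exp]; field_simp
  · intro p hp
    have hp' : p.1 ∈ ({0}ᶜ : Set V) := hp
    have hpos := norm_pos_iff.2 hp'
    simp only [hg]
    rw [dif_pos hp']
    simp only [pol_symm_fst]
    have e1 : Real.exp (-(-k * Real.log ‖p.1‖) / k) = ‖p.1‖ := by
      rw [show -(-k * Real.log ‖p.1‖) / k = Real.log ‖p.1‖ by field_simp, Real.exp_log hpos]
    have e2 : Real.exp ((-k * Real.log ‖p.1‖) / k) = ‖p.1‖⁻¹ := by
      rw [show (-k * Real.log ‖p.1‖) / k = -Real.log ‖p.1‖ by field_simp, Real.exp_neg, Real.exp_log hpos]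
    ext1
    · simp only
      rw [e1, smul_smul, mul_inv_cancel₀ hpos.ne', one_smul]
    · simp only
      rw [e2]; field_simp

theorem Dat.main [ProperSpace V] (D : Dat F jU jW a b k) (hd : 2 ≤ d)
    (eA : OnePoint (EuclideanSpace ℝ (Fin d)) ≃ₜ Metric.sphere (0 : V) 1)
    (eB : OnePoint (EuclideanSpace ℝ (Fin d) × ℝ) ≃ₜ Metric.sphere (0 : E) 1)
    (spl : E ≃L[ℝ] V × ℝ) :
    ∃ H : E ≃ₜ E, H 0 = 0 ∧ ∀ x, x ≠ 0 → ((spl x).2 = 0 ↔ ∃ v : V, v ≠ 0 ∧ jW (H x) = jU (v, 0)) := by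
  obtain ⟨c, G, hc, h1, C, h2⟩ := D.exists_c
  have hk : (0 : ℝ) < k := Nat.cast_pos.2 D.hk
  obtain ⟨u, hu, hur, hu0, -⟩ := usq_exists ℝ
  have hu1 : ∀ t, |u t| < 1 := fun t => by
    have : u t ∈ Metric.ball (0 : ℝ) 1 := hur ▸ mem_range_self t
    simpa using this
  set χ : (Metric.sphere (0 : V) 1 × ℝ) × ℝ → V × ℝ := fun q =>
    (Real.exp (- q.2 / k) • (q.1.1 : V), c * Real.exp (q.2 / k) * u q.1.2) with hχ
  have χo : IsOpenEmbedding χ := (chi_exists hc hk (eA OnePoint.infty)).comp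
    ((IsOpenEmbedding.id.prodMap hu).prodMap IsOpenEmbedding.id)
  have χn : ∀ q, ‖(χ q).1‖ = Real.exp (- q.2 / k) := fun q => by
    simp only [hχ]
    rw [norm_smul, norm_eq_of_mem_sphere, mul_one, Real.norm_eq_abs, abs_of_pos (Real.exp_pos _)]
  have χ0 : ∀ q, (χ q).1 ≠ 0 := fun q => norm_pos_iff.1 (by rw [χn]; exact Real.exp_pos _)
  have χc : ∀ q, ‖(χ q).1‖ * |(χ q).2| ≤ c := fun q => by
    rw [χn]
    simp only [hχ]
    rw [abs_mul, abs_mul, abs_of_pos hc, abs_of_pos (Real.exp_pos _), neg_div, Real.exp_neg]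
    have := Real.exp_pos (q.2 / k)
    rw [show (Real.exp (q.2 / k))⁻¹ * (c * Real.exp (q.2 / k) * |u q.1.2|) = c * |u q.1.2| by field_simp]
    exact mul_le_of_le_one_right hc.le (hu1 _).le
  set Ψ : (Metric.sphere (0 : V) 1 × ℝ) × ℝ → ({0}ᶜ : Set E) := fun q =>
    ⟨G (χ q), (h1 _ (χ0 q) (χc q)).2⟩ with hΨ
  have Ψj : ∀ q, jW (Ψ q) = jU (χ q) := fun q => (h1 _ (χ0 q) (χc q)).1
  have Ψo : IsOpenEmbedding Ψ := by
    refine IsOpenEmbedding.of_comp (g := fun y : ({0}ᶜ : Set E) => jW y) Ψ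
      (D.oW.comp isOpen_compl_singleton.isOpenEmbedding_subtypeVal) ?_
    have : (fun y : ({0}ᶜ : Set E) => jW y) ∘ Ψ = jU ∘ χ := funext Ψj
    rw [this]; exact D.oU.comp χo
  obtain ⟨H, H0, H1⟩ := lemG hd eA eB spl Ψo ⟨C, fun q => by
    have := h2 _ (χ0 q) (χc q)
    rw [χn, Real.log_exp] at this
    rw [show (k : ℝ) * (-q.2 / k) = - q.2 by field_simp] at this
    exact this⟩
  refine ⟨H, H0, fun x hx => (H1 x hx).trans ?_⟩
  have χz : ∀ s r, χ ((s, 0), r) = (((pol V (s, -r / k) : ({0}ᶜ : Set V)) : V), (0 : ℝ)) := fun s r => by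
    simp only [hχ, hu0, mul_zero]; rfl
  constructor
  · rintro ⟨s, r, h⟩
    refine ⟨_, (pol V (s, -r / k)).2, ?_⟩
    rw [h, Ψj, χz]
  · rintro ⟨v, hv, h⟩
    refine ⟨((pol V).symm ⟨v, hv⟩).1, - k * ((pol V).symm ⟨v, hv⟩).2, ?_⟩
    apply D.oW.injective
    rw [h, Ψj, χz]
    rw [show - (- k * ((pol V).symm ⟨v, hv⟩).2) / (k : ℝ) = ((pol V).symm ⟨v, hv⟩).2 by field_simp]
    simp

end GM
end LFS


open Filter Topology

namespace LFS
open Set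

section Dyn
variable {M : Type*}

theorem cluster_recurrent [MetricSpace M] (f : M ≃ₜ M) {x y : M}
    (h : MapClusterPt y atTop (fun j : ℕ => (⇑f)^[j] x)) : ChainRecurrent (⇑f) y := by
  intro ε hε
  have hO : Metric.ball y ε ∩ f ⁻¹' Metric.ball (f y) ε ∈ 𝓝 y :=
    inter_mem (Metric.ball_mem_nhds _ hε)
      (f.continuous.continuousAt.preimage_mem_nhds (Metric.ball_mem_nhds _ hε))
  have hfr := mapClusterPt_iff_frequently.1 h _ hO
  rw [frequently_atTop] at hfr
  obtain ⟨i, -, hi⟩ := hfr 0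
  obtain ⟨j, hj, hj2⟩ := hfr (i + 2)
  refine ⟨2, two_pos, ![y, (⇑f)^[i + 1] x, y], ![1, j - i - 1], rfl, rfl, ?_, ?_⟩
  · intro l
    fin_cases l
    · simp
    · simp; omega
  · intro l
    fin_cases l
    · have : f ((⇑f)^[i] x) ∈ Metric.ball (f y) ε := hi.2
      rw [← Function.iterate_succ_apply' (⇑f), Metric.mem_ball, dist_comm] at this
      simpa using this
    · have : (⇑f)^[j] x ∈ Metric.ball y ε := hj2.1
      show dist ((⇑f)^[j - i - 1] ((⇑f)^[i + 1] x)) y < ε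
      rw [← Function.iterate_add_apply, show j - i - 1 + (i + 1) = j by omega]
      exact this

theorem conv_of_finite [TopologicalSpace M] [CompactSpace M] [T2Space M] {G : M → M}
    (hG : Continuous G) {u : ℕ → M} (hu : ∀ j, u (j + 1) = G (u j)) {R : Set M} (hR : R.Finite)
    (hc : ∀ y, MapClusterPt y atTop u → y ∈ R) (hf : ∀ q ∈ R, G q = q) :
    ∃ q ∈ R, Tendsto u atTop (𝓝 q) := by
  classical
  obtain ⟨q, -, hq⟩ := isCompact_univ.exists_mapClusterPt (f := atTop) (u := u) (by simp)
  refine ⟨q, hc q hq, ?_⟩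
  rw [tendsto_nhds]
  intro O hO hqO
  obtain ⟨U, hU, hUd⟩ := hR.t2_separation
  set A : M → Set M := fun q' => if q' = q then U q' ∩ O else U q' with hA
  have AU : ∀ q', A q' ⊆ U q' := fun q' => by
    simp only [hA]; split_ifs
    · exact inter_subset_left
    · exact subset_rfl
  have Ao : ∀ q', IsOpen (A q') := fun q' => by
    simp only [hA]; split_ifs
    · exact (hU q').2.inter hO
    · exact (hU q').2
  have Am : ∀ q', q' ∈ A q' := fun q' => by
    simp only [hA]; split_ifs with h
    · exact ⟨(hU q').1, h ▸ hqO⟩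
    · exact (hU q').1
  have Aq : A q ⊆ O := by simp only [hA, if_true]; exact inter_subset_right
  set B : M → Set M := fun q' => A q' ∩ G ⁻¹' A q' with hB
  have Bo : ∀ q', IsOpen (B q') := fun q' => (Ao q').inter ((Ao q').preimage hG)
  have Bm : ∀ q' ∈ R, q' ∈ B q' := fun q' h => ⟨Am q', by rw [mem_preimage, hf q' h]; exact Am q'⟩
  have ev : ∀ᶠ j in atTop, u j ∈ ⋃ q' ∈ R, B q' := by
    by_contra hne
    rw [not_eventually] at hne
    have hcl : IsCompact (⋃ q' ∈ R, B q')ᶜ :=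
      (isOpen_biUnion fun q' _ => Bo q').isClosed_compl.isCompact
    obtain ⟨y, hy, hy2⟩ := hcl.exists_mapClusterPt_of_frequently hne
    exact hy (mem_biUnion (hc y hy2) (Bm y (hc y hy2)))
  have fr := mapClusterPt_iff_frequently.1 hq _ ((Bo q).mem_nhds (Bm q (hc q hq)))
  obtain ⟨j0, hj0⟩ := eventually_atTop.1 ev
  rw [frequently_atTop] at fr
  obtain ⟨j1, hj1, hj1q⟩ := fr j0
  have ind : ∀ j, u (j1 + j) ∈ B q := by
    intro j
    induction j with
    | zero => exact hj1q
    | succ j ih =>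
      have h1 : u (j1 + (j + 1)) ∈ A q := by rw [← add_assoc, hu]; exact ih.2
      obtain ⟨q', hq', h2⟩ := mem_iUnion₂.1 (hj0 (j1 + (j + 1)) (by omega))
      by_cases h : q' = q
      · subst h; exact h2
      · exact (disjoint_left.1 (hUd hq' (hc q hq) h) (AU _ h2.1) (AU _ h1)).elim
  rw [mem_atTop_sets]
  refine ⟨j1, fun j hj => ?_⟩
  obtain ⟨i, rfl⟩ := Nat.exists_eq_add_of_le hj
  exact Aq (ind i).1

theorem exists_stable [MetricSpace M] [CompactSpace M] {n : ℕ} (f : M ≃ₜ M) (hf : RegularHomeo n f)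
    (x : M) : ∃ q ∈ chainRecurrentSet (⇑f), x ∈ stableSet f q := by
  obtain ⟨hfin, hhyp⟩ := hf
  have hper : ∀ q ∈ chainRecurrentSet (⇑f), 0 < Function.minimalPeriod (⇑f) q := fun q hq => by
    obtain ⟨i, -, m, hm, -, h, -⟩ := hhyp q hq
    rw [h]; exact hm
  set L := ∏ q ∈ hfin.toFinset, Function.minimalPeriod (⇑f) q with hL
  have hdvd : ∀ q ∈ chainRecurrentSet (⇑f), Function.minimalPeriod (⇑f) q ∣ L := fun q hq =>
    Finset.dvd_prod_of_mem _ (hfin.mem_toFinset.2 hq)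
  have hL0 : 0 < L := Finset.prod_pos fun q hq => hper q (hfin.mem_toFinset.1 hq)
  have hc : Continuous (⇑f) := f.continuous
  obtain ⟨q, hq, ht⟩ := conv_of_finite (G := (⇑f)^[L]) (hc.iterate L)
    (u := fun j => (⇑f)^[j * L] x) (R := chainRecurrentSet (⇑f))
    (fun j => by rw [← Function.iterate_add_apply]; congr 1; ring_nf) hfin
    (fun y hy => by
      refine cluster_recurrent f (x := x) ?_
      have : (fun j : ℕ => (⇑f)^[j * L] x) = (fun j => (⇑f)^[j] x) ∘ fun j => j * L := rfl
      rw [this] at hy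
      refine MapClusterPt.of_comp (φ := fun j => j * L) ?_ hy
      exact tendsto_id.atTop_mul_const' hL0)
    (fun q hq => (Function.isPeriodicPt_minimalPeriod (⇑f) q).trans_dvd (hdvd q hq))
  refine ⟨q, hq, ?_⟩
  obtain ⟨c, hcm⟩ := hdvd q hq
  set m := Function.minimalPeriod (⇑f) q with hm
  have hc0 : 0 < c := Nat.pos_of_ne_zero (by rintro rfl; simp at hcm; omega)
  show Tendsto (fun k : ℕ => (⇑f)^[k * m] x) atTop (𝓝 q)
  rw [tendsto_nhds]
  intro O hO hqO
  have h1 : (⋂ i ∈ Finset.range c, (⇑f)^[i * m] ⁻¹' O) ∈ 𝓝 q := by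
    rw [Filter.biInter_finset_mem]
    intro i _
    refine (hc.iterate (i * m)).continuousAt.preimage_mem_nhds (hO.mem_nhds ?_)
    have : (⇑f)^[i * m] q = q := (Function.isPeriodicPt_minimalPeriod (⇑f) q).const_mul i
    rw [this]; exact hqO
  obtain ⟨j0, hj0⟩ := eventually_atTop.1 (ht.eventually_mem h1)
  rw [mem_atTop_sets]
  refine ⟨j0 * c, fun k hk => ?_⟩
  have h2 := hj0 (k / c) ((Nat.le_div_iff_mul_le hc0).2 hk)
  have h3 := mem_iInter₂.1 h2 (k % c) (Finset.mem_range.2 (Nat.mod_lt _ hc0))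
  rw [mem_preimage, ← Function.iterate_add_apply] at h3
  have e : k % c * m + k / c * L = k * m := by
    rw [hcm]
    calc k % c * m + k / c * (m * c) = (k % c + c * (k / c)) * m := by ring
      _ = k * m := by rw [Nat.mod_add_div]
  rw [e] at h3
  exact h3

end Dyn
end LFS


open Filter Topology

namespace LFS
open Set

section Model
variable {n : ℕ}

theorem euc_norm {n : ℕ} {x y : EuclideanSpace ℝ (Fin n)} {c : ℝ} (hc : 0 ≤ c)
    (h : ∀ j, |y j| = c * |x j|) : ‖y‖ = c * ‖x‖ := by
  rw [EuclideanSpace.norm_eq, EuclideanSpace.norm_eq]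
  have : ∑ i, ‖y i‖ ^ 2 = c ^ 2 * ∑ i, ‖x i‖ ^ 2 := by
    rw [Finset.mul_sum]
    refine Finset.sum_congr rfl fun i _ => ?_
    rw [Real.norm_eq_abs, Real.norm_eq_abs, h]; ring
  rw [this, Real.sqrt_mul (by positivity), Real.sqrt_sq hc]

theorem modelMap_apply (n i : ℕ) (δu δs : ℝ) (x : EuclideanSpace ℝ (Fin n)) (j : Fin n) :
    modelMap n i δu δs x j = (if (j : ℕ) < i then (if (j : ℕ) = 0 then 2 * δu else 2)
      else (if (j : ℕ) = i then δs / 2 else 1 / 2)) * x j := by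
  simp only [modelMap]
  split_ifs <;> rfl

theorem abs_sign {δ : ℝ} (h : δ = 1 ∨ δ = -1) : |δ| = 1 := by
  rcases h with rfl | rfl <;> simp

theorem modelMap_abs_lt {i : ℕ} {δu δs : ℝ} (hu : δu = 1 ∨ δu = -1)
    (x : EuclideanSpace ℝ (Fin n)) {j : Fin n} (hj : (j : ℕ) < i) :
    |modelMap n i δu δs x j| = 2 * |x j| := by
  rw [modelMap_apply, if_pos hj]
  split_ifs <;> simp [abs_mul, abs_sign hu]

theorem modelMap_abs_ge {i : ℕ} {δu δs : ℝ} (hs : δs = 1 ∨ δs = -1)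
    (x : EuclideanSpace ℝ (Fin n)) {j : Fin n} (hj : ¬ (j : ℕ) < i) :
    |modelMap n i δu δs x j| = 2⁻¹ * |x j| := by
  rw [modelMap_apply, if_neg hj]
  split_ifs <;> simp [abs_mul, abs_div, abs_sign hs]

theorem modelMap_surj {i : ℕ} {δu δs : ℝ} (hu : δu = 1 ∨ δu = -1) (hs : δs = 1 ∨ δs = -1) :
    Function.Surjective (modelMap n i δu δs) := by
  intro y
  set c : Fin n → ℝ := fun j => (if (j : ℕ) < i then (if (j : ℕ) = 0 then 2 * δu else 2)
      else (if (j : ℕ) = i then δs / 2 else 1 / 2)) with hc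
  have hc0 : ∀ j, c j ≠ 0 := fun j => by
    have h1 : δu ≠ 0 := by rcases hu with rfl | rfl <;> norm_num
    have h2 : δs ≠ 0 := by rcases hs with rfl | rfl <;> norm_num
    simp only [hc]
    split_ifs <;> simp [h1, h2]
  refine ⟨WithLp.toLp 2 fun j => (c j)⁻¹ * y j, ?_⟩
  ext j
  rw [modelMap_apply]
  show c j * ((c j)⁻¹ * y j) = y j
  rw [← mul_assoc, mul_inv_cancel₀ (hc0 j), one_mul]

theorem modelMap_fix {i : ℕ} {δu δs : ℝ} (hu : δu = 1 ∨ δu = -1) (hs : δs = 1 ∨ δs = -1)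
    {x : EuclideanSpace ℝ (Fin n)} (h : modelMap n i δu δs x = x) : x = 0 := by
  ext j
  show x j = 0
  refine abs_eq_zero.1 ?_
  have h1 := congrArg (fun y : EuclideanSpace ℝ (Fin n) => |y j|) h
  simp only at h1
  by_cases hj : (j : ℕ) < i
  · rw [modelMap_abs_lt hu x hj] at h1; linarith
  · rw [modelMap_abs_ge hs x hj] at h1; linarith

/-- splitting off the last coordinate -/
noncomputable def spl (d : ℕ) : EuclideanSpace ℝ (Fin (d + 1)) ≃L[ℝ] EuclideanSpace ℝ (Fin d) × ℝ :=
  LinearEquiv.toContinuousLinearEquiv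
    { toFun := fun x => (WithLp.toLp 2 fun j => x j.castSucc, x (Fin.last d))
      invFun := fun p => WithLp.toLp 2 (Fin.snoc (α := fun _ => ℝ) (fun j => p.1 j) p.2)
      map_add' := fun x y => rfl
      map_smul' := fun c x => rfl
      left_inv := fun x => by
        ext j
        refine Fin.lastCases ?_ (fun j => ?_) j <;> simp
      right_inv := fun p => by
        ext1
        · ext j; simp
        · simp }

theorem spl_fst (d : ℕ) (x : EuclideanSpace ℝ (Fin (d + 1))) (j : Fin d) :
    (spl d x).1 j = x j.castSucc := rfl
theorem spl_snd (d : ℕ) (x : EuclideanSpace ℝ (Fin (d + 1))) : (spl d x).2 = x (Fin.last d) := rfl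

end Model

section Charts
variable {M : Type*} [MetricSpace M] {n : ℕ}

theorem pow_apply (f : M ≃ₜ M) (m : ℕ) (x : M) : (f ^ m) x = (⇑f)^[m] x := by
  induction m generalizing x with
  | zero => rfl
  | succ m ih => rw [pow_succ, Homeomorph.mul_apply, ih]; rfl

theorem pow_coe (f : M ≃ₜ M) (m : ℕ) : ⇑(f ^ m) = (⇑f)^[m] := funext (pow_apply f m)

theorem pow_symm_coe (f : M ≃ₜ M) (m : ℕ) : ⇑(f ^ m).symm = (⇑f.symm)^[m] := by
  ext x
  rw [Homeomorph.symm_apply_eq, pow_apply]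
  exact ((f.right_inv.iterate m) x).symm

theorem chart_exists {f : M ≃ₜ M} {p : M} {i : ℕ} (h : TopHyperbolic n f p i) :
    0 < Function.minimalPeriod (⇑f) p ∧ (f ^ Function.minimalPeriod (⇑f) p) p = p ∧
    ∃ δu δs : ℝ, (δu = 1 ∨ δu = -1) ∧ (δs = 1 ∨ δs = -1) ∧
      ∃ j : EuclideanSpace ℝ (Fin n) → M, IsOpenEmbedding j ∧ j 0 = p ∧
      ∀ x, (f ^ Function.minimalPeriod (⇑f) p) (j x) = j (modelMap n i δu δs x) := by
  obtain ⟨m, hm, hp, rfl, δu, δs, hu, hs, U, hU, hpU, h, hh⟩ := h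
  refine ⟨hm, by rw [pow_apply]; exact hp, δu, δs, hu, hs, fun x => (h.symm x : U),
    hU.isOpenEmbedding_subtypeVal.comp h.symm.isOpenEmbedding, ?_, ?_⟩
  · have h1 := hh ⟨p, hpU⟩
    have h2 : (⇑f)^[Function.minimalPeriod (⇑f) p] p = p := hp
    simp only [h2] at h1
    have h3 : (⟨p, hpU⟩ : U) = h.symm (modelMap n i δu δs (h ⟨p, hpU⟩)) := Subtype.ext h1
    have h4 := modelMap_fix hu hs ((h.symm_apply_eq.1 h3.symm))
    show ((h.symm 0 : U) : M) = p
    rw [← h4, Homeomorph.symm_apply_apply]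
  · intro x
    rw [pow_apply, hh]; simp

variable {E : Type*} [NormedAddCommGroup E] {F : M ≃ₜ M} {j : E → M} {a : E → E}

theorem iter_chart (hj2 : ∀ x, F (j x) = j (a x)) (k : ℕ) (x : E) :
    (⇑F)^[k] (j x) = j (a^[k] x) := by
  induction k with
  | zero => rfl
  | succ k ih => rw [Function.iterate_succ_apply', ih, hj2, Function.iterate_succ_apply']

theorem tendsto_chart (hj : IsOpenEmbedding j) (hj2 : ∀ x, F (j x) = j (a x)) {z : M}
    (hz : Tendsto (fun k : ℕ => (⇑F)^[k] z) atTop (𝓝 (j 0))) :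
    ∃ (k : ℕ) (q : E), (⇑F)^[k] z = j q ∧ Tendsto (fun k : ℕ => a^[k] q) atTop (𝓝 0) := by
  obtain ⟨k, hk⟩ := (hz.eventually_mem (hj.isOpen_range.mem_nhds (mem_range_self 0))).exists
  obtain ⟨q, hq⟩ := hk
  refine ⟨k, q, hq.symm, ?_⟩
  have h1 := (tendsto_add_atTop_iff_nat k).2 hz
  rw [hj.tendsto_nhds_iff]
  refine h1.congr fun i => ?_
  rw [Function.iterate_add_apply, ← hq, iter_chart hj2]; rfl

theorem mem_of_iter (hj2 : ∀ x, F (j x) = j (a x)) (as : Function.Surjective a) {z : M} {k : ℕ} {q : E}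
    (h : (⇑F)^[k] z = j q) : ∃ q', z = j q' := by
  obtain ⟨q', rfl⟩ := as.iterate k q
  rw [← iter_chart hj2] at h
  exact ⟨q', F.injective.iterate k h⟩

theorem stable_iff (f : M ≃ₜ M) (p z : M) : z ∈ stableSet f p ↔
    Tendsto (fun k : ℕ => (⇑(f ^ Function.minimalPeriod (⇑f) p))^[k] z) atTop (𝓝 p) := by
  rw [pow_coe]
  simp only [← Function.iterate_mul]
  simp only [mul_comm (Function.minimalPeriod (⇑f) p)]
  rfl

theorem unstable_iff (f : M ≃ₜ M) (p z : M) : z ∈ unstableSet f p ↔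
    Tendsto (fun k : ℕ => (⇑(f ^ Function.minimalPeriod (⇑f) p).symm)^[k] z) atTop (𝓝 p) := by
  rw [pow_symm_coe]
  simp only [← Function.iterate_mul]
  simp only [mul_comm (Function.minimalPeriod (⇑f) p)]
  rfl

theorem norm_iter {E' : Type*} {a : E' → E'} {ν : E' → ℝ} {c : ℝ} (h : ∀ x, ν (a x) = c * ν x) (k : ℕ)
    (x : E') : ν (a^[k] x) = c ^ k * ν x := by
  induction k with
  | zero => simp
  | succ k ih => rw [Function.iterate_succ_apply', h, ih]; ring

theorem zero_of_expand {E' : Type*} [TopologicalSpace E'] [Zero E'] {a : E' → E'} {ν : E' → ℝ}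
    (hν : Continuous ν) (hν0 : ν 0 = 0) (hpos : ∀ x, 0 ≤ ν x) (h : ∀ x, ν (a x) = 2 * ν x) {q : E'}
    (ht : Tendsto (fun k : ℕ => a^[k] q) atTop (𝓝 0)) : ν q = 0 := by
  have h1 : Tendsto (fun k : ℕ => ν (a^[k] q)) atTop (𝓝 0) := by
    have := (hν.tendsto 0).comp ht
    rwa [hν0] at this
  refine le_antisymm (ge_of_tendsto h1 (Eventually.of_forall fun k => ?_)) (hpos q)
  rw [norm_iter h]
  exact le_mul_of_one_le_left (hpos q) (one_le_pow₀ one_le_two)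

/-- stable set of a sink -/
theorem sink_stable (f : M ≃ₜ M) {p : M} (h : TopHyperbolic n f p 0) :
    ∃ (j : EuclideanSpace ℝ (Fin n) → M) (b : EuclideanSpace ℝ (Fin n) → EuclideanSpace ℝ (Fin n)),
      IsOpenEmbedding j ∧ j 0 = p ∧ Function.Surjective b ∧ (∀ x, ‖b x‖ = 2⁻¹ * ‖x‖) ∧
      (∀ x, (f ^ Function.minimalPeriod (⇑f) p) (j x) = j (b x)) ∧ stableSet f p = range j := by
  obtain ⟨hm, hp, δu, δs, hu, hs, j, hj, hj0, hj2⟩ := chart_exists h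
  have hn : ∀ x, ‖modelMap n 0 δu δs x‖ = 2⁻¹ * ‖x‖ := fun x =>
    euc_norm (by norm_num) fun i => modelMap_abs_ge hs x (by simp)
  refine ⟨j, modelMap n 0 δu δs, hj, hj0, modelMap_surj hu hs, hn, hj2, ?_⟩
  ext z
  rw [stable_iff]
  constructor
  · intro hz
    rw [← hj0] at hz
    rw [hj0] at hz
    have hz' : Tendsto (fun k : ℕ => (⇑(f ^ Function.minimalPeriod (⇑f) p))^[k] z) atTop (𝓝 (j 0)) := by
      rw [hj0]; exact hz
    obtain ⟨k, q, hq, -⟩ := tendsto_chart hj hj2 hz'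
    obtain ⟨q', rfl⟩ := mem_of_iter hj2 (modelMap_surj hu hs) hq
    exact mem_range_self _
  · rintro ⟨x, rfl⟩
    simp only [iter_chart hj2]
    have : Tendsto (fun k : ℕ => (modelMap n 0 δu δs)^[k] x) atTop (𝓝 0) := by
      rw [tendsto_zero_iff_norm_tendsto_zero]
      simp only [norm_iter (ν := norm) hn]
      have := (tendsto_pow_atTop_nhds_zero_of_lt_one (r := (2⁻¹ : ℝ)) (by norm_num)
        (by norm_num)).mul_const ‖x‖
      simpa using this
    have h3 := (hj.continuous.tendsto 0).comp this
    rw [hj0] at h3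
    exact h3

/-- stable set of a source -/
theorem source_stable (f : M ≃ₜ M) {p z : M} (h : TopHyperbolic n f p n) (hz : z ∈ stableSet f p) :
    z = p := by
  obtain ⟨hm, hp, δu, δs, hu, hs, j, hj, hj0, hj2⟩ := chart_exists h
  have hn : ∀ x, ‖modelMap n n δu δs x‖ = 2 * ‖x‖ := fun x =>
    euc_norm (by norm_num) fun i => modelMap_abs_lt hu x i.2
  rw [stable_iff] at hz
  have hz' : Tendsto (fun k : ℕ => (⇑(f ^ Function.minimalPeriod (⇑f) p))^[k] z) atTop (𝓝 (j 0)) := by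
    rw [hj0]; exact hz
  obtain ⟨k, q, hq, ht⟩ := tendsto_chart hj hj2 hz'
  have h0 := zero_of_expand continuous_norm norm_zero norm_nonneg hn ht
  rw [norm_eq_zero.1 h0, hj0] at hq
  refine (f ^ Function.minimalPeriod (⇑f) p).injective.iterate k ?_
  rw [hq, Function.iterate_fixed hp]

/-- the saddle chart -/
theorem saddle_chart {d : ℕ} (f : M ≃ₜ M) {p : M} (h : TopHyperbolic (d + 1) f p d) :
    ∃ (j : EuclideanSpace ℝ (Fin d) × ℝ → M)
      (a : EuclideanSpace ℝ (Fin d) × ℝ → EuclideanSpace ℝ (Fin d) × ℝ),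
      IsOpenEmbedding j ∧ j 0 = p ∧ Function.Surjective a ∧ (∀ x, ‖(a x).1‖ = 2 * ‖x.1‖) ∧
      (∀ x, |(a x).2| = |x.2| / 2) ∧ (∀ x, a x = x → x = 0) ∧
      (∀ x, (f ^ Function.minimalPeriod (⇑f) p) (j x) = j (a x)) ∧
      unstableSet f p = range (fun x => j (x, 0)) ∧
      ∀ x, j x ∈ stableSet f p → x.1 = 0 := by
  obtain ⟨hm, hp, δu, δs, hu, hs, j, hj, hj0, hj2⟩ := chart_exists h
  set F := f ^ Function.minimalPeriod (⇑f) p with hF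
  set j' := j ∘ (spl d).symm with hj'
  set a := fun x => spl d (modelMap (d + 1) d δu δs ((spl d).symm x)) with ha
  have oj : IsOpenEmbedding j' := hj.comp (spl d).symm.toHomeomorph.isOpenEmbedding
  have j0 : j' 0 = p := by simp [hj', hj0]
  have asj : Function.Surjective a :=
    (spl d).surjective.comp ((modelMap_surj hu hs).comp (spl d).symm.surjective)
  have na1 : ∀ x, ‖(a x).1‖ = 2 * ‖x.1‖ := fun x => by
    refine euc_norm (by norm_num) fun i => ?_
    simp only [ha]
    rw [spl_fst, modelMap_abs_lt hu _ (by simp), ← spl_fst, ContinuousLinearEquiv.apply_symm_apply]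
  have na2 : ∀ x, |(a x).2| = |x.2| / 2 := fun x => by
    simp only [ha]
    rw [spl_snd, modelMap_abs_ge hs _ (by simp), ← spl_snd, ContinuousLinearEquiv.apply_symm_apply]
    ring
  have afix : ∀ x, a x = x → x = 0 := fun x hx => by
    ext1
    · have := na1 x
      rw [hx] at this
      exact norm_eq_zero.1 (by linarith)
    · have := na2 x
      rw [hx] at this
      exact abs_eq_zero.1 (by linarith)
  have hj2' : ∀ x, F (j' x) = j' (a x) := fun x => by
    simp only [hj', ha, Function.comp_apply]; rw [hj2]; simp
  refine ⟨j', a, oj, j0, asj, na1, na2, afix, hj2', ?_, ?_⟩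
  · set b := Function.surjInv asj
    have hb : ∀ x, a (b x) = x := Function.surjInv_eq asj
    have hbj : ∀ x, F.symm (j' x) = j' (b x) := fun x => by
      rw [Homeomorph.symm_apply_eq, hj2', hb]
    have nb1 : ∀ x, ‖(b x).1‖ = 2⁻¹ * ‖x.1‖ := fun x => by
      have := na1 (b x); rw [hb] at this; linarith
    have nb2 : ∀ x, |(b x).2| = 2 * |x.2| := fun x => by
      have := na2 (b x); rw [hb] at this; linarith
    ext z
    rw [unstable_iff]
    constructor
    · intro hz
      have hz' : Tendsto (fun k : ℕ => (⇑F.symm)^[k] z) atTop (𝓝 (j' 0)) := by rw [j0]; exact hz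
      obtain ⟨k, q, hq, -⟩ := tendsto_chart oj hbj hz'
      have hz2 : z = j' (a^[k] q) := by
        rw [← iter_chart hj2', ← hq]
        exact ((F.right_inv.iterate k) z).symm
      rw [hz2] at hz'
      have ht : Tendsto (fun k' : ℕ => b^[k'] (a^[k] q)) atTop (𝓝 0) := by
        rw [oj.tendsto_nhds_iff]
        refine hz'.congr fun i => ?_
        rw [iter_chart hbj]; rfl
      have h0 := zero_of_expand (ν := fun x : EuclideanSpace ℝ (Fin d) × ℝ => |x.2|) (by fun_prop)
        (by simp) (fun x => abs_nonneg _) nb2 ht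
      refine ⟨(a^[k] q).1, ?_⟩
      rw [hz2]
      beta_reduce
      congr 1
      exact Prod.ext rfl (abs_eq_zero.1 h0).symm
    · rintro ⟨x, rfl⟩
      have ht : Tendsto (fun k' : ℕ => b^[k'] (x, 0)) atTop (𝓝 0) := by
        rw [show (0 : EuclideanSpace ℝ (Fin d) × ℝ) = (0, 0) from rfl, nhds_prod_eq,
          tendsto_prod_iff']
        constructor
        · rw [tendsto_zero_iff_norm_tendsto_zero]
          simp only [norm_iter (ν := fun x : EuclideanSpace ℝ (Fin d) × ℝ => ‖x.1‖) nb1]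
          have := (tendsto_pow_atTop_nhds_zero_of_lt_one (r := (2⁻¹ : ℝ)) (by norm_num)
            (by norm_num)).mul_const ‖x‖
          simpa using this
        · rw [tendsto_zero_iff_norm_tendsto_zero]
          simp only [Real.norm_eq_abs]
          simp only [norm_iter (ν := fun x : EuclideanSpace ℝ (Fin d) × ℝ => |x.2|) nb2]
          simp
      have h3 := (oj.continuous.tendsto 0).comp ht
      rw [j0] at h3
      refine h3.congr fun i => ?_
      rw [iter_chart hbj]; rfl
  · intro x hx
    rw [stable_iff] at hx
    have ht : Tendsto (fun k : ℕ => a^[k] x) atTop (𝓝 0) := by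
      rw [oj.tendsto_nhds_iff, j0]
      refine hx.congr fun i => ?_
      rw [iter_chart hj2']; rfl
    exact norm_eq_zero.1 (zero_of_expand (ν := fun x : EuclideanSpace ℝ (Fin d) × ℝ => ‖x.1‖)
      (by fun_prop) (by simp) (fun x => norm_nonneg _) na1 ht)

end Charts
end LFS


open Filter Topology
namespace LFS
open Set

section E5
variable {M : Type*} [MetricSpace M]

theorem stable_unique (f : M ≃ₜ M) {p q z : M} (hp : 0 < Function.minimalPeriod (⇑f) p)
    (hq : 0 < Function.minimalPeriod (⇑f) q) (h1 : z ∈ stableSet f p) (h2 : z ∈ stableSet f q) :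
    p = q := by
  have e1 := Tendsto.comp (show Tendsto _ _ _ from h1)
    (tendsto_id.atTop_mul_const' hq : Tendsto (fun k : ℕ => k * Function.minimalPeriod (⇑f) q) atTop atTop)
  have e2 := Tendsto.comp (show Tendsto _ _ _ from h2)
    (tendsto_id.atTop_mul_const' hp : Tendsto (fun k : ℕ => k * Function.minimalPeriod (⇑f) p) atTop atTop)
  refine tendsto_nhds_unique e1 (e2.congr fun k => ?_)
  simp only [Function.comp]
  congr 1
  ring_nf

theorem mem_stable_self (f : M ≃ₜ M) (p : M) : p ∈ stableSet f p := by
  refine tendsto_const_nhds.congr fun k => ?_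
  exact ((Function.isPeriodicPt_minimalPeriod (⇑f) p).const_mul k).symm

theorem unstable_periodic (f : M ≃ₜ M) {z p : M} (hz : 0 < Function.minimalPeriod (⇑f) z)
    (h : z ∈ unstableSet f p) : z = p := by
  have e1 := Tendsto.comp (show Tendsto _ _ _ from h)
    (tendsto_id.atTop_mul_const' hz : Tendsto (fun k : ℕ => k * Function.minimalPeriod (⇑f) z) atTop atTop)
  refine tendsto_nhds_unique (tendsto_const_nhds.congr fun k => ?_) e1
  simp only [Function.comp, id]
  have h2 : (⇑f)^[k * Function.minimalPeriod (⇑f) z * Function.minimalPeriod (⇑f) p] z = z :=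
    (((Function.isPeriodicPt_minimalPeriod (⇑f) z).const_mul k).mul_const _)
  conv_lhs => rw [← (f.left_inv.iterate (k * Function.minimalPeriod (⇑f) z * Function.minimalPeriod (⇑f) p)) z]
  exact congrArg _ h2

theorem flat_at {d : ℕ} {S : Set M} {j : EuclideanSpace ℝ (Fin (d + 1)) → M} (oj : IsOpenEmbedding j)
    (hS : ∀ x, j x ∈ S ↔ x (Fin.last d) = 0) {z : M} (hz : z ∈ range j) :
    ∃ U : Set M, IsOpen U ∧ z ∈ U ∧ ∃ ψ : U ≃ₜ EuclideanSpace ℝ (Fin (d + 1)),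
      ψ '' {y : U | (y : M) ∈ S} = {y | ∀ i : Fin (d + 1), d ≤ (i : ℕ) → y i = 0} := by
  refine ⟨range j, oj.isOpen_range, hz, oj.isEmbedding.toHomeomorph.symm, ?_⟩
  ext y
  rw [← Homeomorph.preimage_symm]
  simp only [Homeomorph.symm_symm, mem_preimage, mem_setOf_eq]
  rw [show ((oj.isEmbedding.toHomeomorph y : range j) : M) = j y from rfl, hS]
  constructor
  · intro h i hi
    have : i = Fin.last d := Fin.ext (le_antisymm (Nat.lt_succ_iff.1 i.2) hi)
    rw [this, h]
  · intro h
    exact h _ le_rfl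

theorem sphere_of_chart [CompactSpace M] {V : Type*} [NormedAddCommGroup V] [NormedSpace ℝ V] [FiniteDimensional ℝ V]
    [Nontrivial V]
    {c : V → M} (hc : Continuous c) (hi : Function.Injective c) {ω : M} (hω : ω ∉ range c)
    (ht : Tendsto c (cocompact V) (𝓝 ω)) :
    closure (range c) = range c ∪ {ω} ∧ Nonempty ((range c ∪ {ω} : Set M) ≃ₜ OnePoint V) := by
  haveI : NoncompactSpace V := NormedSpace.noncompactSpace ℝ V
  set g : OnePoint V → M := fun x => OnePoint.elim x ω c with hg
  have g0 : g OnePoint.infty = ω := rfl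
  have g1 : ∀ v : V, g (v : OnePoint V) = c v := fun v => rfl
  have gc : Continuous g := by
    rw [OnePoint.continuous_iff]
    refine ⟨?_, hc⟩
    rw [coclosedCompact_eq_cocompact]
    exact ht
  have gi : Function.Injective g := by
    intro x y hxy
    induction x using OnePoint.rec with
    | infty =>
      induction y using OnePoint.rec with
      | infty => rfl
      | coe y => exact absurd ⟨y, hxy.symm⟩ hω
    | coe x =>
      induction y using OnePoint.rec with
      | infty => exact absurd ⟨x, hxy⟩ hω
      | coe y => rw [hi hxy]
  have gr : range g = range c ∪ {ω} := by
    ext z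
    constructor
    · rintro ⟨x, rfl⟩
      induction x using OnePoint.rec with
      | infty => exact Or.inr rfl
      | coe y => exact Or.inl ⟨y, rfl⟩
    · rintro (⟨y, rfl⟩ | h)
      · exact ⟨(y : OnePoint V), rfl⟩
      · exact ⟨OnePoint.infty, h.symm⟩
  have ge : IsClosedEmbedding g := gc.isClosedEmbedding gi
  constructor
  · apply subset_antisymm
    · rw [← gr]
      refine closure_minimal ?_ ge.isClosed_range
      rw [gr]; exact subset_union_left
    · rw [← gr]
      have h3 := gc.range_subset_closure_image_dense (OnePoint.denseRange_coe (X := V))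
      rwa [← range_comp] at h3
  · rw [← gr]
    exact ⟨ge.isEmbedding.toHomeomorph.symm⟩

theorem exists_basin [CompactSpace M] {d : ℕ} (hd : 1 ≤ d) (f : M ≃ₜ M) (hf : RegularHomeo (d + 2) f) (σ : M)
    (hsep : ∀ q : M, q ≠ σ → IsSaddlePt (d + 2) f q → unstableSet f σ ∩ stableSet f q = ∅)
    {j : EuclideanSpace ℝ (Fin (d + 1)) × ℝ → M} (oj : IsOpenEmbedding j) (j0 : j 0 = σ)
    (hu : unstableSet f σ = range (fun x => j (x, 0)))
    (hs : ∀ x, j x ∈ stableSet f σ → x.1 = 0) :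
    ∃ ω, TopHyperbolic (d + 2) f ω 0 ∧ ∀ x : EuclideanSpace ℝ (Fin (d + 1)), x ≠ 0 →
      j (x, 0) ∈ stableSet f ω := by
  have key : ∀ x : EuclideanSpace ℝ (Fin (d + 1)), x ≠ 0 →
      ∃ q, TopHyperbolic (d + 2) f q 0 ∧ j (x, 0) ∈ stableSet f q := by
    intro x hx
    obtain ⟨q, hq, hz⟩ := exists_stable f hf (j (x, 0))
    have hzu : j (x, 0) ∈ unstableSet f σ := by rw [hu]; exact ⟨x, rfl⟩
    obtain ⟨i, hi, hqi⟩ := hf.2 q hq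
    have hzσ : j (x, 0) ≠ σ := by
      rw [← j0]
      intro h
      exact hx (congrArg Prod.fst (oj.injective h))
    rcases Nat.eq_zero_or_pos i with rfl | hi0
    · exact ⟨q, hqi, hz⟩
    rcases hi.eq_or_lt with rfl | hi1
    · exfalso
      have h1 := source_stable f hqi hz
      refine hzσ (unstable_periodic f ?_ hzu)
      rw [h1]; exact (chart_exists hqi).1
    · exfalso
      by_cases hqσ : q = σ
      · subst hqσ
        exact hx (hs _ hz)
      · have := hsep q hqσ ⟨i, hi0, hi1, hqi⟩
        exact (this ▸ (⟨hzu, hz⟩ : j (x, 0) ∈ unstableSet f σ ∩ stableSet f q) : j (x, 0) ∈ (∅ : Set M))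
  obtain ⟨x0, hx0⟩ := exists_ne (0 : EuclideanSpace ℝ (Fin (d + 1)))
  obtain ⟨ω, hω, hzω⟩ := key x0 hx0
  refine ⟨ω, hω, ?_⟩
  have hop : ∀ q, TopHyperbolic (d + 2) f q 0 →
      IsOpen {x : EuclideanSpace ℝ (Fin (d + 1)) | j (x, 0) ∈ stableSet f q} := by
    intro q hq
    obtain ⟨jj, b, h1, -, -, -, -, h2⟩ := sink_stable f hq
    rw [h2]
    have : Continuous fun x : EuclideanSpace ℝ (Fin (d + 1)) => j (x, (0 : ℝ)) :=
      oj.continuous.comp (by fun_prop)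
    exact h1.isOpen_range.preimage this
  have hcon : IsPreconnected ({0}ᶜ : Set (EuclideanSpace ℝ (Fin (d + 1)))) := by
    refine (isConnected_compl_singleton_of_one_lt_rank ?_ 0).isPreconnected
    rw [← Module.finrank_eq_rank]
    simp only [finrank_euclideanSpace, Fintype.card_fin]
    exact_mod_cast Nat.lt_succ_of_le hd
  have h := hcon.subset_left_of_subset_union (hop ω hω)
    (v := ⋃ q ∈ {q | TopHyperbolic (d + 2) f q 0 ∧ q ≠ ω}, {x | j (x, 0) ∈ stableSet f q})
    (isOpen_biUnion fun q hq => hop q hq.1) ?_ ?_ ⟨x0, hx0, hzω⟩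
  · exact fun x hx => h hx
  · rw [Set.disjoint_left]
    intro x hx hx'
    simp only [mem_iUnion] at hx'
    obtain ⟨q, hq, hxq⟩ := hx'
    exact hq.2 (stable_unique f (chart_exists hq.1).1 (chart_exists hω).1 hxq hx)
  · intro x hx
    obtain ⟨q, hq, hxq⟩ := key x hx
    by_cases hqω : q = ω
    · subst hqω; exact Or.inl hxq
    · right
      simp only [mem_iUnion]
      exact ⟨q, ⟨hq, hqω⟩, hxq⟩

theorem final [CompactSpace M] {d : ℕ} (hd : 2 ≤ d) (f : M ≃ₜ M) (hf : RegularHomeo (d + 2) f) (σ : M)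
    (hσ : TopHyperbolic (d + 2) f σ (d + 1))
    (hsep : ∀ q : M, q ≠ σ → IsSaddlePt (d + 2) f q → unstableSet f σ ∩ stableSet f q = ∅) :
    ∃ ω : M,
      (TopHyperbolic (d + 2) f ω 0 ∧
        closure (unstableSet f σ) = unstableSet f σ ∪ {ω}) ∧
      Nonempty ((unstableSet f σ ∪ {ω} : Set M) ≃ₜ
        (Metric.sphere (0 : EuclideanSpace ℝ (Fin (d + 2))) 1)) ∧
      IsLocallyFlatSubmanifold (d + 2) (d + 1) (unstableSet f σ ∪ {ω}) ∧
      ∀ ω' : M, TopHyperbolic (d + 2) f ω' 0 →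
        closure (unstableSet f σ) = unstableSet f σ ∪ {ω'} → ω' = ω := by
  obtain ⟨jU, a, oU, jU0, as, na1, na2, afix, cU, hu, hs⟩ := saddle_chart f hσ
  obtain ⟨ω, hω, hb⟩ := exists_basin (by omega) f hf σ hsep oU jU0 hu hs
  obtain ⟨jW, b, oW, jW0, bs, nb, cW, hW⟩ := sink_stable f hω
  obtain ⟨hmσ, hFσ, -⟩ := chart_exists hσ
  obtain ⟨hmω, hFω, -⟩ := chart_exists hω
  set m := Function.minimalPeriod (⇑f) σ with hm
  obtain ⟨x0, hx0⟩ := exists_ne (0 : EuclideanSpace ℝ (Fin (d + 1)))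
  have ax0 : (a (x0, 0)).2 = 0 := by
    have := na2 (x0, 0)
    simpa using this
  have ax1 : (a (x0, 0)).1 ≠ 0 := by
    have := na1 (x0, 0)
    rw [← norm_ne_zero_iff, this]
    simpa using hx0
  have hFfix : (⇑f)^[m] ω = ω := by
    have h1 := hb x0 hx0
    have h2 := hb _ ax1
    have h3 : (⇑f)^[m] (jU (x0, 0)) ∈ stableSet f ω := by
      rw [← pow_apply, cU]
      have : a (x0, 0) = ((a (x0, 0)).1, 0) := Prod.ext rfl ax0
      rw [this]; exact h2
    have h4 : Tendsto _ _ _ := ((f.continuous.iterate m).tendsto ω).comp (show Tendsto _ _ _ from h1)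
    refine tendsto_nhds_unique h4 (Tendsto.congr (fun k => ?_) (show Tendsto _ _ _ from h3))
    simp only [Function.comp]
    rw [← Function.iterate_add_apply, ← Function.iterate_add_apply, add_comm]
  obtain ⟨k, hk⟩ : Function.minimalPeriod (⇑f) ω ∣ m := Function.IsPeriodicPt.minimalPeriod_dvd hFfix
  have hk0 : 0 < k := by
    rcases Nat.eq_zero_or_pos k with rfl | h
    · omega
    · exact h
  have cW' : ∀ y, (f ^ m) (jW y) = jW (b^[k] y) := by
    intro y
    rw [hk, pow_mul, pow_apply]
    exact ((Function.Semiconj.iterate_right (f := jW) (ga := b)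
      (gb := ⇑(f ^ Function.minimalPeriod (⇑f) ω)) (fun y => (cW y).symm) k) y).symm
  have hωU : ω ∉ range jU := by
    rintro ⟨p, hp⟩
    have h1 : a p = p := by
      apply oU.injective
      rw [← cU, hp, pow_apply, hFfix]
    have h2 : ω = σ := by rw [← hp, afix p h1, jU0]
    have h3 := hb x0 hx0
    rw [h2] at h3
    exact hx0 (hs _ h3)
  have hσω : σ ≠ ω := fun h => hωU ⟨0, by rw [jU0, h]⟩
  have hσW : σ ∉ range jW := by
    rw [← hW]
    intro h
    exact hσω (stable_unique f hmσ hmω (mem_stable_self f σ) h)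
  have D : Dat (f ^ m) jU jW a (b^[k]) k :=
    { oU := oU, oW := oW, cU := cU, cW := cW', na1 := na1, na2 := na2, as := as
      nb := fun y => by rw [norm_iter (ν := fun y => ‖y‖) nb, inv_pow]
      bs := bs.iterate k
      hk := hk0
      h0 := by rw [jW0]; exact hωU
      hUW := fun x hx => by rw [← hW]; exact hb x hx }
  have hωc : ω ∉ range (fun x : EuclideanSpace ℝ (Fin (d + 1)) => jU (x, 0)) := by
    rintro ⟨x, hx⟩
    exact hωU ⟨_, hx⟩
  obtain ⟨hcl, ⟨e⟩⟩ := sphere_of_chart (c := fun x : EuclideanSpace ℝ (Fin (d + 1)) => jU (x, 0))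
    (oU.continuous.comp (by fun_prop)) (fun x y h => congrArg Prod.fst (oU.injective h)) hωc
    (by rw [← jW0]; exact D.tendsto)
  rw [← hu] at hcl e
  refine ⟨ω, ⟨hω, hcl⟩, ⟨e.trans (onePointEquivSphereOfFinrankEq (by simp))⟩, ?_, ?_⟩
  · have hSU : ∀ x : EuclideanSpace ℝ (Fin (d + 1)) × ℝ,
        jU x ∈ unstableSet f σ ∪ {ω} ↔ x.2 = 0 := by
      intro x
      constructor
      · rintro (h | h)
        · rw [hu] at h
          obtain ⟨y, hy⟩ := h
          rw [← oU.injective hy]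
        · exact absurd ⟨x, h⟩ hωU
      · intro h
        left
        rw [hu]
        exact ⟨x.1, by rw [← h]⟩
    obtain ⟨H, H0, hH⟩ := D.main hd (onePointEquivSphereOfFinrankEq (by simp))
      (onePointEquivSphereOfFinrankEq (by simp)) (spl (d + 1))
    rintro z (hz | hz)
    · refine flat_at (j := jU ∘ spl (d + 1)) (oU.comp (spl (d + 1)).toHomeomorph.isOpenEmbedding)
        (fun x => ?_) ?_
      · exact hSU _
      · rw [hu] at hz
        obtain ⟨x, rfl⟩ := hz
        exact ⟨(spl (d + 1)).symm (x, 0), by simp⟩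
    · refine flat_at (j := jW ∘ H) (oW.comp H.isOpenEmbedding) (fun x => ?_) ?_
      · by_cases hx : x = 0
        · subst hx
          simp only [Function.comp, H0, jW0]
          simp
        · have h1 := hH x hx
          rw [spl_snd] at h1
          rw [h1]
          constructor
          · rintro (h | h)
            · rw [hu] at h
              obtain ⟨v, hv⟩ := h
              refine ⟨v, ?_, hv.symm⟩
              rintro rfl
              exact hσW ⟨H x, by rw [← jU0]; exact hv.symm⟩
            · exfalso
              apply hx
              apply H.injective
              rw [H0]
              apply oW.injective
              rw [jW0]; exact h
          · rintro ⟨v, -, hv⟩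
            left
            rw [hu]
            exact ⟨v, hv.symm⟩
      · exact ⟨0, by simp only [Function.comp, H0, jW0]; exact hz.symm⟩
  · intro ω' _ h
    have h1 : ω ∈ unstableSet f σ ∪ {ω'} := by
      rw [← h, hcl]; exact Or.inr rfl
    rcases h1 with h1 | h1
    · rw [hu] at h1; exact absurd h1 hωc
    · exact h1.symm

end E5
end LFS


/-- for a regular homeomorphism `f` of a closed connected topological
`n`-manifold, `n ≥ 4`, and a saddle periodic point `σ` of Morse index `n-1` whose
unstable manifold misses the stable manifolds of all other saddles, there is a unique
sink periodic point `ω` with `cl(W^u_σ) = W^u_σ ∪ {ω}`, and `S_σ = W^u_σ ∪ {ω}` is a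
locally flat `(n-1)`-dimensional sphere in `M`. -/
theorem closure_unstable_is_locally_flat_sphere {n : ℕ} (hn : 4 ≤ n) {M : Type*}
    [MetricSpace M] [CompactSpace M] [ConnectedSpace M] [Nonempty M]
    (hM : IsChartedEuclidean n M)
    (f : M ≃ₜ M) (hf : RegularHomeo n f)
    (σ : M) (hσ : TopHyperbolic n f σ (n - 1))
    (hsep : ∀ q : M, q ≠ σ → IsSaddlePt n f q → unstableSet f σ ∩ stableSet f q = ∅) :
    ∃ ω : M,
      (TopHyperbolic n f ω 0 ∧
        closure (unstableSet f σ) = unstableSet f σ ∪ {ω}) ∧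
      Nonempty ((unstableSet f σ ∪ {ω} : Set M) ≃ₜ
        (Metric.sphere (0 : EuclideanSpace ℝ (Fin n)) 1)) ∧
      IsLocallyFlatSubmanifold n (n - 1) (unstableSet f σ ∪ {ω}) ∧
      ∀ ω' : M, TopHyperbolic n f ω' 0 →
        closure (unstableSet f σ) = unstableSet f σ ∪ {ω'} → ω' = ω := by
  obtain ⟨d, rfl⟩ : ∃ d, n = d + 2 := ⟨n - 2, by omega⟩
  exact LFS.final (by omega) f hf σ hσ hsep
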